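/- Let p be a prime with p ≥ 5 and k an even integer, and let K = Q(√-3). If f ∈ M_k^{(s)}(U_2(O_K), ν_k)_Q (all Fourier coefficients rational) satisfies a_f([[m, α],[ᾱ, n]]) ∈ Z_(p) for all integers m, n and all α ∈ D_K^{-1} with 0 ≤ m ≤ (5k+9)/45, 0 ≤ n ≤ (10k+3)/90 and mn − N(α) ≥ 0, then all Fourier coefficients of f lie in Z_(p), i.e. f ∈ M_k^{(s)}(U_2(O_K), ν_k)_{Z_(p)}. -/

import Mathlib

open Complex Matrix
open scoped ComplexOrder

noncomputable section

/-- `√d_K` for an imaginary quadratic discriminant `d < 0`,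
taken as `√|d| · i` in the upper half plane. -/
def sqrtD (d : ℤ) : ℂ := Real.sqrt (-d) * Complex.I

/-- The ring of integers `O_K = ℤ[(d + √d)/2]` of the imaginary quadratic field of
discriminant `d`, viewed as a subset of `ℂ`. -/
def ringInt (d : ℤ) : Set ℂ :=
  {z | ∃ a b : ℤ, z = (a : ℂ) + (b : ℂ) * (((d : ℂ) + sqrtD d) / 2)}

/-- The inverse different `D_K⁻¹ = O_K / √d_K`. -/
def invDiff (d : ℤ) : Set ℂ := {z | sqrtD d * z ∈ ringInt d}

/-- The Hermitian upper half-space of degree 2: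
`Z` with `(Z - ᵗZ̄)/(2i)` positive definite. -/
def HermitianUpperHalfSpace : Set (Matrix (Fin 2) (Fin 2) ℂ) :=
  {Z | ((Z - Zᴴ).map (fun w => w / (2 * Complex.I))).PosDef}

/-- The lattice `Λ₂(K)`: Hermitian matrices with integral diagonal and
`√d_K ·`(off-diagonal entries) in `O_K`. -/
def LambdaH (d : ℤ) : Set (Matrix (Fin 2) (Fin 2) ℂ) :=
  {H | H.IsHermitian ∧ (∀ i, ∃ n : ℤ, H i i = (n : ℂ)) ∧
    ∀ i j, sqrtD d * H i j ∈ ringInt d}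

/-- Semi-positive elements of `Λ₂(K)`, the index set of Fourier expansions. -/
def HermLattice (d : ℤ) : Set (Matrix (Fin 2) (Fin 2) ℂ) :=
  {H | H ∈ LambdaH d ∧ H.PosSemidef}

/-- The symplectic-form matrix `J₂ = [[0, -1], [1, 0]]` (2×2 blocks). -/
def J2 : Matrix (Fin 2 ⊕ Fin 2) (Fin 2 ⊕ Fin 2) ℂ :=
  Matrix.fromBlocks 0 (-1) 1 0

/-- The Hermitian modular group `U₂(O_K)`:
matrices with entries in `O_K` satisfying `ᵗM̄ J₂ M = J₂`. -/
def HermitianModularGroup (d : ℤ) : Set (Matrix (Fin 2 ⊕ Fin 2) (Fin 2 ⊕ Fin 2) ℂ) :=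
  {M | (∀ i j, M i j ∈ ringInt d) ∧ Mᴴ * J2 * M = J2}

/-- The fractional-linear action `Z ↦ (AZ + B)(CZ + D)⁻¹`. -/
def matAct (M : Matrix (Fin 2 ⊕ Fin 2) (Fin 2 ⊕ Fin 2) ℂ)
    (Z : Matrix (Fin 2) (Fin 2) ℂ) : Matrix (Fin 2) (Fin 2) ℂ :=
  (M.toBlocks₁₁ * Z + M.toBlocks₁₂) * (M.toBlocks₂₁ * Z + M.toBlocks₂₂)⁻¹

/-- The character `ν_k`: `det^{k/2}` for `K = ℚ(√-1)` (i.e. `d = -4`, `k` even),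
and `det^k` for `K = ℚ(√-3)` (i.e. `d = -3`). -/
def nuChar (d k : ℤ) (M : Matrix (Fin 2 ⊕ Fin 2) (Fin 2 ⊕ Fin 2) ℂ) : ℂ :=
  if d = -4 then M.det ^ (k / 2) else M.det ^ k

/-- A Hermitian modular form of degree 2, weight `k` and character `ν_k` for `U₂(O_K)`,
bundled with its Fourier expansion over the semi-positive part of `Λ₂(K)`. -/
structure HermitianModularForm (d k : ℤ) where
  toFun : Matrix (Fin 2) (Fin 2) ℂ → ℂ
  coeff : Matrix (Fin 2) (Fin 2) ℂ → ℂ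
  holo : DifferentiableOn ℂ (fun Z : Fin 2 → Fin 2 → ℂ => toFun (Matrix.of Z))
    {Z | Matrix.of Z ∈ HermitianUpperHalfSpace}
  transform : ∀ M ∈ HermitianModularGroup d, ∀ Z ∈ HermitianUpperHalfSpace,
    toFun (matAct M Z) =
      nuChar d k M * (M.toBlocks₂₁ * Z + M.toBlocks₂₂).det ^ k * toFun Z
  coeff_supported : ∀ H, coeff H ≠ 0 → H ∈ HermLattice d
  expansion : ∀ Z ∈ HermitianUpperHalfSpace,
    HasSum (fun H : HermLattice d =>
      coeff H * Complex.exp (2 * Real.pi * Complex.I * ((H : Matrix (Fin 2) (Fin 2) ℂ) * Z).trace))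
      (toFun Z)

/-- A Hermitian modular form is symmetric if `f(ᵗZ) = f(Z)`. -/
def IsSymmetricHMF {d k : ℤ} (f : HermitianModularForm d k) : Prop :=
  ∀ Z ∈ HermitianUpperHalfSpace, f.toFun Zᵀ = f.toFun Z

/-- `z` is a `p`-integral rational number: `z = a/b` with `p ∤ b`. -/
def IsPIntegral (p : ℕ) (z : ℂ) : Prop :=
  ∃ a b : ℤ, ¬ (p : ℤ) ∣ b ∧ (b : ℂ) * z = (a : ℂ)

/-- `z ≡ w (mod p^l)` in the local ring `ℤ_(p)`, i.e. `(z - w)/p^l` is `p`-integral. -/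
def ModCongr (p l : ℕ) (z w : ℂ) : Prop :=
  IsPIntegral p ((z - w) / (p : ℂ) ^ l)


/-- The lexicographic order on `Λ₂(K)` used to define `ord_p`:
compare first `tr H`, then the `(1,1)`-entry `m`, then (for off-diagonal entry
`(a + b i)/2`) first `a`, then `b`. -/
def lexLt (H H' : Matrix (Fin 2) (Fin 2) ℂ) : Prop :=
  H.trace.re < H'.trace.re ∨
    (H.trace = H'.trace ∧
      ((H 0 0).re < (H' 0 0).re ∨
        (H 0 0 = H' 0 0 ∧
          ((H 0 1).re < (H' 0 1).re ∨
            ((H 0 1).re = (H' 0 1).re ∧ (H 0 1).im < (H' 0 1).im)))))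

/-- The Siegel upper half-space of degree `n`: symmetric complex matrices with
positive definite imaginary part. -/
def SiegelUpperHalfSpace (n : ℕ) : Set (Matrix (Fin n) (Fin n) ℂ) :=
  {Z | Z.IsSymm ∧ ((Z - Zᴴ).map (fun w => w / (2 * Complex.I))).PosDef}

/-- The symplectic-form matrix over `ℤ` in degree `n`. -/
def Jn (n : ℕ) : Matrix (Fin n ⊕ Fin n) (Fin n ⊕ Fin n) ℤ :=
  Matrix.fromBlocks 0 (-1) 1 0

/-- The Siegel modular group `Γ_n = Sp_n(ℤ)` (as a set of `2n × 2n` integer matrices). -/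
def SiegelModularGroup (n : ℕ) : Set (Matrix (Fin n ⊕ Fin n) (Fin n ⊕ Fin n) ℤ) :=
  {M | Mᵀ * Jn n * M = Jn n}

/-- The fractional-linear action of an integral symplectic matrix on the Siegel
upper half-space. -/
def matActS {n : ℕ} (M : Matrix (Fin n ⊕ Fin n) (Fin n ⊕ Fin n) ℤ)
    (Z : Matrix (Fin n) (Fin n) ℂ) : Matrix (Fin n) (Fin n) ℂ :=
  ((M.map (fun a => (a : ℂ))).toBlocks₁₁ * Z + (M.map (fun a => (a : ℂ))).toBlocks₁₂) *
    ((M.map (fun a => (a : ℂ))).toBlocks₂₁ * Z + (M.map (fun a => (a : ℂ))).toBlocks₂₂)⁻¹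

/-- The index lattice of Fourier expansions of Siegel modular forms of level `N`:
semi-positive symmetric rational matrices `T` with `N·T` half-integral,
i.e. `T ∈ (1/N)Λ_n`. -/
def SiegelLattice (n : ℕ) (N : ℕ) : Set (Matrix (Fin n) (Fin n) ℚ) :=
  {T | T.IsSymm ∧ (∀ i, ∃ a : ℤ, (N : ℚ) * T i i = (a : ℚ)) ∧
    (∀ i j, ∃ a : ℤ, 2 * (N : ℚ) * T i j = (a : ℚ)) ∧
    (T.map (fun q => (q : ℝ))).PosSemidef}

/-- A Siegel modular form of degree `n` and weight `k` for a subgroup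
`Γ ⊆ Γ_n = Sp_n(ℤ)` of level `N`, bundled with its Fourier expansion. For the
full modular group take `Γ = SiegelModularGroup n` and `N = 1`. -/
structure SiegelModularForm (n : ℕ) (k : ℤ)
    (Γ : Set (Matrix (Fin n ⊕ Fin n) (Fin n ⊕ Fin n) ℤ)) (N : ℕ) where
  toFun : Matrix (Fin n) (Fin n) ℂ → ℂ
  coeff : Matrix (Fin n) (Fin n) ℚ → ℂ
  holo : DifferentiableOn ℂ (fun Z : Fin n → Fin n → ℂ => toFun (Matrix.of Z))
    {Z | Matrix.of Z ∈ SiegelUpperHalfSpace n}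
  transform : ∀ M ∈ Γ, ∀ Z ∈ SiegelUpperHalfSpace n,
    toFun (matActS M Z) =
      ((M.map (fun a => (a : ℂ))).toBlocks₂₁ * Z +
        (M.map (fun a => (a : ℂ))).toBlocks₂₂).det ^ k * toFun Z
  coeff_supported : ∀ T, coeff T ≠ 0 → T ∈ SiegelLattice n N
  expansion : ∀ Z ∈ SiegelUpperHalfSpace n,
    HasSum (fun T : SiegelLattice n N =>
      coeff T * Complex.exp (2 * Real.pi * Complex.I *
        (((T : Matrix (Fin n) (Fin n) ℚ).map (fun q => (q : ℂ))) * Z).trace))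
      (toFun Z)


/-- A Hermitian cusp form (degree 2, class number one field): the Fourier
coefficients vanish off the positive definite part of the lattice. -/
def IsCuspHMF {d k : ℤ} (f : HermitianModularForm d k) : Prop :=
  ∀ H, ¬ H.PosDef → f.coeff H = 0

/-- `H0 = ord_p f`: `H0` is the minimal element of `Λ₂(K)`, in the lexicographic
order `lexLt`, whose Fourier coefficient is not divisible by `p`. -/
def IsOrdP (p : ℕ) {d k : ℤ} (f : HermitianModularForm d k)
    (H0 : Matrix (Fin 2) (Fin 2) ℂ) : Prop :=
  H0 ∈ HermLattice d ∧ ¬ ModCongr p 1 (f.coeff H0) 0 ∧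
    ∀ H ∈ HermLattice d, lexLt H H0 → ModCongr p 1 (f.coeff H) 0

section LevelOne

open UpperHalfPlane ModularForm ModularFormClass MatrixGroups EisensteinSeries

/-- `a` is the `q`-expansion of a modular form of weight `w` for `SL₂(ℤ)`. -/
def IsMF (w : ℤ) (a : PowerSeries ℂ) : Prop :=
  ∃ f : ModularForm 𝒮ℒ w, qExpansion 1 f = a

lemma IsMF.add {w : ℤ} {a b : PowerSeries ℂ} (ha : IsMF w a) (hb : IsMF w b) :
    IsMF w (a + b) := by
  obtain ⟨f, rfl⟩ := ha
  obtain ⟨g, rfl⟩ := hb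
  exact ⟨f + g, ModularForm.qExpansion_add one_pos one_mem_strictPeriods_SL f g⟩

lemma IsMF.smul {w : ℤ} {a : PowerSeries ℂ} (c : ℂ) (ha : IsMF w a) : IsMF w (c • a) := by
  obtain ⟨f, rfl⟩ := ha
  exact ⟨c • f, ModularForm.qExpansion_smul one_pos one_mem_strictPeriods_SL c f⟩

lemma IsMF.mul {w w' : ℤ} {a b : PowerSeries ℂ} (ha : IsMF w a) (hb : IsMF w' b) :
    IsMF (w + w') (a * b) := by
  obtain ⟨f, rfl⟩ := ha
  obtain ⟨g, rfl⟩ := hb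
  exact ⟨f.mul g, ModularForm.qExpansion_mul one_pos one_mem_strictPeriods_SL f g⟩

lemma IsMF.zero (w : ℤ) : IsMF w 0 := by
  refine ⟨0, ?_⟩
  have h := ModularForm.qExpansion_smul one_pos one_mem_strictPeriods_SL 0 (0 : ModularForm 𝒮ℒ w)
  simpa using h

lemma IsMF.one : IsMF 0 1 := ⟨1, ModularForm.qExpansion_one⟩

lemma IsMF.congr {w w' : ℤ} {a : PowerSeries ℂ} (ha : IsMF w a) (h : w = w') : IsMF w' a :=
  h ▸ ha

lemma IsMF.pow {w : ℤ} {a : PowerSeries ℂ} (ha : IsMF w a) (n : ℕ) :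
    IsMF (n * w) (a ^ n) := by
  induction n with
  | zero => simpa using IsMF.one
  | succ n ih => rw [pow_succ]; exact (ih.mul ha).congr (by push_cast; ring)

lemma IsMF.sum {w : ℤ} {ι : Type*} (s : Finset ι) (a : ι → PowerSeries ℂ)
    (h : ∀ i ∈ s, IsMF w (a i)) : IsMF w (∑ i ∈ s, a i) := by
  classical
  induction s using Finset.induction_on with
  | empty => simpa using IsMF.zero w
  | insert i s hi ih =>
    rw [Finset.sum_insert hi]
    exact (h i (by simp)).add (ih fun j hj => h j (by simp [hj]))

lemma IsMF.sub {w : ℤ} {a b : PowerSeries ℂ} (ha : IsMF w a) (hb : IsMF w b) :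
    IsMF w (a - b) := by
  have := ha.add (hb.smul (-1))
  simpa [sub_eq_add_neg] using this

/-- The submodule of `q`-expansions of weight `w`. -/
def mfSubmodule (w : ℤ) : Submodule ℂ (PowerSeries ℂ) where
  carrier := {a | IsMF w a}
  add_mem' := IsMF.add
  zero_mem' := IsMF.zero w
  smul_mem' c _ h := h.smul c

lemma isMF_E4 : IsMF 4 (qExpansion 1 E₄) := ⟨_, rfl⟩
lemma isMF_E6 : IsMF 6 (qExpansion 1 E₆) := ⟨_, rfl⟩

lemma bernoulli_four_val : bernoulli 4 = -1 / 30 := by decide +kernel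
lemma bernoulli_six_val : bernoulli 6 = 1 / 42 := by decide +kernel

lemma coeff_E4_mem (R : Subring ℂ) (n : ℕ) : (qExpansion 1 E₄).coeff n ∈ R := by
  have h := EisensteinSeries.E_qExpansion_coeff (k := 4) (by norm_num) ⟨2, rfl⟩ n
  rw [show (qExpansion 1 E₄) = qExpansion 1 (E (k := 4) (by norm_num)) from rfl, h]
  split_ifs
  · exact R.one_mem
  · rw [bernoulli_four_val]
    refine R.mul_mem ?_ (natCast_mem R _)
    norm_num

lemma coeff_E6_mem (R : Subring ℂ) (n : ℕ) : (qExpansion 1 E₆).coeff n ∈ R := by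
  have h := EisensteinSeries.E_qExpansion_coeff (k := 6) (by norm_num) ⟨3, rfl⟩ n
  rw [show (qExpansion 1 E₆) = qExpansion 1 (E (k := 6) (by norm_num)) from rfl, h]
  split_ifs
  · exact R.one_mem
  · rw [bernoulli_six_val]
    refine R.mul_mem ?_ (natCast_mem R _)
    norm_num

lemma coeff_E4_zero : (qExpansion 1 E₄).coeff 0 = 1 := by
  simpa using EisensteinSeries.E_qExpansion_coeff (k := 4) (by norm_num) ⟨2, rfl⟩ 0

lemma coeff_E6_zero : (qExpansion 1 E₆).coeff 0 = 1 := by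
  simpa using EisensteinSeries.E_qExpansion_coeff (k := 6) (by norm_num) ⟨3, rfl⟩ 0

/-- Power series all of whose coefficients lie in `R`. -/
def coeffIn (R : Subring ℂ) : Subring (PowerSeries ℂ) where
  carrier := {a | ∀ n, a.coeff n ∈ R}
  mul_mem' ha hb n := by
    rw [PowerSeries.coeff_mul]
    exact R.sum_mem fun i _ => R.mul_mem (ha _) (hb _)
  one_mem' n := by
    rw [PowerSeries.coeff_one]; split_ifs
    exacts [R.one_mem, R.zero_mem]
  add_mem' ha hb n := by rw [map_add]; exact R.add_mem (ha n) (hb n)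
  zero_mem' n := by rw [map_zero]; exact R.zero_mem
  neg_mem' ha n := by rw [map_neg]; exact R.neg_mem (ha n)

lemma qExpansion_discriminant_eq :
    qExpansion 1 CuspForm.discriminant =
      (1 / 1728 : ℂ) • (qExpansion 1 E₄ ^ 3 - qExpansion 1 E₆ ^ 2) := by
  let g : ModularForm 𝒮ℒ 12 :=
    ModularForm.mcast (by decide) (E₄.pow 3) - ModularForm.mcast (by decide) (E₆.pow 2)
  have hg : (CuspForm.discriminant : ℍ → ℂ) = ((1 / 1728 : ℂ) • g : ModularForm 𝒮ℒ 12) := by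
    funext z
    have := discriminant_eq_E₄_cube_sub_E₆_sq z
    change ModularForm.discriminant z = (1 / 1728 : ℂ) * g z
    rw [this]
    simp only [g, coe_mcast, coe_pow, _root_.sub_apply, Pi.pow_apply]
    ring
  rw [hg]
  have h1 := ModularForm.qExpansion_smul one_pos one_mem_strictPeriods_SL (1 / 1728 : ℂ) g
  rw [show (((1 / 1728 : ℂ) • g : ModularForm 𝒮ℒ 12) : ℍ → ℂ) = (1 / 1728 : ℂ) • (g : ℍ → ℂ)
    from rfl, h1]
  congr 1
  simp only [g, FunLike.coe_sub, coe_mcast,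
    ModularForm.qExpansion_sub one_pos one_mem_strictPeriods_SL,
    ModularForm.qExpansion_pow one_pos one_mem_strictPeriods_SL]

lemma coeffIn_discriminant (R : Subring ℂ) (h6 : (1 / 6 : ℂ) ∈ R) :
    qExpansion 1 CuspForm.discriminant ∈ coeffIn R := by
  rw [qExpansion_discriminant_eq]
  intro n
  rw [PowerSeries.coeff_smul, smul_eq_mul]
  refine R.mul_mem ?_ ?_
  · have h : (1 / 1728 : ℂ) = (1 / 6) ^ 6 * 27 := by norm_num
    rw [h]
    exact R.mul_mem (R.pow_mem h6 6) (by exact_mod_cast natCast_mem R 27)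
  · exact (coeffIn R).sub_mem ((coeffIn R).pow_mem (coeff_E4_mem R) 3)
      ((coeffIn R).pow_mem (coeff_E6_mem R) 2) n

lemma exists_discriminant_factor :
    ∃ D : PowerSeries ℂ, qExpansion 1 CuspForm.discriminant = PowerSeries.X * D ∧
      D.coeff 0 = 1 := by
  have h0 := CuspFormClass.qExpansion_coeff_zero CuspForm.discriminant one_pos
    one_mem_strictPeriods_SL
  obtain ⟨D, hD⟩ := PowerSeries.X_dvd_iff.mpr
    (show PowerSeries.constantCoeff (qExpansion 1 CuspForm.discriminant) = 0 by simpa using h0)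
  refine ⟨D, hD, ?_⟩
  have h1 : (qExpansion 1 CuspForm.discriminant).coeff 1 = 1 := discriminant_qExpansion_coeff_one
  rw [hD, show (1 : ℕ) = 0 + 1 from rfl, PowerSeries.coeff_succ_X_mul] at h1
  exact h1

/-- If `D` is an `R`-integral series with constant term `1` and the coefficients of `D * b` below
`N` lie in `R`, then so do those of `b`. -/
lemma coeff_mem_of_unit_mul (R : Subring ℂ) {D b : PowerSeries ℂ} (hD : D ∈ coeffIn R)
    (hD0 : D.coeff 0 = 1) (N : ℕ) (h : ∀ n < N, (D * b).coeff n ∈ R) :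
    ∀ n < N, b.coeff n ∈ R := by
  intro n
  induction n using Nat.strong_induction_on with
  | _ n ih =>
    intro hn
    have h1 := h n hn
    rw [PowerSeries.coeff_mul, Finset.Nat.sum_antidiagonal_eq_sum_range_succ_mk,
      Finset.sum_range_succ', hD0, one_mul] at h1
    have h2 : ∑ i ∈ Finset.range n, D.coeff (i + 1) * b.coeff (n - (i + 1)) ∈ R := by
      refine R.sum_mem fun i hi => R.mul_mem (hD _) (ih _ ?_ ?_)
      · have := Finset.mem_range.mp hi; omega
      · omega
    have h3 := R.sub_mem h1 h2
    simpa using h3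

/-- Sturm-type integrality for level one: coefficients up to `w / 12` control all others. -/
theorem IsMF.coeff_mem (R : Subring ℂ) (h6 : (1 / 6 : ℂ) ∈ R) (n : ℕ) :
    ∀ (w : ℤ) (_ : w < 12 * n) (a : PowerSeries ℂ) (_ : IsMF w a)
      (_ : ∀ j : ℕ, 12 * (j : ℤ) ≤ w → a.coeff j ∈ R), a ∈ coeffIn R := by
  induction n with
  | zero =>
    rintro w hw a ⟨f, rfl⟩ -
    have : f = 0 := rank_zero_iff_forall_zero.mp (levelOne_neg_weight_rank_zero (by simpa using hw)) f
    have h0 : qExpansion 1 (0 : ModularForm 𝒮ℒ w) = 0 := by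
      have h := ModularForm.qExpansion_smul one_pos one_mem_strictPeriods_SL 0 (0 : ModularForm 𝒮ℒ w)
      simpa using h
    rw [this, h0]
    exact (coeffIn R).zero_mem
  | succ n ih =>
    rintro w hw a ⟨f, rfl⟩ ha
    have hz : ∀ w, qExpansion 1 (0 : ModularForm 𝒮ℒ w) = 0 := by
      intro w
      have h := ModularForm.qExpansion_smul one_pos one_mem_strictPeriods_SL 0 (0 : ModularForm 𝒮ℒ w)
      simpa using h
    rcases lt_or_ge w 0 with hneg | hnn
    · rw [rank_zero_iff_forall_zero.mp (levelOne_neg_weight_rank_zero hneg) f, hz]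
      exact (coeffIn R).zero_mem
    rcases Int.even_or_odd w with hev | hodd
    swap
    · rw [levelOne_odd_weight_eq_zero hodd f, hz]
      exact (coeffIn R).zero_mem
    by_cases h2 : w = 2
    · subst h2
      rw [rank_zero_iff_forall_zero.mp levelOne_weight_two_rank_zero f, hz]
      exact (coeffIn R).zero_mem
    obtain ⟨A, B, hAB⟩ : ∃ A B : ℕ, w = A * 4 + B * 6 := by
      obtain ⟨r, rfl⟩ := hev
      lift r to ℕ using (by omega)
      rcases Nat.even_or_odd r with ⟨s, rfl⟩ | ⟨s, rfl⟩
      · exact ⟨s, 0, by push_cast; ring⟩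
      · refine ⟨s - 1, 1, ?_⟩
        have : 1 ≤ s := by
          by_contra h
          exact h2 (by push_cast; omega)
        push_cast [Nat.cast_sub this]; ring
    have hE := ((isMF_E4.pow A).mul (isMF_E6.pow B)).congr hAB.symm
    have hER : qExpansion 1 E₄ ^ A * qExpansion 1 E₆ ^ B ∈ coeffIn R :=
      (coeffIn R).mul_mem ((coeffIn R).pow_mem (coeff_E4_mem R) _)
        ((coeffIn R).pow_mem (coeff_E6_mem R) _)
    have hE0 : (qExpansion 1 E₄ ^ A * qExpansion 1 E₆ ^ B).coeff 0 = 1 := by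
      have h4 := coeff_E4_zero
      have h6 := coeff_E6_zero
      rw [PowerSeries.coeff_zero_eq_constantCoeff_apply] at h4 h6 ⊢
      simp [h4, h6]
    set e := qExpansion 1 E₄ ^ A * qExpansion 1 E₆ ^ B with he
    set c := (qExpansion 1 f).coeff 0 with hc
    have hcR : c ∈ R := ha 0 (by simpa using hnn)
    have hceR : c • e ∈ coeffIn R := fun n => by
      rw [PowerSeries.coeff_smul, smul_eq_mul]; exact R.mul_mem hcR (hER n)
    obtain ⟨g, hg⟩ := IsMF.sub ⟨f, rfl⟩ (hE.smul c)
    have hg0 : (qExpansion 1 g).coeff 0 = 0 := by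
      rw [hg, map_sub, PowerSeries.coeff_smul, hE0]; simp [hc]
    have hfac := qExpansion_eq_qExpansion_discriminant_mul g hg0
    set b := qExpansion 1 (CuspForm.discriminantEquiv (toCuspForm g hg0)) with hb
    obtain ⟨D, hD, hD0⟩ := exists_discriminant_factor
    have hDR : D ∈ coeffIn R := fun n => by
      have := coeffIn_discriminant R h6 (n + 1)
      rwa [hD, PowerSeries.coeff_succ_X_mul] at this
    have hfac' : qExpansion 1 g = PowerSeries.X * (D * b) := by
      rw [hfac, ← mul_assoc, ← hD]; rfl
    have hbR : b ∈ coeffIn R := by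
      refine ih (w - 12) (by push_cast at hw; linarith) b ⟨_, rfl⟩ fun j hj => ?_
      refine coeff_mem_of_unit_mul R hDR hD0 (j + 1) (fun i hi => ?_) j (by omega)
      rw [← PowerSeries.coeff_succ_X_mul, ← hfac', hg, map_sub]
      refine R.sub_mem (ha _ ?_) (hceR _)
      push_cast; have : (i : ℤ) ≤ j := by exact_mod_cast Nat.lt_succ_iff.mp hi
      linarith
    have hfin : qExpansion 1 f = c • e + PowerSeries.X * (D * b) := by
      rw [← hfac', hg]; ring
    rw [hfin]
    refine (coeffIn R).add_mem hceR ((coeffIn R).mul_mem ?_ ((coeffIn R).mul_mem hDR hbR))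
    intro n
    rw [PowerSeries.coeff_X]; split_ifs
    exacts [R.one_mem, R.zero_mem]

end LevelOne

section Convergent

open UpperHalfPlane ModularForm ModularFormClass MatrixGroups EisensteinSeries Manifold

/-- A power series converging on the open unit disc. -/
def Conv (a : PowerSeries ℂ) : Prop :=
  ∀ q : ℂ, ‖q‖ < 1 → Summable fun n => a.coeff n * q ^ n

/-- `e^{2πiτ}`. -/
def qp (τ : ℍ) : ℂ := Complex.exp (2 * Real.pi * Complex.I * τ)

lemma norm_qp (τ : ℍ) : ‖qp τ‖ = Real.exp (-(2 * Real.pi * τ.im)) := by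
  rw [qp, Complex.norm_exp]
  congr 1
  simp

lemma norm_qp_lt_one (τ : ℍ) : ‖qp τ‖ < 1 := by
  rw [norm_qp, Real.exp_lt_one_iff]
  have := mul_pos Real.two_pi_pos τ.im_pos
  linarith

lemma qp_eq_qParam (τ : ℍ) : Function.Periodic.qParam 1 τ = qp τ := by
  simp [Function.Periodic.qParam, qp]

lemma exists_qp_eq {q : ℂ} (h0 : q ≠ 0) (h1 : ‖q‖ < 1) : ∃ τ : ℍ, qp τ = q := by
  refine ⟨⟨Complex.log q / (2 * Real.pi * Complex.I), ?_⟩, ?_⟩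
  · have h2 : Real.log ‖q‖ < 0 := Real.log_neg (norm_pos_iff.mpr h0) h1
    have h3 : (Complex.log q / (2 * Real.pi * Complex.I)).im
        = -(Real.log ‖q‖) / (2 * Real.pi) := by
      rw [show Complex.log q / (2 * Real.pi * Complex.I)
        = Complex.log q * (-Complex.I) * ((1 / (2 * Real.pi) : ℝ) : ℂ) by
          push_cast; field_simp; rw [Complex.I_sq]; ring, Complex.im_mul_ofReal]
      simp [Complex.log_re]
      ring
    rw [h3]
    exact div_pos (by linarith) Real.two_pi_pos
  · rw [qp]
    have : (2 * Real.pi * Complex.I : ℂ) ≠ 0 := Complex.two_pi_I_ne_zero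
    rw [UpperHalfPlane.coe_mk, mul_div_cancel₀ _ this, Complex.exp_log h0]

lemma conv_of_qp {a : PowerSeries ℂ} (h : ∀ τ : ℍ, Summable fun n => a.coeff n * qp τ ^ n) :
    Conv a := by
  intro q hq
  rcases eq_or_ne q 0 with rfl | h0
  · refine summable_of_ne_finset_zero (s := {0}) fun n hn => ?_
    rw [zero_pow (by simpa using hn), mul_zero]
  · obtain ⟨τ, rfl⟩ := exists_qp_eq h0 hq
    exact h τ

/-- The value of a power series at `e^{2πiτ}`. -/
def ev (a : PowerSeries ℂ) (τ : ℍ) : ℂ := ∑' n, a.coeff n * qp τ ^ n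

lemma Conv.summable {a : PowerSeries ℂ} (ha : Conv a) (τ : ℍ) :
    Summable fun n => a.coeff n * qp τ ^ n := ha _ (norm_qp_lt_one τ)

lemma Conv.hasSum {a : PowerSeries ℂ} (ha : Conv a) (τ : ℍ) :
    HasSum (fun n => a.coeff n * qp τ ^ n) (ev a τ) := (ha.summable τ).hasSum

lemma Conv.add {a b : PowerSeries ℂ} (ha : Conv a) (hb : Conv b) : Conv (a + b) := fun q hq => by
  simpa [add_mul] using (ha q hq).add (hb q hq)

lemma ev_add {a b : PowerSeries ℂ} (ha : Conv a) (hb : Conv b) (τ : ℍ) :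
    ev (a + b) τ = ev a τ + ev b τ := by
  have := (ha.hasSum τ).add (hb.hasSum τ)
  refine (HasSum.tsum_eq ?_)
  simpa [add_mul] using this

lemma Conv.smul {a : PowerSeries ℂ} (c : ℂ) (ha : Conv a) : Conv (c • a) := fun q hq => by
  simpa [mul_assoc] using (ha q hq).mul_left c

lemma ev_smul (a : PowerSeries ℂ) (c : ℂ) (τ : ℍ) : ev (c • a) τ = c * ev a τ := by
  simp only [ev, PowerSeries.coeff_smul, smul_eq_mul, mul_assoc, tsum_mul_left]

lemma coeff_mul_mul_pow (a b : PowerSeries ℂ) (q : ℂ) (n : ℕ) :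
    (a * b).coeff n * q ^ n = ∑ kl ∈ (Finset.HasAntidiagonal.antidiagonal n : Finset (ℕ × ℕ)),
      (a.coeff kl.1 * q ^ kl.1) * (b.coeff kl.2 * q ^ kl.2) := by
  rw [PowerSeries.coeff_mul, Finset.sum_mul]
  refine Finset.sum_congr rfl fun kl hkl => ?_
  rw [← Finset.HasAntidiagonal.mem_antidiagonal.mp hkl, pow_add]
  ring

lemma hasSum_powerSeries_mul {a b : PowerSeries ℂ} {q x y : ℂ}
    (ha : HasSum (fun n => a.coeff n * q ^ n) x) (hb : HasSum (fun n => b.coeff n * q ^ n) y) :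
    HasSum (fun n => (a * b).coeff n * q ^ n) (x * y) := by
  have ha' := ha.summable.norm
  have hb' := hb.summable.norm
  have h1 := tsum_mul_tsum_eq_tsum_sum_antidiagonal_of_summable_norm ha' hb'
  have h2 := (summable_norm_sum_mul_antidiagonal_of_summable_norm ha' hb').of_norm
  rw [ha.tsum_eq, hb.tsum_eq] at h1
  simp_rw [coeff_mul_mul_pow]
  rw [h1]
  exact h2.hasSum

lemma Conv.mul {a b : PowerSeries ℂ} (ha : Conv a) (hb : Conv b) : Conv (a * b) := fun q hq =>
  (hasSum_powerSeries_mul (ha q hq).hasSum (hb q hq).hasSum).summable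

lemma ev_mul {a b : PowerSeries ℂ} (ha : Conv a) (hb : Conv b) (τ : ℍ) :
    ev (a * b) τ = ev a τ * ev b τ :=
  (hasSum_powerSeries_mul (ha.hasSum τ) (hb.hasSum τ)).tsum_eq

lemma conv_one : Conv 1 := fun q _ => by
  refine summable_of_ne_finset_zero (s := {0}) fun n hn => ?_
  rw [PowerSeries.coeff_one, if_neg (by simpa using hn), zero_mul]

lemma ev_one (τ : ℍ) : ev 1 τ = 1 := by
  rw [ev, tsum_eq_single 0 fun n hn => by rw [PowerSeries.coeff_one, if_neg hn, zero_mul]]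
  simp

lemma conv_X : Conv PowerSeries.X := fun q _ => by
  refine summable_of_ne_finset_zero (s := {1}) fun n hn => ?_
  rw [PowerSeries.coeff_X, if_neg (by simpa using hn), zero_mul]

lemma ev_X (τ : ℍ) : ev PowerSeries.X τ = qp τ := by
  rw [ev, tsum_eq_single 1 fun n hn => by rw [PowerSeries.coeff_X, if_neg hn, zero_mul]]
  simp [PowerSeries.coeff_X]

/-- The subring of power series converging on the unit disc. -/
def convRing : Subring (PowerSeries ℂ) where
  carrier := {a | Conv a}
  mul_mem' := Conv.mul
  one_mem' := conv_one
  add_mem' := Conv.add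
  zero_mem' := by simpa using conv_one.smul 0
  neg_mem' := fun {a} h => by simpa using Conv.smul (-1) h

/-- Evaluation at `τ` as a ring homomorphism. -/
def evHom (τ : ℍ) : convRing →+* ℂ where
  toFun a := ev a τ
  map_one' := ev_one τ
  map_mul' a b := ev_mul a.2 b.2 τ
  map_zero' := by simp [ev]
  map_add' a b := ev_add a.2 b.2 τ

lemma Conv.pow {a : PowerSeries ℂ} (ha : Conv a) (n : ℕ) : Conv (a ^ n) :=
  convRing.pow_mem ha n

lemma ev_pow {a : PowerSeries ℂ} (ha : Conv a) (n : ℕ) (τ : ℍ) : ev (a ^ n) τ = ev a τ ^ n :=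
  map_pow (evHom τ) ⟨a, ha⟩ n

lemma conv_sum {ι : Type*} (s : Finset ι) (a : ι → PowerSeries ℂ) (h : ∀ i ∈ s, Conv (a i)) :
    Conv (∑ i ∈ s, a i) := convRing.sum_mem h

lemma ev_sum {ι : Type*} (s : Finset ι) (a : ι → PowerSeries ℂ) (h : ∀ i, Conv (a i))
    (τ : ℍ) : ev (∑ i ∈ s, a i) τ = ∑ i ∈ s, ev (a i) τ := by
  have := map_sum (evHom τ) (fun i => (⟨a i, h i⟩ : convRing)) s
  have h2 : ((∑ i ∈ s, (⟨a i, h i⟩ : convRing) : convRing) : PowerSeries ℂ) = ∑ i ∈ s, a i := by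
    simp
  rw [← h2]
  exact this

lemma coe_S_smul (τ : ℍ) : ((ModularGroup.S • τ : ℍ) : ℂ) * τ = -1 := by
  rw [modular_S_smul, UpperHalfPlane.coe_mk, inv_mul_eq_div, div_eq_iff (neg_ne_zero.mpr τ.ne_zero)]
  ring

lemma hasFPowerSeriesOnBall_ofScalars {a : ℕ → ℂ} {g : ℂ → ℂ}
    (h : ∀ u : ℂ, ‖u‖ < 1 → HasSum (fun n => a n * u ^ n) (g u)) :
    HasFPowerSeriesOnBall g (.ofScalars ℂ a) 0 1 := by
  constructor
  · refine le_of_forall_lt_imp_le_of_dense fun r hr => ?_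
    lift r to NNReal using hr.ne_top
    apply FormalMultilinearSeries.le_radius_of_summable
    have hr' : ‖((r : ℝ) : ℂ)‖ < 1 := by simpa using hr
    simpa [smul_eq_mul, norm_mul, mul_comm] using (h _ hr').summable.norm
  · simp
  · intro y hy
    rw [← ENNReal.coe_one, Metric.eball_coe, NNReal.coe_one, mem_ball_zero_iff] at hy
    simpa [mul_comm] using h y hy

/-- A convergent `q`-series with the right behaviour under `τ ↦ -1/τ` is a modular form. -/
theorem isMF_of_S {w : ℤ} {a : PowerSeries ℂ} (ha : Conv a)
    (hS : ∀ τ τ' : ℍ, (τ' : ℂ) * τ = -1 → ev a τ' = (τ : ℂ) ^ w * ev a τ) : IsMF w a := by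
  have hsum : ∀ τ : ℍ, HasSum (fun m => a.coeff m • Function.Periodic.qParam 1 τ ^ m) (ev a τ) := by
    intro τ
    simpa [qp_eq_qParam] using ha.hasSum τ
  have hSl : (ev a) ∣[w] ModularGroup.S = ev a := by
    funext τ
    rw [SL_slash_apply, hS τ _ (coe_S_smul τ), ModularGroup.denom_S, mul_comm, ← mul_assoc, ← zpow_add₀ τ.ne_zero]
    simp
  have hTl : (ev a) ∣[w] ModularGroup.T = ev a := by
    funext τ
    have h1 : qp (ModularGroup.T • τ) = qp τ := by
      rw [qp, qp, modular_T_smul]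
      simp only [UpperHalfPlane.coe_vadd, ofReal_one, mul_add, Complex.exp_add, mul_one]
      simp [Complex.exp_two_pi_mul_I]
    rw [SL_slash_apply, ev, h1, ModularGroup.denom_apply]
    simp [ModularGroup.T, ev]
  have hγ := SlashInvariantForm.slash_action_generators_SL2Z hSl hTl
  have hb := isBoundedAtImInfty_of_hasSum_qExpansion one_pos hsum
  have hhol : MDiff (ev a) := by
    rw [UpperHalfPlane.mdifferentiable_iff]
    have hF := (hasFPowerSeriesOnBall_ofScalars (a := fun n => a.coeff n)
      (g := fun q => ∑' n, a.coeff n * q ^ n) fun u hu => (ha u hu).hasSum).differentiableOn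
    have hexp : DifferentiableOn ℂ (fun z : ℂ => Complex.exp (2 * Real.pi * Complex.I * z))
        upperHalfPlaneSet := by fun_prop
    refine (hF.comp hexp fun z hz => ?_).congr fun z hz => ?_
    · rw [← ENNReal.coe_one, Metric.eball_coe, NNReal.coe_one, mem_ball_zero_iff]
      exact norm_qp_lt_one ⟨z, hz⟩
    · rw [Function.comp_apply, ofComplex_apply_of_im_pos hz]
      rfl
  let f : ModularForm 𝒮ℒ w :=
    { toFun := ev a
      slash_action_eq' := fun _ ⟨γ, h⟩ => h ▸ hγ γ
      holo' := hhol
      bdd_at_cusps' := fun {c} hc => by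
        rw [Subgroup.IsArithmetic.isCusp_iff_isCusp_SL2Z] at hc
        rw [OnePoint.isBoundedAt_iff_forall_SL2Z hc]
        intro γ _
        rw [hγ γ]
        exact hb }
  refine ⟨f, ?_⟩
  ext n
  exact (ModularFormClass.qExpansion_coeff_unique one_pos one_mem_strictPeriods_SL
    (f := f) hsum n).symm

end Convergent

section Gauss

open PowerSeries

variable {A : Type*} [CommRing A] [Algebra ℚ A]

/-- The formal Gaussian `exp (c u²)`. -/
def gauss (c : A) : PowerSeries A :=
  PowerSeries.mk fun n => if Even n then (1 / (n / 2).factorial : ℚ) • c ^ (n / 2) else 0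

lemma coeff_gauss_even (c : A) (j : ℕ) :
    (gauss c).coeff (2 * j) = (1 / j.factorial : ℚ) • c ^ j := by
  simp [gauss]

lemma coeff_gauss_odd (c : A) (j : ℕ) : (gauss c).coeff (2 * j + 1) = 0 := by
  simp [gauss]

lemma rescale_gauss (a c : A) : rescale a (gauss c) = gauss (a ^ 2 * c) := by
  ext n
  rw [coeff_rescale]
  rcases Nat.even_or_odd' n with ⟨j, rfl | rfl⟩
  · rw [coeff_gauss_even, coeff_gauss_even, mul_pow, ← pow_mul, mul_smul_comm]
  · rw [coeff_gauss_odd, coeff_gauss_odd, mul_zero]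

lemma derivative_gauss (c : A) :
    derivative A (gauss c) = C (2 * c) * (X * gauss c) := by
  ext n
  rw [coeff_derivative, coeff_C_mul]
  rcases n with _ | n
  · rw [show 0 + 1 = 2 * 0 + 1 from rfl, coeff_gauss_odd]
    simp
  rw [coeff_succ_X_mul]
  rcases Nat.even_or_odd' n with ⟨j, rfl | rfl⟩
  · rw [show 2 * j + 1 + 1 = 2 * (j + 1) by ring, coeff_gauss_even, coeff_gauss_even]
    have h : (1 / j.factorial : ℚ) = (1 / (j + 1).factorial : ℚ) * (j + 1) := by
      rw [Nat.factorial_succ]; push_cast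
      have : (j.factorial : ℚ) ≠ 0 := by positivity
      field_simp
    rw [h, mul_smul, Algebra.smul_def, Algebra.smul_def, Algebra.smul_def]
    push_cast
    ring
  · rw [show 2 * j + 1 + 1 + 1 = 2 * (j + 1) + 1 by ring, coeff_gauss_odd, coeff_gauss_odd]
    simp

lemma constantCoeff_gauss (c : A) : constantCoeff (gauss c) = 1 := by
  have := coeff_gauss_even c 0
  simpa using this

/-- A formal solution of `y' = 2 c u y` is determined by its constant term. -/
lemma eq_of_derivative_gauss {c : A} {y z : PowerSeries A}
    (hy : derivative A y = C (2 * c) * (X * y)) (hz : derivative A z = C (2 * c) * (X * z))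
    (h0 : constantCoeff y = constantCoeff z) : y = z := by
  ext n
  induction n using Nat.strong_induction_on with
  | _ n ih =>
    rcases n with _ | n
    · simpa using h0
    have h1 := congrArg (coeff n) hy
    have h2 := congrArg (coeff n) hz
    rw [coeff_derivative, coeff_C_mul] at h1 h2
    have h3 : coeff n (X * y) = coeff n (X * z) := by
      rcases n with _ | n
      · simp
      · rw [coeff_succ_X_mul, coeff_succ_X_mul, ih n (by omega)]
    rw [← h3, ← h1] at h2
    have hu : IsUnit ((n : A) + 1) := by
      have := (IsUnit.mk0 ((n : ℚ) + 1) (by positivity)).map (algebraMap ℚ A)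
      simpa using this
    exact (hu.mul_left_inj.mp h2).symm

lemma gauss_add (c d : A) : gauss (c + d) = gauss c * gauss d := by
  refine eq_of_derivative_gauss (derivative_gauss _) ?_ ?_
  · rw [Derivation.leibniz, derivative_gauss, derivative_gauss]
    simp only [smul_eq_mul, map_mul, map_add]
    ring
  · simp [constantCoeff_gauss]

lemma gauss_zero : gauss (0 : A) = 1 := by
  refine eq_of_derivative_gauss (derivative_gauss _) ?_ ?_
  · simp
  · simp [constantCoeff_gauss]

end Gauss

section Entire

/-- `P` is the Taylor series of the entire function `g`. -/
def IsTaylor (P : PowerSeries ℂ) (g : ℂ → ℂ) : Prop :=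
  ∀ u : ℂ, HasSum (fun n => P.coeff n * u ^ n) (g u)

lemma IsTaylor.unique {P Q : PowerSeries ℂ} {g : ℂ → ℂ} (hP : IsTaylor P g) (hQ : IsTaylor Q g) :
    P = Q := by
  have h1 := (hasFPowerSeriesOnBall_ofScalars (a := fun n => P.coeff n)
    fun u _ => hP u).hasFPowerSeriesAt
  have h2 := (hasFPowerSeriesOnBall_ofScalars (a := fun n => Q.coeff n)
    fun u _ => hQ u).hasFPowerSeriesAt
  ext n
  simpa using congr_arg (FormalMultilinearSeries.coeff · n) (h1.eq_formalMultilinearSeries h2)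

lemma IsTaylor.mul {P Q : PowerSeries ℂ} {g h : ℂ → ℂ} (hP : IsTaylor P g) (hQ : IsTaylor Q h) :
    IsTaylor (P * Q) (fun u => g u * h u) := fun u => hasSum_powerSeries_mul (hP u) (hQ u)

lemma IsTaylor.smul {P : PowerSeries ℂ} {g : ℂ → ℂ} (c : ℂ) (hP : IsTaylor P g) :
    IsTaylor (c • P) (fun u => c * g u) := fun u => by
  simpa [mul_assoc] using (hP u).mul_left c

lemma IsTaylor.rescale {P : PowerSeries ℂ} {g : ℂ → ℂ} (c : ℂ) (hP : IsTaylor P g) :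
    IsTaylor (PowerSeries.rescale c P) (fun u => g (c * u)) := fun u => by
  have := hP (c * u)
  simpa only [PowerSeries.coeff_rescale, mul_pow, mul_assoc, mul_left_comm] using this

lemma isTaylor_gauss (c : ℂ) : IsTaylor (gauss c) (fun u => Complex.exp (c * u ^ 2)) := fun u => by
  have h := NormedSpace.expSeries_div_hasSum_exp (𝔸 := ℂ) (c * u ^ 2)
  rw [← Complex.exp_eq_exp_ℂ] at h
  have hinj : Function.Injective fun j : ℕ => 2 * j := fun a b h => by simpa using h
  refine (hinj.hasSum_iff fun n hn => ?_).mp ?_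
  · rcases Nat.even_or_odd' n with ⟨j, rfl | rfl⟩
    · exact absurd ⟨j, rfl⟩ hn
    · rw [coeff_gauss_odd, zero_mul]
  · have he : ((fun n => (gauss c).coeff n * u ^ n) ∘ fun j => 2 * j)
        = fun j => (c * u ^ 2) ^ j / (j.factorial : ℂ) := by
      funext j
      rw [Function.comp_apply, coeff_gauss_even, Algebra.smul_def, mul_pow, ← pow_mul]
      simp only [eq_ratCast]
      push_cast
      ring
    rw [he]
    exact h

end Entire

section Quasi

open UpperHalfPlane

/-- The `q`-expansion of `E₂`. -/
def E2q : PowerSeries ℂ :=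
  PowerSeries.mk fun m => if m = 0 then 1 else -24 * (ArithmeticFunction.sigma 1 m : ℂ)

lemma hasSum_E2q (τ : ℍ) : HasSum (fun n => E2q.coeff n * qp τ ^ n) (EisensteinSeries.E2 τ) := by
  have := EisensteinSeries.hasSum_qExpansion_E2 (z := τ)
  simpa [E2q, qp] using this

lemma conv_E2q : Conv E2q := conv_of_qp fun τ => (hasSum_E2q τ).summable

lemma ev_E2q (τ : ℍ) : ev E2q τ = EisensteinSeries.E2 τ := (hasSum_E2q τ).tsum_eq

lemma coeff_E2q_mem (R : Subring ℂ) : E2q ∈ coeffIn R := fun n => by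
  rw [E2q, PowerSeries.coeff_mk]
  split_ifs
  · exact R.one_mem
  · exact R.mul_mem (by exact_mod_cast intCast_mem R (-24)) (natCast_mem R _)

lemma ev_E2q_S (τ τ' : ℍ) (h : (τ' : ℂ) * τ = -1) :
    ev E2q τ' = (τ : ℂ) ^ 2 * (ev E2q τ + 12 / (2 * Real.pi * Complex.I * τ)) := by
  have hτ' : τ' = ModularGroup.S • τ := by
    apply UpperHalfPlane.ext
    exact mul_right_cancel₀ τ.ne_zero (h.trans (coe_S_smul τ).symm)
  have h1 := EisensteinSeries.G2_S_transform τ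
  have hpi : (Real.pi : ℂ) ≠ 0 := by exact_mod_cast Real.pi_ne_zero
  have ht := τ.ne_zero
  rw [ev_E2q, ev_E2q, hτ', EisensteinSeries.E2]
  simp only [Pi.smul_apply, smul_eq_mul]
  rw [h1, riemannZeta_two]
  field_simp
  ring_nf
  simp only [Complex.I_sq]
  ring

/-- The Taylor coefficients at `z = 0` of a function that transforms like a Jacobi form, corrected
by powers of `E₂`, are modular forms. -/
theorem isMF_coeff_mul_gauss (F : PowerSeries (PowerSeries ℂ)) (hF : ∀ d, Conv (F.coeff d))
    (w : ℤ) (M : ℚ) (Φ : ℍ → ℂ → ℂ)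
    (hT : ∀ τ : ℍ, IsTaylor (PowerSeries.mk fun d => ev (F.coeff d) τ) (Φ τ))
    (hS : ∀ (τ τ' : ℍ) (u : ℂ), (τ' : ℂ) * τ = -1 →
      Φ τ' (u / τ) = (τ : ℂ) ^ w *
        Complex.exp (M * u ^ 2 / (2 * Real.pi * Complex.I * τ)) * Φ τ u) (d : ℕ) :
    IsMF (w + d) ((F * gauss ((-(M / 12)) • E2q)).coeff d) := by
  have hG : ∀ i, Conv ((gauss ((-(M / 12)) • E2q)).coeff i) := by
    intro i
    rw [gauss, PowerSeries.coeff_mk]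
    split_ifs
    · rw [← Rat.cast_smul_eq_qsmul ℂ, ← Rat.cast_smul_eq_qsmul ℂ]
      exact ((conv_E2q.smul _).pow _).smul _
    · exact convRing.zero_mem
  have hGe : ∀ τ, (PowerSeries.mk fun i => ev ((gauss ((-(M / 12)) • E2q)).coeff i) τ)
      = gauss ((-(M / 12 : ℂ)) * ev E2q τ) := by
    intro τ
    ext i
    rw [gauss, gauss, PowerSeries.coeff_mk, PowerSeries.coeff_mk, PowerSeries.coeff_mk]
    split_ifs
    · rw [← Rat.cast_smul_eq_qsmul ℂ, ← Rat.cast_smul_eq_qsmul ℂ, ev_smul,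
        ev_pow (conv_E2q.smul _), ev_smul, ← Rat.cast_smul_eq_qsmul ℂ, smul_eq_mul]
      push_cast
      rfl
    · simp [ev]
  have hc : ∀ i, Conv ((F * gauss ((-(M / 12)) • E2q)).coeff i) := fun i => by
    rw [PowerSeries.coeff_mul]
    exact conv_sum _ _ fun kl _ => (hF _).mul (hG _)
  have hev : ∀ τ, (PowerSeries.mk fun i => ev ((F * gauss ((-(M / 12)) • E2q)).coeff i) τ)
      = (PowerSeries.mk fun d => ev (F.coeff d) τ) * gauss ((-(M / 12 : ℂ)) * ev E2q τ) := by
    intro τ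
    rw [← hGe]
    ext i
    rw [PowerSeries.coeff_mk, PowerSeries.coeff_mul, PowerSeries.coeff_mul,
      ev_sum _ _ (fun kl => (hF _).mul (hG _))]
    refine Finset.sum_congr rfl fun kl _ => ?_
    rw [PowerSeries.coeff_mk, PowerSeries.coeff_mk, ev_mul (hF _) (hG _)]
  refine isMF_of_S (hc d) fun τ τ' h => ?_
  have ht := τ.ne_zero
  set P : ℍ → PowerSeries ℂ := fun τ => PowerSeries.mk fun d => ev (F.coeff d) τ with hP
  have key : PowerSeries.rescale (τ : ℂ)⁻¹ (P τ')
      = ((τ : ℂ) ^ w) • (gauss (M / (2 * Real.pi * Complex.I * τ) : ℂ) * P τ) := by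
    refine IsTaylor.unique ((hT τ').rescale _) ?_
    have h1 := (((isTaylor_gauss (M / (2 * Real.pi * Complex.I * τ) : ℂ)).mul (hT τ)).smul
      ((τ : ℂ) ^ w))
    convert h1 using 1
    funext u
    rw [inv_mul_eq_div, hS τ τ' u h]
    ring_nf
  have key2 : PowerSeries.rescale (τ : ℂ)⁻¹ (P τ' * gauss ((-(M / 12 : ℂ)) * ev E2q τ'))
      = ((τ : ℂ) ^ w) • (P τ * gauss ((-(M / 12 : ℂ)) * ev E2q τ)) := by
    rw [map_mul, key, rescale_gauss, smul_mul_assoc, mul_comm (gauss _) (P τ), mul_assoc,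
      ← gauss_add, ev_E2q_S τ τ' h]
    congr 3
    field_simp
    ring
  rw [← hev, ← hev] at key2
  have key3 := congrArg (PowerSeries.coeff d) key2
  rw [PowerSeries.coeff_rescale, PowerSeries.coeff_smul, PowerSeries.coeff_mk,
    PowerSeries.coeff_mk, inv_pow, inv_mul_eq_iff_eq_mul₀ (pow_ne_zero _ ht), smul_eq_mul] at key3
  rw [key3, zpow_add₀ ht, zpow_natCast]
  ring

end Quasi

section Formal

open PowerSeries

/-- Exchange of the two variables of an iterated power series. -/
def swapVars {A : Type*} [CommRing A] :
    PowerSeries (PowerSeries A) →+* PowerSeries (PowerSeries A) where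
  toFun F := .mk fun d => .mk fun n => coeff d (coeff n F)
  map_one' := by
    ext d n
    simp only [coeff_mk, coeff_one]
    by_cases hn : n = 0 <;> by_cases hd : d = 0 <;> simp [hn, hd, coeff_one]
  map_mul' F G := by
    ext d n
    simp only [coeff_mk, coeff_mul, map_sum]
    rw [Finset.sum_comm]
  map_zero' := by ext; simp
  map_add' F G := by ext; simp

lemma coeff_swapVars {A : Type*} [CommRing A] (F : PowerSeries (PowerSeries A)) (d n : ℕ) :
    coeff n (coeff d (swapVars F)) = coeff d (coeff n F) := by
  simp [swapVars]

/-- The formal exponential `e^{c u}`. -/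
def ex (c : ℂ) : PowerSeries ℂ := .mk fun n => c ^ n / n.factorial

lemma coeff_ex (c : ℂ) (n : ℕ) : coeff n (ex c) = c ^ n / n.factorial := coeff_mk _ _

lemma ex_eq (c : ℂ) : ex c = rescale c (exp ℂ) := by
  ext n
  rw [coeff_ex, coeff_rescale, coeff_exp]
  simp
  rfl

lemma ex_add (a b : ℂ) : ex (a + b) = ex a * ex b := by
  rw [ex_eq, ex_eq, ex_eq, exp_mul_exp_eq_exp_add]

lemma ex_zero : ex 0 = 1 := by
  ext n
  rw [coeff_ex, coeff_one]
  rcases n with _ | n <;> simp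

variable {ι κ : Type*} {A : Type*} [CommRing A]

/-- The power series `∑ c i * q ^ deg i` for a degree function with finite fibres. -/
def ser {deg : ι → ℕ} (h : ∀ n, {i | deg i = n}.Finite) (c : ι → A) : PowerSeries A :=
  .mk fun n => ∑ i ∈ (h n).toFinset, c i

lemma coeff_ser {deg : ι → ℕ} (h : ∀ n, {i | deg i = n}.Finite) (c : ι → A) (n : ℕ) :
    coeff n (ser h c) = ∑ i ∈ (h n).toFinset, c i := coeff_mk _ _

lemma map_ser {B : Type*} [CommRing B] (φ : A →+* B) {deg : ι → ℕ}
    (h : ∀ n, {i | deg i = n}.Finite) (c : ι → A) :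
    PowerSeries.map φ (ser h c) = ser h fun i => φ (c i) := by
  ext n
  rw [coeff_map, coeff_ser, coeff_ser, map_sum]

lemma ser_add {deg : ι → ℕ} (h : ∀ n, {i | deg i = n}.Finite) (c d : ι → A) :
    ser h (fun i => c i + d i) = ser h c + ser h d := by
  ext n
  simp only [coeff_ser, map_add, Finset.sum_add_distrib]

lemma finite_fiber_prod {deg : ι → ℕ} {deg' : κ → ℕ} (h : ∀ n, {i | deg i = n}.Finite)
    (h' : ∀ n, {i | deg' i = n}.Finite) (n : ℕ) :
    {p : ι × κ | deg p.1 + deg' p.2 = n}.Finite := by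
  refine (((Set.finite_Iic n).biUnion fun a _ => h a).prod
    ((Set.finite_Iic n).biUnion fun a _ => h' a)).subset fun p hp => ?_
  simp only [Set.mem_ofPred_eq] at hp
  simp only [Set.mem_prod, Set.mem_iUnion, Set.mem_ofPred_eq, Set.mem_Iic, exists_prop]
  exact ⟨⟨_, by omega, rfl⟩, ⟨_, by omega, rfl⟩⟩

lemma ser_mul {deg : ι → ℕ} {deg' : κ → ℕ} (h : ∀ n, {i | deg i = n}.Finite)
    (h' : ∀ n, {i | deg' i = n}.Finite) (c : ι → A) (d : κ → A) :
    ser h c * ser h' d = ser (finite_fiber_prod h h') fun p => c p.1 * d p.2 := by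
  classical
  ext n
  rw [coeff_mul, coeff_ser, ← Finset.sum_fiberwise_of_maps_to
    (t := Finset.HasAntidiagonal.antidiagonal n) (g := fun p : ι × κ => (deg p.1, deg' p.2))]
  · refine Finset.sum_congr rfl fun ab hab => ?_
    rw [coeff_ser, coeff_ser, Finset.sum_mul_sum, ← Finset.sum_product']
    refine Finset.sum_congr ?_ fun _ _ => rfl
    ext p
    have := Finset.HasAntidiagonal.mem_antidiagonal.mp hab
    simp only [Finset.mem_product, Set.Finite.mem_toFinset, Set.mem_ofPred_eq, Finset.mem_filter,
      Prod.ext_iff]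
    constructor
    · rintro ⟨h1, h2⟩
      exact ⟨by omega, h1, h2⟩
    · rintro ⟨-, h1, h2⟩
      exact ⟨h1, h2⟩
  · intro p hp
    simpa using hp

end Formal

section Analytic

open UpperHalfPlane

variable {ι : Type*}

lemma ev_ser {deg : ι → ℕ} (h : ∀ n, {i | deg i = n}.Finite) (c : ι → ℂ) (τ : ℍ) {s : ℂ}
    (hs : HasSum (fun i => c i * qp τ ^ deg i) s) :
    HasSum (fun n => (ser h c).coeff n * qp τ ^ n) s := by
  have h1 := hs.tsum_fiberwise deg
  have he : (fun n => (ser h c).coeff n * qp τ ^ n)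
      = fun n => ∑' i : deg ⁻¹' {n}, c i * qp τ ^ deg i := by
    funext n
    rw [coeff_ser, Finset.sum_mul]
    have h2 : deg ⁻¹' {n} = ((h n).toFinset : Set ι) := by ext; simp
    rw [h2, Finset.tsum_subtype' (h n).toFinset (fun i => c i * qp τ ^ deg i)]
    refine Finset.sum_congr rfl fun i hi => ?_
    rw [(by simpa using hi : deg i = n)]
  rw [he]
  exact h1

lemma exp_abs_le (x y : ℝ) :
    Real.exp (|x| * y) ≤ Real.exp (x * y) + Real.exp (-(x * y)) := by
  rcases abs_cases x with ⟨h, -⟩ | ⟨h, -⟩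
  · rw [h]; linarith [Real.exp_pos (-(x * y))]
  · rw [h, neg_mul]; linarith [Real.exp_pos (x * y)]

lemma hasSum_real_exp (x : ℝ) : HasSum (fun n : ℕ => x ^ n / n.factorial) (Real.exp x) := by
  have := NormedSpace.expSeries_div_hasSum_exp (𝔸 := ℝ) x
  rwa [← Real.exp_eq_exp_ℝ] at this

lemma hasSum_complex_exp (x : ℂ) :
    HasSum (fun n : ℕ => x ^ n / n.factorial) (Complex.exp x) := by
  have := NormedSpace.expSeries_div_hasSum_exp (𝔸 := ℂ) x
  rwa [← Complex.exp_eq_exp_ℂ] at this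

lemma summable_abs_mul_exp {β : ι → ℂ} {l : ι → ℝ}
    (hs : ∀ u : ℂ, Summable fun i => β i * Complex.exp (l i * u)) (y : ℝ) :
    Summable fun i => ‖β i‖ * Real.exp (|l i| * y) := by
  have h1 := (hs (y : ℂ)).norm
  have h2 := (hs (-(y : ℂ))).norm
  refine Summable.of_nonneg_of_le (fun i => mul_nonneg (norm_nonneg _) (Real.exp_pos _).le)
    (fun i => ?_) (h1.add h2)
  rw [norm_mul, norm_mul, Complex.norm_exp, Complex.norm_exp, ← mul_add]
  refine mul_le_mul_of_nonneg_left ?_ (norm_nonneg _)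
  have e1 : ((l i : ℂ) * (y : ℂ)).re = l i * y := by
    rw [← Complex.ofReal_mul, Complex.ofReal_re]
  have e2 : ((l i : ℂ) * (-(y : ℂ))).re = -(l i * y) := by
    rw [mul_neg, Complex.neg_re, e1]
  rw [e1, e2]
  exact exp_abs_le _ _

lemma summable_mul_exp {β : ι → ℂ} {l : ι → ℝ}
    (hs : ∀ u : ℂ, Summable fun i => β i * Complex.exp (l i * u)) (u : ℂ) :
    Summable fun p : ι × ℕ => β p.1 * ((l p.1 * u) ^ p.2 / p.2.factorial) := by
  have hn : (fun p : ι × ℕ => ‖β p.1 * ((l p.1 * u) ^ p.2 / p.2.factorial)‖)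
      = fun p => ‖β p.1‖ * ((|l p.1| * ‖u‖) ^ p.2 / p.2.factorial) := by
    funext p
    rw [norm_mul, norm_div, norm_pow, norm_mul, Complex.norm_real, Real.norm_eq_abs,
      Complex.norm_natCast]
  apply Summable.of_norm
  rw [hn, summable_prod_of_nonneg (fun p => by
    exact mul_nonneg (norm_nonneg _) (by positivity))]
  refine ⟨fun i => ((hasSum_real_exp (|l i| * ‖u‖)).summable.mul_left ‖β i‖), ?_⟩
  have ht : (fun i => ∑' n : ℕ, ‖β i‖ * ((|l i| * ‖u‖) ^ n / n.factorial))
      = fun i => ‖β i‖ * Real.exp (|l i| * ‖u‖) := by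
    funext i
    rw [tsum_mul_left, (hasSum_real_exp _).tsum_eq]
  exact ht ▸ summable_abs_mul_exp hs ‖u‖

lemma summable_mul_exp_fiber {β : ι → ℂ} {l : ι → ℝ}
    (hs : ∀ u : ℂ, Summable fun i => β i * Complex.exp (l i * u)) (u : ℂ) (d : ℕ) :
    Summable fun i => β i * ((l i * u) ^ d / d.factorial) :=
  (summable_mul_exp hs u).comp_injective (i := fun i => (i, d))
    fun _ _ h => (Prod.ext_iff.mp h).1

lemma hasSum_exp_swap {β : ι → ℂ} {l : ι → ℝ}
    (hs : ∀ u : ℂ, Summable fun i => β i * Complex.exp (l i * u)) (u : ℂ) :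
    HasSum (fun d : ℕ => (∑' i, β i * ((l i : ℂ) ^ d / d.factorial)) * u ^ d)
      (∑' i, β i * Complex.exp (l i * u)) := by
  have hS := summable_mul_exp hs u
  have h1 := hS.hasSum.prod_fiberwise (g := fun i => β i * Complex.exp (l i * u))
    fun i => (hasSum_complex_exp (l i * u)).mul_left _
  have h2 := ((Equiv.prodComm ℕ ι).hasSum_iff.mpr hS.hasSum).prod_fiberwise
    (g := fun d : ℕ => ∑' i, β i * ((l i * u) ^ d / (d.factorial : ℂ)))
    fun d => (summable_mul_exp_fiber hs u d).hasSum
  have he : (fun d : ℕ => (∑' i, β i * ((l i : ℂ) ^ d / d.factorial)) * u ^ d)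
      = fun d : ℕ => ∑' i, β i * ((l i * u) ^ d / d.factorial) := by
    funext d
    rw [← tsum_mul_right]
    refine tsum_congr fun i => ?_
    rw [mul_pow]
    ring
  rw [he, h1.tsum_eq]
  exact h2

/-- Taylor expansion in `u` of a series `∑ b i q^{deg i} e^{l i u}`. -/
theorem isTaylor_ser {deg : ι → ℕ} (h : ∀ n, {i | deg i = n}.Finite) (b : ι → ℂ) (l : ι → ℝ)
    (hs : ∀ (τ : ℍ) (u : ℂ), Summable fun i => b i * qp τ ^ deg i * Complex.exp (l i * u)) :
    (∀ d, Conv ((swapVars (ser h fun i => b i • ex (l i))).coeff d)) ∧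
    ∀ τ, IsTaylor
      (.mk fun d => ev ((swapVars (ser h fun i => b i • ex (l i))).coeff d) τ)
      (fun u => ∑' i, b i * qp τ ^ deg i * Complex.exp (l i * u)) := by
  have hcoef : ∀ d, (swapVars (ser h fun i => b i • ex (l i))).coeff d
      = ser h fun i => b i * ((l i : ℂ) ^ d / d.factorial) := by
    intro d
    ext n
    rw [coeff_swapVars, coeff_ser, coeff_ser, map_sum]
    refine Finset.sum_congr rfl fun i _ => ?_
    rw [PowerSeries.coeff_smul, coeff_ex, smul_eq_mul]
  have hsum : ∀ (τ : ℍ) (d : ℕ), HasSum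
      (fun n => ((swapVars (ser h fun i => b i • ex (l i))).coeff d).coeff n * qp τ ^ n)
      (∑' i, b i * qp τ ^ deg i * ((l i : ℂ) ^ d / d.factorial)) := by
    intro τ d
    rw [hcoef]
    refine ev_ser h _ τ ?_
    have h1 := (summable_mul_exp_fiber (hs τ) 1 d).hasSum
    simp only [mul_one] at h1
    have he : (fun i => b i * ((l i : ℂ) ^ d / d.factorial) * qp τ ^ deg i)
      = fun i => b i * qp τ ^ deg i * ((l i : ℂ) ^ d / d.factorial) := by
      funext i; ring
    rw [he]
    exact h1
  refine ⟨fun d => conv_of_qp fun τ => (hsum τ d).summable, fun τ u => ?_⟩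
  have hev : ∀ d, ev ((swapVars (ser h fun i => b i • ex (l i))).coeff d) τ
      = ∑' i, b i * qp τ ^ deg i * ((l i : ℂ) ^ d / d.factorial) := fun d => (hsum τ d).tsum_eq
  simp only [PowerSeries.coeff_mk, hev]
  exact hasSum_exp_swap (hs τ) u

end Analytic

section Theta

open UpperHalfPlane hiding I

/-- Triangular numbers `k (k + 1) / 2`. -/
def tri (k : ℤ) : ℕ := (k * (k + 1) / 2).toNat

lemma two_mul_tri (k : ℤ) : 2 * (tri k : ℤ) = k * (k + 1) := by
  have h0 : 0 ≤ k * (k + 1) := by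
    rcases le_or_gt 0 k with h | h
    · positivity
    · exact mul_nonneg_of_nonpos_of_nonpos h.le (by omega)
  rw [tri, Int.toNat_of_nonneg (Int.ediv_nonneg h0 (by norm_num))]
  exact Int.mul_ediv_cancel' (Int.even_mul_succ_self k).two_dvd

lemma finite_tri (n : ℕ) : {k : ℤ | tri k = n}.Finite := by
  refine (Set.finite_Icc (-(2 * n + 1) : ℤ) (2 * n + 1)).subset fun k hk => ?_
  simp only [Set.mem_ofPred_eq] at hk
  have h := two_mul_tri k
  rw [hk] at h
  constructor <;> nlinarith [sq_nonneg k, sq_nonneg (k + 1)]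

/-- The sign `(-1)^k`. -/
def sg (k : ℤ) : ℂ := (-1) ^ k

/-- The `e`-th Taylor coefficient of the odd theta series (without its factor `q^{1/8}`). -/
def thetaC (e : ℕ) : PowerSeries ℂ :=
  ser finite_tri fun k => sg k * ((k : ℂ) + 1 / 2) ^ e / e.factorial

/-- The series `∑ (-1)^k (k+1/2)^l / l! q^{k(k+1)/2} e^{a (k+1/2) u}`. -/
def thetaS (l : ℕ) (a : ℂ) : PowerSeries (PowerSeries ℂ) :=
  swapVars (ser finite_tri fun k =>
    (sg k * ((k : ℂ) + 1 / 2) ^ l / l.factorial) • ex (a * ((k : ℂ) + 1 / 2)))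

lemma coeff_thetaS (l : ℕ) (a : ℂ) (d : ℕ) :
    (thetaS l a).coeff d = (a ^ d * (d + l).choose l) • thetaC (d + l) := by
  ext n
  rw [thetaS, coeff_swapVars, PowerSeries.coeff_smul, thetaC, coeff_ser, coeff_ser, map_sum,
    smul_eq_mul, Finset.mul_sum]
  refine Finset.sum_congr rfl fun k _ => ?_
  rw [PowerSeries.coeff_smul, coeff_ex, smul_eq_mul, mul_pow]
  have h : ((d + l).choose l : ℂ) * l.factorial * d.factorial = (d + l).factorial := by
    have := Nat.choose_mul_factorial_mul_factorial (n := d + l) (k := l) (by omega)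
    rw [Nat.add_sub_cancel] at this
    exact_mod_cast this
  have h1 : (l.factorial : ℂ) ≠ 0 := by exact_mod_cast l.factorial_ne_zero
  have h2 : (d.factorial : ℂ) ≠ 0 := by exact_mod_cast d.factorial_ne_zero
  have h3 : ((d + l).factorial : ℂ) ≠ 0 := by exact_mod_cast (d + l).factorial_ne_zero
  field_simp
  rw [← h]
  ring

lemma coeff_thetaS_zero_one (d : ℕ) : (thetaS 0 1).coeff d = thetaC d := by
  rw [coeff_thetaS]
  simp

/-- The function `q^{-1/8} ϑ(τ, u/(2πi))`. -/
def thetaF (τ : ℍ) (u : ℂ) : ℂ :=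
  cexp (u / 2) * jacobiTheta₂ (u / (2 * Real.pi * I) + τ / 2 + 1 / 2) τ

lemma hasSum_thetaF (τ : ℍ) (u : ℂ) :
    HasSum (fun k : ℤ => sg k * qp τ ^ tri k * cexp (((k + 1 / 2 : ℝ) : ℂ) * u)) (thetaF τ u) := by
  have h := (hasSum_jacobiTheta₂_term (u / (2 * Real.pi * I) + τ / 2 + 1 / 2) τ.im_pos).mul_left
    (cexp (u / 2))
  have he : (fun k : ℤ => sg k * qp τ ^ tri k * cexp (((k + 1 / 2 : ℝ) : ℂ) * u))
      = fun k => cexp (u / 2) *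
        jacobiTheta₂_term k (u / (2 * Real.pi * I) + τ / 2 + 1 / 2) τ := by
    funext k
    have h2 : ((k : ℂ)) * (k + 1) = 2 * (tri k : ℂ) := by exact_mod_cast (two_mul_tri k).symm
    rw [sg, ← Complex.exp_pi_mul_I, ← Complex.exp_int_mul, qp, ← Complex.exp_nat_mul,
      jacobiTheta₂_term, ← Complex.exp_add, ← Complex.exp_add, ← Complex.exp_add]
    congr 1
    push_cast
    have hpi : (2 * Real.pi * I : ℂ) ≠ 0 := Complex.two_pi_I_ne_zero
    have e : 2 * (Real.pi : ℂ) * I * k * (u / (2 * Real.pi * I) + τ / 2 + 1 / 2)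
        = k * u + 2 * (Real.pi : ℂ) * I * k * (τ / 2 + 1 / 2) := by
      field_simp
      ring
    rw [e]
    linear_combination (-(Real.pi : ℂ) * I * τ) * h2
  rw [he]
  exact h

lemma thetaC_conv_taylor : (∀ d, Conv (thetaC d)) ∧
    ∀ τ, IsTaylor (.mk fun d => ev (thetaC d) τ) (thetaF τ) := by
  have h := isTaylor_ser finite_tri sg (fun k => (k + 1 / 2 : ℝ))
    fun τ u => (hasSum_thetaF τ u).summable
  have h1 : (swapVars (ser finite_tri fun i => sg i • ex ((i + 1 / 2 : ℝ) : ℂ))) = thetaS 0 1 := by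
    simp [thetaS]
  simp only [h1, coeff_thetaS_zero_one] at h
  refine ⟨h.1, fun τ => ?_⟩
  have h2 := h.2 τ
  simp only [(hasSum_thetaF τ _).tsum_eq] at h2
  exact h2

/-- The automorphy factor of `thetaF`. -/
def thetaK (τ τ' : ℍ) : ℂ :=
  -I * (-I * τ) ^ (1 / 2 : ℂ) * cexp (Real.pi * I * (τ - τ') / 4)

lemma neg_I_mul_ne_zero (τ : ℍ) : -I * (τ : ℂ) ≠ 0 :=
  mul_ne_zero (neg_ne_zero.mpr I_ne_zero) τ.ne_zero

lemma thetaF_S (τ τ' : ℍ) (u : ℂ) (h : (τ' : ℂ) * τ = -1) :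
    thetaF τ' (u / τ) = thetaK τ τ' *
      cexp ((1 / 2 : ℚ) * u ^ 2 / (2 * Real.pi * I * τ)) * thetaF τ u := by
  have hτ : (τ : ℂ) ≠ 0 := τ.ne_zero
  have hpi : (2 * Real.pi * I : ℂ) ≠ 0 := Complex.two_pi_I_ne_zero
  have h' : (τ' : ℂ) = -1 / τ := by field_simp; exact h
  set z : ℂ := u / (2 * Real.pi * I) with hz
  have hu : u = 2 * Real.pi * I * z := by rw [hz]; field_simp
  have hf := jacobiTheta₂_functional_equation (z + τ / 2 + 1 / 2) τ
  have ha := jacobiTheta₂_add_left' ((z + τ / 2 + 1 / 2) / τ) τ'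
  rw [← h'] at hf
  have e1 : u / τ / (2 * Real.pi * I) + (τ' : ℂ) / 2 + 1 / 2
      = (z + τ / 2 + 1 / 2) / τ + τ' := by
    rw [h', hu]; field_simp; ring
  have hs : (-I * (τ : ℂ)) ^ (1 / 2 : ℂ) ≠ 0 := by
    rw [Ne, Complex.cpow_eq_zero_iff]
    exact fun hh => neg_I_mul_ne_zero τ hh.1
  rw [thetaF, thetaF, e1, ha, ← hz, hf, thetaK]
  set s := (-I * (τ : ℂ)) ^ (1 / 2 : ℂ)
  set j := jacobiTheta₂ ((z + τ / 2 + 1 / 2) / τ) τ'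
  have hI : (-I : ℂ) = cexp (-(Real.pi * I / 2)) := by
    rw [Complex.exp_neg, show (Real.pi * I / 2 : ℂ) = Real.pi / 2 * I by ring,
      Complex.exp_pi_div_two_mul_I, Complex.inv_I]
  have e2 : cexp (u / τ / 2) * cexp (-Real.pi * I * (τ' + 2 * ((z + τ / 2 + 1 / 2) / τ)))
      = -I * cexp (Real.pi * I * (τ - τ') / 4) *
        cexp ((1 / 2 : ℚ) * u ^ 2 / (2 * Real.pi * I * τ)) * cexp (u / 2) *
        cexp (-Real.pi * I * (z + τ / 2 + 1 / 2) ^ 2 / τ) := by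
    rw [hI, ← Complex.exp_add, ← Complex.exp_add, ← Complex.exp_add, ← Complex.exp_add,
      ← Complex.exp_add]
    congr 1
    rw [h', hu]
    push_cast
    have e3 : (1 / 2 : ℂ) * (2 * Real.pi * I * z) ^ 2 / (2 * Real.pi * I * τ)
        = Real.pi * I * z ^ 2 / τ := by
      field_simp
    rw [e3]
    field_simp
    ring
  calc cexp (u / τ / 2) * (cexp (-Real.pi * I * (τ' + 2 * ((z + τ / 2 + 1 / 2) / τ))) * j)
      = (cexp (u / τ / 2) * cexp (-Real.pi * I * (τ' + 2 * ((z + τ / 2 + 1 / 2) / τ)))) * j := by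
        ring
    _ = _ := by
        rw [e2]
        field_simp

lemma ev_thetaC_one_S (τ τ' : ℍ) (h : (τ' : ℂ) * τ = -1) :
    ev (thetaC 1) τ' = thetaK τ τ' * τ * ev (thetaC 1) τ := by
  have hτ : (τ : ℂ) ≠ 0 := τ.ne_zero
  have h1 := (thetaC_conv_taylor.2 τ').rescale (τ : ℂ)⁻¹
  have h2 := ((isTaylor_gauss ((1 / 2 : ℚ) / (2 * Real.pi * I * τ))).mul
    (thetaC_conv_taylor.2 τ)).smul (thetaK τ τ')
  have h3 : (fun u => thetaF τ' ((τ : ℂ)⁻¹ * u)) = fun u => thetaK τ τ' *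
      (cexp ((1 / 2 : ℚ) / (2 * Real.pi * I * τ) * u ^ 2) * thetaF τ u) := by
    funext u
    rw [← div_eq_inv_mul, thetaF_S τ τ' u h, mul_assoc]
    congr 3
    ring
  rw [h3] at h1
  have h4 := congrArg (PowerSeries.coeff 1) (h1.unique h2)
  have hg0 : (gauss (((1 / 2 : ℚ) : ℂ) / (2 * Real.pi * I * τ))).coeff 0 = 1 := by
    rw [PowerSeries.coeff_zero_eq_constantCoeff, constantCoeff_gauss]
  have hg1 : (gauss (((1 / 2 : ℚ) : ℂ) / (2 * Real.pi * I * τ))).coeff 1 = 0 :=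
    coeff_gauss_odd _ 0
  rw [PowerSeries.coeff_rescale, PowerSeries.coeff_smul, PowerSeries.coeff_mul,
    Finset.Nat.antidiagonal_succ] at h4
  simp only [Finset.Nat.antidiagonal_zero, Finset.map_singleton, Finset.sum_cons,
    Finset.sum_singleton, Function.Embedding.prodMap, Function.Embedding.coeFn_mk, Prod.map,
    hg0, PowerSeries.coeff_mk, pow_one, smul_eq_mul] at h4
  simp only [Nat.succ_eq_add_one, zero_add, Function.Embedding.refl_apply, hg1, one_mul,
    zero_mul, add_zero] at h4
  field_simp at h4
  linear_combination h4

/-- `J = ∑ (-1)^k (k+1/2) q^{k(k+1)/2}`, i.e. `q^{-1/8} η(τ)^3`. -/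
def Jq : PowerSeries ℂ := thetaC 1

lemma thetaK_pow_eight (τ τ' : ℍ) :
    thetaK τ τ' ^ 8 * qp τ' = (τ : ℂ) ^ 4 * qp τ := by
  have hc : ((-I * (τ : ℂ)) ^ (1 / 2 : ℂ)) ^ 8 = (τ : ℂ) ^ 4 := by
    rw [← Complex.cpow_nat_mul]
    rw [show ((8 : ℕ) : ℂ) * (1 / 2) = (4 : ℕ) by norm_num, Complex.cpow_natCast, mul_pow,
      neg_pow, Complex.I_pow_four]
    norm_num
  rw [thetaK, mul_pow, mul_pow, hc, ← Complex.exp_nat_mul, qp, qp]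
  have : (-I : ℂ) ^ 8 = 1 := by
    rw [show 8 = 4 * 2 from rfl, pow_mul, neg_pow, Complex.I_pow_four]; norm_num
  rw [this, one_mul, mul_assoc, ← Complex.exp_add]
  congr 2
  push_cast
  ring

/-- Taylor coefficients of `q J^7 ϑ` corrected by a Gaussian: level one modular forms. -/
def yT (d : ℕ) : PowerSeries ℂ :=
  ((PowerSeries.C (PowerSeries.X * Jq ^ 7) * thetaS 0 1) *
    gauss ((-((1 / 2 : ℚ) / 12)) • E2q)).coeff d

theorem isMF_yT (d : ℕ) : IsMF (11 + d) (yT d) := by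
  have hc := thetaC_conv_taylor.1
  have hcJ : Conv (PowerSeries.X * Jq ^ 7) := conv_X.mul ((hc 1).pow 7)
  refine isMF_coeff_mul_gauss _ (fun e => ?_) 11 (1 / 2)
    (fun τ u => ev (PowerSeries.X * Jq ^ 7) τ * thetaF τ u) (fun τ => ?_) (fun τ τ' u h => ?_) d
  · rw [PowerSeries.coeff_C_mul, coeff_thetaS_zero_one]
    exact hcJ.mul (hc e)
  · have h1 := (thetaC_conv_taylor.2 τ).smul (ev (PowerSeries.X * Jq ^ 7) τ)
    have h2 : (PowerSeries.mk fun d =>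
        ev ((PowerSeries.C (PowerSeries.X * Jq ^ 7) * thetaS 0 1).coeff d) τ)
        = ev (PowerSeries.X * Jq ^ 7) τ • PowerSeries.mk fun d => ev (thetaC d) τ := by
      ext e
      rw [PowerSeries.coeff_mk, PowerSeries.coeff_smul, PowerSeries.coeff_mk,
        PowerSeries.coeff_C_mul, coeff_thetaS_zero_one, ev_mul hcJ (hc e), smul_eq_mul]
    rw [h2]
    exact h1
  · have hJ := ev_thetaC_one_S τ τ' h
    rw [Jq, ev_mul conv_X ((hc 1).pow 7), ev_mul conv_X ((hc 1).pow 7), ev_X, ev_X,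
      ev_pow (hc 1), ev_pow (hc 1), thetaF_S τ τ' u h]
    rw [hJ]
    have hk := thetaK_pow_eight τ τ'
    have h11 : (τ : ℂ) ^ (11 : ℤ) = (τ : ℂ) ^ 4 * (τ : ℂ) ^ 7 := by
      rw [← pow_add]; norm_cast
    rw [h11]
    linear_combination (τ : ℂ) ^ 7 * ev (thetaC 1) τ ^ 7 *
      cexp ((1 / 2 : ℚ) * u ^ 2 / (2 * Real.pi * I * τ)) * thetaF τ u * hk

end Theta

section JacobiSeries

open PowerSeries

/-- A power series in `u` whose `d`-th coefficient is a modular form of weight `w + d`. -/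
def IsJ (w : ℤ) (X : PowerSeries (PowerSeries ℂ)) : Prop := ∀ d : ℕ, IsMF (w + d) (X.coeff d)

lemma IsJ.add {w : ℤ} {X Y : PowerSeries (PowerSeries ℂ)} (hX : IsJ w X) (hY : IsJ w Y) :
    IsJ w (X + Y) := fun d => by
  rw [map_add]
  exact (hX d).add (hY d)

lemma IsJ.mul {w w' : ℤ} {X Y : PowerSeries (PowerSeries ℂ)} (hX : IsJ w X) (hY : IsJ w' Y) :
    IsJ (w + w') (X * Y) := fun d => by
  rw [coeff_mul]
  refine IsMF.sum _ _ fun p hp => ((hX p.1).mul (hY p.2)).congr ?_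
  rw [← Finset.HasAntidiagonal.mem_antidiagonal.mp hp]
  push_cast
  ring

lemma IsJ.congr {w w' : ℤ} {X : PowerSeries (PowerSeries ℂ)} (hX : IsJ w X) (h : w = w') :
    IsJ w' X := h ▸ hX

lemma IsMF.isJ {w : ℤ} {a : PowerSeries ℂ} (ha : IsMF w a) : IsJ w (C a) := fun d => by
  rw [coeff_C]
  split_ifs with h
  · exact ha.congr (by simp [h])
  · exact IsMF.zero _

lemma IsJ.one : IsJ 0 1 := by
  have := IsMF.one.isJ
  rwa [map_one] at this

lemma IsJ.pow {w : ℤ} {X : PowerSeries (PowerSeries ℂ)} (hX : IsJ w X) (n : ℕ) :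
    IsJ (n * w) (X ^ n) := by
  induction n with
  | zero => simpa using IsJ.one
  | succ n ih => rw [pow_succ]; exact (ih.mul hX).congr (by push_cast; ring)

lemma IsJ.sum {w : ℤ} {ι : Type*} (s : Finset ι) (X : ι → PowerSeries (PowerSeries ℂ))
    (h : ∀ i ∈ s, IsJ w (X i)) : IsJ w (∑ i ∈ s, X i) := fun d => by
  rw [map_sum]
  exact IsMF.sum _ _ fun i hi => h i hi d

lemma IsJ.smul {w : ℤ} {X : PowerSeries (PowerSeries ℂ)} (c : ℂ) (hX : IsJ w X) :
    IsJ w (c • X) := fun d => by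
  rw [coeff_smul]
  exact (hX d).smul c

lemma IsJ.sub {w : ℤ} {X Y : PowerSeries (PowerSeries ℂ)} (hX : IsJ w X) (hY : IsJ w Y) :
    IsJ w (X - Y) := fun d => by
  rw [map_sub]
  exact (hX d).sub (hY d)

lemma IsJ.derivative {w : ℤ} {X : PowerSeries (PowerSeries ℂ)} (hX : IsJ w X) :
    IsJ (w + 1) (PowerSeries.derivative (PowerSeries ℂ) X) := fun d => by
  rw [coeff_derivative]
  have h := ((hX (d + 1)).smul ((d : ℂ) + 1)).congr (w' := w + 1 + d) (by push_cast; ring)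
  convert h using 1
  rw [mul_comm, smul_eq_C_mul]
  simp

lemma IsJ.rescale {w : ℤ} {X : PowerSeries (PowerSeries ℂ)} (a : ℂ) (hX : IsJ w X) :
    IsJ w (PowerSeries.rescale (C a) X) := fun d => by
  rw [coeff_rescale, ← map_pow, ← smul_eq_C_mul]
  exact (hX d).smul _

lemma thetaS_eq_rescale (l : ℕ) (a : ℂ) : thetaS l a = rescale (C a) (thetaS l 1) := by
  ext1 d
  rw [coeff_rescale, coeff_thetaS, coeff_thetaS, ← map_pow, ← smul_eq_C_mul, smul_smul, one_pow,
    one_mul]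

lemma derivative_thetaS (l : ℕ) :
    derivative (PowerSeries ℂ) (thetaS l 1) = ((l : ℂ) + 1) • thetaS (l + 1) 1 := by
  ext1 d
  rw [coeff_derivative, coeff_thetaS, coeff_smul, coeff_thetaS, smul_smul]
  have h : ((d : PowerSeries ℂ) + 1) = C ((d : ℂ) + 1) := by simp
  rw [h, mul_comm, ← smul_eq_C_mul, smul_smul]
  have e : d + 1 + l = d + (l + 1) := by ring
  rw [e]
  congr 1
  have h3 := Nat.choose_succ_right_eq (d + l + 1) l
  have h4 : d + l + 1 - l = d + 1 := by omega
  rw [h4] at h3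
  rw [← add_assoc]
  have h5 : ((d + l + 1).choose (l + 1) : ℂ) * (l + 1) = (d + l + 1).choose l * (d + 1) := by
    exact_mod_cast h3
  linear_combination -h5

/-- The discriminant in the form `q J^8`. -/
def Dlt : PowerSeries ℂ := X * Jq ^ 8

lemma isMF_Dlt : IsMF 12 Dlt := by
  have h := isMF_yT 1
  have h2 : yT 1 = Dlt := by
    rw [yT, mul_assoc, coeff_C_mul, coeff_mul, Finset.Nat.antidiagonal_succ]
    have hg1 : (gauss ((-((1 / 2 : ℚ) / 12)) • E2q)).coeff 1 = 0 := coeff_gauss_odd _ 0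
    have hg0 : (gauss ((-((1 / 2 : ℚ) / 12)) • E2q)).coeff 0 = 1 := by
      rw [coeff_zero_eq_constantCoeff, constantCoeff_gauss]
    simp only [Finset.Nat.antidiagonal_zero, Finset.map_singleton, Finset.sum_cons,
      Finset.sum_singleton, Function.Embedding.prodMap, Function.Embedding.coeFn_mk, Prod.map,
      hg0, Nat.succ_eq_add_one, zero_add, Function.Embedding.refl_apply, hg1,
      coeff_thetaS_zero_one, mul_zero, mul_one]
    rw [Dlt, ← Jq]
    ring
  rw [h2] at h
  exact h.congr (by norm_num)

/-- The corrected theta series. -/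
def yS : PowerSeries (PowerSeries ℂ) :=
  (C (X * Jq ^ 7) * thetaS 0 1) * gauss ((-((1 / 2 : ℚ) / 12)) • E2q)

lemma isJ_yS : IsJ 11 yS := isMF_yT

/-- Correction factor turning Taylor expansions of index `M` into modular forms. -/
def corr (M : ℚ) : PowerSeries (PowerSeries ℂ) := gauss ((-(M / 12)) • E2q)

lemma corr_add (M N : ℚ) : corr (M + N) = corr M * corr N := by
  rw [corr, corr, corr, ← gauss_add, ← add_smul]
  congr 2
  ring

lemma corr_zero : corr 0 = 1 := by
  rw [corr, zero_div, neg_zero, zero_smul, gauss_zero]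

lemma rescale_corr (a : ℤ) (M : ℚ) : rescale (C (a : ℂ)) (corr M) = corr (a ^ 2 * M) := by
  rw [corr, rescale_gauss, corr]
  congr 1
  have h : (C (a : ℂ) : PowerSeries ℂ) = algebraMap ℚ (PowerSeries ℂ) a := by
    rw [map_intCast, map_intCast]
  rw [h, ← map_pow, ← Algebra.smul_def, smul_smul]
  congr 1
  ring

/-- `E_2 / 24` with sign, as a constant series in `u`. -/
def eC : PowerSeries (PowerSeries ℂ) := C ((-((1 / 2 : ℚ) / 12)) • E2q)

lemma derivative_corr :
    derivative (PowerSeries ℂ) (corr (1 / 2)) = 2 * eC * X * corr (1 / 2) := by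
  rw [corr, derivative_gauss, eC, map_mul]
  have : (C (2 : PowerSeries ℂ)) = (2 : PowerSeries (PowerSeries ℂ)) := map_ofNat C 2
  rw [this]
  ring

/-- First divided derivative of the corrected theta series. -/
def yS1 : PowerSeries (PowerSeries ℂ) :=
  C (X * Jq ^ 7) * corr (1 / 2) * (thetaS 1 1 + 2 * eC * X * thetaS 0 1)

/-- Second divided derivative of the corrected theta series. -/
def yS2 : PowerSeries (PowerSeries ℂ) :=
  C (X * Jq ^ 7) * corr (1 / 2) *
    (thetaS 2 1 + 2 * eC * X * thetaS 1 1 + (eC + 2 * eC ^ 2 * X ^ 2) * thetaS 0 1)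

/-- Third divided derivative of the corrected theta series. -/
def yS3 : PowerSeries (PowerSeries ℂ) :=
  C (X * Jq ^ 7) * corr (1 / 2) *
    (3 * thetaS 3 1 + 6 * eC * X * thetaS 2 1 + (3 * eC + 6 * eC ^ 2 * X ^ 2) * thetaS 1 1 +
      (6 * eC ^ 2 * X + 4 * eC ^ 3 * X ^ 3) * thetaS 0 1)

lemma yS_eq : yS = C (X * Jq ^ 7) * corr (1 / 2) * thetaS 0 1 := by
  rw [yS, corr]; ring

lemma derivative_eC : derivative (PowerSeries ℂ) eC = 0 := derivative_C

lemma derivative_two :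
    derivative (PowerSeries ℂ) (2 : PowerSeries (PowerSeries ℂ)) = 0 := by
  rw [← map_ofNat (C (R := PowerSeries ℂ)) 2]
  exact derivative_C

lemma isJ_yS1 : IsJ 12 yS1 := by
  have h := isJ_yS.derivative
  have : derivative (PowerSeries ℂ) yS = yS1 := by
    simp only [yS_eq, yS1, Derivation.leibniz, derivative_corr, derivative_thetaS, derivative_C,
      smul_eq_mul, Nat.cast_zero, zero_add, one_smul]
    ring
  rw [this] at h
  exact h.congr (by norm_num)

lemma two_smul_thetaS (l : ℕ) : (((1 : ℕ) : ℂ) + 1) • thetaS l 1 = 2 * thetaS l 1 := by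
  rw [Nat.cast_one, one_add_one_eq_two, two_smul, two_mul]

lemma three_smul_thetaS (l : ℕ) : (((2 : ℕ) : ℂ) + 1) • thetaS l 1 = 3 * thetaS l 1 := by
  rw [show (((2 : ℕ) : ℂ) + 1) = 1 + 1 + 1 by norm_num, add_smul, add_smul, one_smul]
  ring

lemma isJ_yS2 : IsJ 13 yS2 := by
  have h := isJ_yS1.derivative
  have h2 : derivative (PowerSeries ℂ) yS1 = (2 : ℂ) • yS2 := by
    rw [two_smul]
    simp only [yS1, yS2, mul_assoc, Derivation.leibniz, derivative_corr, derivative_thetaS,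
      derivative_C, derivative_eC, derivative_two, two_smul_thetaS, map_add, derivative_X,
      smul_eq_mul, Nat.cast_zero, zero_add, one_smul]
    ring
  rw [h2] at h
  have h3 := h.smul (1 / 2)
  rw [smul_smul] at h3
  norm_num at h3
  exact h3.congr (by norm_num)

lemma isJ_yS3 : IsJ 14 yS3 := by
  have h := isJ_yS2.derivative
  have h2 : derivative (PowerSeries ℂ) yS2 = yS3 := by
    simp only [yS2, yS3, mul_assoc, Derivation.leibniz, derivative_corr, derivative_thetaS,
      derivative_C, derivative_eC, derivative_two, two_smul_thetaS, three_smul_thetaS, map_add, derivative_X,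
      pow_two, add_mul,
      smul_eq_mul, Nat.cast_zero, zero_add, one_smul]
    ring
  rw [h2] at h
  exact h.congr (by norm_num)

lemma rescale_constant (a b : PowerSeries ℂ) : rescale a (C b) = C b := by
  ext1 n
  rw [coeff_rescale, coeff_C]
  split_ifs with h
  · rw [h, pow_zero, one_mul]
  · rw [mul_zero]

/-- A scalar as a constant of the ring of iterated power series. -/
abbrev cst (a : ℂ) : PowerSeries (PowerSeries ℂ) := C (C a)

lemma rescale_yS (a : ℤ) : rescale (C (a : ℂ)) yS =
    C (X * Jq ^ 7) * corr (a ^ 2 * (1 / 2)) * thetaS 0 a := by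
  rw [yS_eq, map_mul, map_mul, rescale_corr, thetaS_eq_rescale 0 (a : ℂ), rescale_constant]

lemma rescale_eC (a : PowerSeries ℂ) : rescale a eC = eC := rescale_constant _ _

lemma rescale_yS1 (a : ℤ) : rescale (C (a : ℂ)) yS1 =
    C (X * Jq ^ 7) * corr (a ^ 2 * (1 / 2)) *
      (thetaS 1 a + 2 * eC * (cst a * X) * thetaS 0 a) := by
  simp only [yS1, map_mul, map_add, rescale_corr, thetaS_eq_rescale _ (a : ℂ), rescale_constant,
    rescale_eC, rescale_X, map_ofNat]

lemma rescale_yS2 (a : ℤ) : rescale (C (a : ℂ)) yS2 =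
    C (X * Jq ^ 7) * corr (a ^ 2 * (1 / 2)) *
      (thetaS 2 a + 2 * eC * (cst a * X) * thetaS 1 a +
        (eC + 2 * eC ^ 2 * (cst a * X) ^ 2) * thetaS 0 a) := by
  simp only [yS2, map_mul, map_add, rescale_corr, thetaS_eq_rescale _ (a : ℂ), rescale_constant,
    rescale_eC, rescale_X, map_ofNat, map_pow]

lemma rescale_yS3 (a : ℤ) : rescale (C (a : ℂ)) yS3 =
    C (X * Jq ^ 7) * corr (a ^ 2 * (1 / 2)) *
      (3 * thetaS 3 a + 6 * eC * (cst a * X) * thetaS 2 a +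
        (3 * eC + 6 * eC ^ 2 * (cst a * X) ^ 2) * thetaS 1 a +
        (6 * eC ^ 2 * (cst a * X) + 4 * eC ^ 3 * (cst a * X) ^ 3) * thetaS 0 a) := by
  simp only [yS3, map_mul, map_add, rescale_corr, thetaS_eq_rescale _ (a : ℂ), rescale_constant,
    rescale_eC, rescale_X, map_ofNat, map_pow]

lemma corr_three (a b : ℤ) :
    corr (a ^ 2 * (1 / 2)) * corr (b ^ 2 * (1 / 2)) * corr (((-a - b : ℤ) : ℚ) ^ 2 * (1 / 2))
      = corr (a ^ 2 + a * b + b ^ 2) := by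
  rw [← corr_add, ← corr_add]
  congr 1
  push_cast
  ring

/-- Coefficient of `w` in `ϑ(a u + w) ϑ(b u + w) ϑ(c u + w)`. -/
def thetaOne (a b c : ℂ) : PowerSeries (PowerSeries ℂ) :=
  thetaS 1 a * thetaS 0 b * thetaS 0 c + thetaS 0 a * thetaS 1 b * thetaS 0 c +
    thetaS 0 a * thetaS 0 b * thetaS 1 c

/-- Coefficient of `w^3` in `ϑ(a u + w) ϑ(b u + w) ϑ(c u + w)`. -/
def thetaThree (a b c : ℂ) : PowerSeries (PowerSeries ℂ) :=
  thetaS 3 a * thetaS 0 b * thetaS 0 c + thetaS 0 a * thetaS 3 b * thetaS 0 c +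
    thetaS 0 a * thetaS 0 b * thetaS 3 c +
  (thetaS 2 a * thetaS 1 b * thetaS 0 c + thetaS 2 a * thetaS 0 b * thetaS 1 c +
    thetaS 1 a * thetaS 2 b * thetaS 0 c + thetaS 0 a * thetaS 2 b * thetaS 1 c +
    thetaS 1 a * thetaS 0 b * thetaS 2 c + thetaS 0 a * thetaS 1 b * thetaS 2 c) +
  thetaS 1 a * thetaS 1 b * thetaS 1 c

theorem isJ_thetaZero (a b : ℤ) :
    IsJ 33 (C (X * Jq ^ 7) ^ 3 * corr (a ^ 2 + a * b + b ^ 2) *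
      (thetaS 0 a * thetaS 0 b * thetaS 0 (-a - b : ℤ))) := by
  have h := ((isJ_yS.rescale a).mul (isJ_yS.rescale b)).mul (isJ_yS.rescale (-a - b : ℤ))
  rw [rescale_yS, rescale_yS, rescale_yS] at h
  rw [← corr_three]
  convert h.congr (w' := 33) (by norm_num) using 1
  ring

lemma cst_neg_sub (a b : ℤ) : cst ((-a - b : ℤ) : ℂ) = -cst a - cst b := by
  simp [cst]

theorem isJ_thetaOne (a b : ℤ) :
    IsJ 34 (C (X * Jq ^ 7) ^ 3 * corr (a ^ 2 + a * b + b ^ 2) *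
      thetaOne a b (-a - b : ℤ)) := by
  have h1 := ((isJ_yS1.rescale a).mul (isJ_yS.rescale b)).mul (isJ_yS.rescale (-a - b : ℤ))
  have h2 := ((isJ_yS.rescale a).mul (isJ_yS1.rescale b)).mul (isJ_yS.rescale (-a - b : ℤ))
  have h3 := ((isJ_yS.rescale a).mul (isJ_yS.rescale b)).mul (isJ_yS1.rescale (-a - b : ℤ))
  have h := ((h1.congr (w' := 34) (by norm_num)).add (h2.congr (w' := 34) (by norm_num))).add
    (h3.congr (w' := 34) (by norm_num))
  simp only [rescale_yS, rescale_yS1, cst_neg_sub] at h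
  rw [← corr_three, thetaOne]
  convert h using 1
  ring

/-- The ring identity behind `isJ_thetaThree`. -/
lemma theta_three_identity {A : Type*} [CommRing A] (E x y z a0 a1 a2 a3 b0 b1 b2 b3 c0 c1 c2 c3 : A)
    (h : z = -x - y) :
    3 * (a3 * b0 * c0 + a0 * b3 * c0 + a0 * b0 * c3 + (a2 * b1 * c0 + a2 * b0 * c1 + a1 * b2 * c0 +
      a0 * b2 * c1 + a1 * b0 * c2 + a0 * b1 * c2) + a1 * b1 * c1) +
      9 * E * (a1 * b0 * c0 + a0 * b1 * c0 + a0 * b0 * c1) =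
    (3 * a3 + 6 * E * x * a2 + (3 * E + 6 * E ^ 2 * x ^ 2) * a1 +
        (6 * E ^ 2 * x + 4 * E ^ 3 * x ^ 3) * a0) * b0 * c0 +
    a0 * (3 * b3 + 6 * E * y * b2 + (3 * E + 6 * E ^ 2 * y ^ 2) * b1 +
        (6 * E ^ 2 * y + 4 * E ^ 3 * y ^ 3) * b0) * c0 +
    a0 * b0 * (3 * c3 + 6 * E * z * c2 + (3 * E + 6 * E ^ 2 * z ^ 2) * c1 +
        (6 * E ^ 2 * z + 4 * E ^ 3 * z ^ 3) * c0) +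
    3 * ((a2 + 2 * E * x * a1 + (E + 2 * E ^ 2 * x ^ 2) * a0) *
          ((b1 + 2 * E * y * b0) * c0 + b0 * (c1 + 2 * E * z * c0)) +
        (b2 + 2 * E * y * b1 + (E + 2 * E ^ 2 * y ^ 2) * b0) *
          ((a1 + 2 * E * x * a0) * c0 + a0 * (c1 + 2 * E * z * c0)) +
        (c2 + 2 * E * z * c1 + (E + 2 * E ^ 2 * z ^ 2) * c0) *
          ((a1 + 2 * E * x * a0) * b0 + a0 * (b1 + 2 * E * y * b0)) +
        (a1 + 2 * E * x * a0) * (b1 + 2 * E * y * b0) * (c1 + 2 * E * z * c0)) := by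
  subst h
  ring

theorem isJ_thetaThree (a b : ℤ) :
    IsJ 36 (C (X * Jq ^ 7) ^ 3 * corr (a ^ 2 + a * b + b ^ 2) *
      (3 * thetaThree a b (-a - b : ℤ) + 9 * eC * thetaOne a b (-a - b : ℤ))) := by
  have r0 := fun n : ℤ => isJ_yS.rescale (n : ℂ)
  have r1 := fun n : ℤ => isJ_yS1.rescale (n : ℂ)
  have r2 := fun n : ℤ => isJ_yS2.rescale (n : ℂ)
  have r3 := fun n : ℤ => isJ_yS3.rescale (n : ℂ)
  set c : ℤ := -a - b with hc
  have k : ∀ {w₁ w₂ w₃ : ℤ} {P Q S : PowerSeries (PowerSeries ℂ)}, IsJ w₁ P → IsJ w₂ Q →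
      IsJ w₃ S → w₁ + w₂ + w₃ = 36 → IsJ 36 (P * Q * S) := fun hP hQ hS hw =>
    ((hP.mul hQ).mul hS).congr hw
  have h3 := ((k (r3 a) (r0 b) (r0 c) (by norm_num)).add
    (k (r0 a) (r3 b) (r0 c) (by norm_num))).add (k (r0 a) (r0 b) (r3 c) (by norm_num))
  have h2 := ((((k (r2 a) (r1 b) (r0 c) (by norm_num)).add
    (k (r2 a) (r0 b) (r1 c) (by norm_num))).add ((k (r1 a) (r2 b) (r0 c) (by norm_num)).add
    (k (r0 a) (r2 b) (r1 c) (by norm_num)))).add ((k (r1 a) (r0 b) (r2 c) (by norm_num)).add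
    (k (r0 a) (r1 b) (r2 c) (by norm_num)))).add (k (r1 a) (r1 b) (r1 c) (by norm_num))
  have h := h3.add ((h2.add h2).add h2)
  have hz : cst (c : ℂ) * X = -(cst (a : ℂ) * X) - cst (b : ℂ) * X := by
    rw [hc, cst_neg_sub]; ring
  have hid := theta_three_identity eC (cst (a : ℂ) * X) (cst (b : ℂ) * X) (cst (c : ℂ) * X)
    (thetaS 0 a) (thetaS 1 a) (thetaS 2 a) (thetaS 3 a) (thetaS 0 b) (thetaS 1 b) (thetaS 2 b)
    (thetaS 3 b) (thetaS 0 c) (thetaS 1 c) (thetaS 2 c) (thetaS 3 c) hz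
  simp only [rescale_yS, rescale_yS1, rescale_yS2, rescale_yS3] at h
  rw [thetaThree, thetaOne, hid, ← corr_three, ← hc]
  convert h using 1
  clear hid h hz
  generalize cst (a : ℂ) * X = x
  generalize cst (b : ℂ) * X = y
  generalize cst (c : ℂ) * X = z
  generalize corr _ = k1
  generalize corr _ = k2
  generalize corr _ = k3
  ring

end JacobiSeries

section FormalJacobi

open PowerSeries

/-- Laurent polynomials in two variables. -/
abbrev LP := AddMonoidAlgebra ℂ (ℤ × ℤ)

lemma LP.coeff_mul_eq_sum (P Q : LP) (S : Finset (ℤ × ℤ)) (hS : P.coeff.support ⊆ S) (r : ℤ × ℤ) :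
    (P * Q).coeff r = ∑ s ∈ S, P.coeff s * Q.coeff (r - s) := by
  classical
  rw [AddMonoidAlgebra.coeff_mul, Finsupp.sum]
  refine Finset.sum_subset_zero_on_sdiff hS (fun x hx => ?_) fun s hs => ?_
  · simp only [Finset.mem_sdiff, Finsupp.mem_support_iff, not_not] at hx
    rw [hx.2, zero_mul]
  · rw [Finsupp.sum, Finset.sum_eq_single (r - s)]
    · simp
    · intro b _ hb
      rw [if_neg]
      rintro rfl
      exact hb (by simp)
    · intro h
      simp only [Finsupp.mem_support_iff, not_not] at h
      simp [h]

/-- Coefficients of a formal Jacobi series, extended by zero to negative exponents of `q`. -/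
def cf (φ : PowerSeries LP) (x : ℤ × ℤ × ℤ) : ℂ :=
  if 0 ≤ x.1 then (coeff x.1.toNat φ).coeff x.2 else 0

lemma cf_natCast (φ : PowerSeries LP) (n : ℕ) (r : ℤ × ℤ) :
    cf φ ((n : ℤ), r) = (coeff n φ).coeff r := by
  simp [cf]

lemma cf_of_neg (φ : PowerSeries LP) {x : ℤ × ℤ × ℤ} (h : x.1 < 0) : cf φ x = 0 :=
  if_neg (by omega)

lemma cf_add (φ ψ : PowerSeries LP) (x : ℤ × ℤ × ℤ) : cf (φ + ψ) x = cf φ x + cf ψ x := by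
  unfold cf
  split_ifs <;> simp

lemma cf_smul (c : ℂ) (φ : PowerSeries LP) (x : ℤ × ℤ × ℤ) : cf (c • φ) x = c * cf φ x := by
  unfold cf
  split_ifs <;> simp

lemma cf_mul (φ ψ : PowerSeries LP) (x : ℤ × ℤ × ℤ) :
    cf (φ * ψ) x = ∑ᶠ y, cf φ y * cf ψ (x - y) := by
  classical
  obtain ⟨n, r⟩ := x
  rcases lt_or_ge n 0 with hn | hn
  · rw [cf_of_neg _ hn, finsum_eq_zero_of_forall_eq_zero]
    intro y
    rcases lt_or_ge y.1 0 with hy | hy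
    · rw [cf_of_neg _ hy, zero_mul]
    · rw [cf_of_neg ψ (by simp; omega), mul_zero]
  lift n to ℕ using hn
  set S : Finset (ℤ × ℤ) := (Finset.range (n + 1)).biUnion fun a => (coeff a φ).coeff.support with hS
  rw [cf_natCast, coeff_mul, AddMonoidAlgebra.coeff_sum, Finsupp.finsetSum_apply,
    finsum_eq_sum_of_support_subset (s := (Finset.range (n + 1)).image (Nat.cast : ℕ → ℤ) ×ˢ S)]
  · rw [Finset.sum_product, Finset.sum_image (by simp),
      Finset.Nat.sum_antidiagonal_eq_sum_range_succ
        (fun a b => ((coeff a φ) * (coeff b ψ)).coeff r)]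
    refine Finset.sum_congr rfl fun a ha => ?_
    have ha' : a ≤ n := by simpa [Nat.lt_succ_iff] using ha
    rw [LP.coeff_mul_eq_sum _ _ S (Finset.subset_biUnion_of_mem
      (fun a => (coeff a φ).coeff.support) ha)]
    refine Finset.sum_congr rfl fun s _ => ?_
    have e : (((n : ℤ), r) - ((a : ℤ), s) : ℤ × ℤ × ℤ) = (((n - a : ℕ) : ℤ), r - s) := by
      rw [Nat.cast_sub ha']; rfl
    rw [cf_natCast, e, cf_natCast]
  · intro y hy
    obtain ⟨a, s⟩ := y
    have h1 : 0 ≤ a := by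
      by_contra h
      exact hy (by simp [cf_of_neg φ (x := (a, s)) (by simp; omega)])
    have h2 : a ≤ n := by
      by_contra h
      refine hy ?_
      beta_reduce
      rw [cf_of_neg ψ (x := ((n : ℤ), r) - (a, s)) (by simp; omega), mul_zero]
    lift a to ℕ using h1
    have h3 : (coeff a φ).coeff s ≠ 0 := by
      intro h
      rw [Function.mem_support, cf_natCast, h, zero_mul] at hy
      exact hy rfl
    simp only [Finset.coe_product, Set.mem_prod, Finset.mem_coe, Finset.mem_image, Finset.mem_range,
      hS, Finset.mem_biUnion, Finsupp.mem_support_iff]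
    exact ⟨⟨a, by omega, rfl⟩, a, by omega, h3⟩

/-- Invariance of the coefficients of `φ` under `x ↦ L x + m t`. -/
def IsInv (L : (ℤ × ℤ × ℤ) ≃+ (ℤ × ℤ × ℤ)) (t : ℤ × ℤ × ℤ) (m : ℤ) (φ : PowerSeries LP) : Prop :=
  ∀ x, cf φ (L x + m • t) = cf φ x

lemma IsInv.add {L t m φ ψ} (h : IsInv L t m φ) (h' : IsInv L t m ψ) : IsInv L t m (φ + ψ) :=
  fun x => by rw [cf_add, cf_add, h, h']

lemma IsInv.smul {L t m φ} (c : ℂ) (h : IsInv L t m φ) : IsInv L t m (c • φ) :=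
  fun x => by rw [cf_smul, cf_smul, h]

lemma IsInv.mul {L t m m' φ ψ} (h : IsInv L t m φ) (h' : IsInv L t m' ψ) :
    IsInv L t (m + m') (φ * ψ) := fun x => by
  rw [cf_mul, cf_mul, ← finsum_comp_equiv (L.toEquiv.trans (Equiv.addRight (m • t)))]
  refine finsum_congr fun y => ?_
  have e : L x + (m + m') • t - (L.toEquiv.trans (Equiv.addRight (m • t))) y
      = L (x - y) + m' • t := by
    simp only [Equiv.trans_apply, Equiv.coe_addRight, AddEquiv.toEquiv_eq_coe, AddEquiv.coe_toEquiv,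
      map_sub, add_smul]
    abel
  rw [e, h', ← h y]
  rfl

/-- Embedding of power series in `q` into formal Jacobi series. -/
def iq : PowerSeries ℂ →+* PowerSeries LP := PowerSeries.map (algebraMap ℂ LP)

lemma coeff_iq (a : PowerSeries ℂ) (n : ℕ) : coeff n (iq a) = algebraMap ℂ LP (coeff n a) :=
  coeff_map _ _ _

lemma cf_iq (a : PowerSeries ℂ) (x : ℤ × ℤ × ℤ) :
    cf (iq a) x = if x.2 = 0 ∧ 0 ≤ x.1 then coeff x.1.toNat a else 0 := by
  classical
  unfold cf
  rw [coeff_iq, AddMonoidAlgebra.coe_algebraMap]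
  by_cases h : 0 ≤ x.1 <;> simp [h, Finsupp.single_apply, eq_comm]

/-- Additive automorphisms fixing the `q`-direction and preserving `r = 0`. -/
structure IsGood (L : (ℤ × ℤ × ℤ) ≃+ (ℤ × ℤ × ℤ)) : Prop where
  map_q : L (1, 0) = (1, 0)
  snd : ∀ x, (L x).2 = 0 ↔ x.2 = 0

lemma IsGood.map_natCast {L} (hL : IsGood L) (n : ℤ) : L (n, 0) = (n, 0) := by
  have : ((n, 0) : ℤ × ℤ × ℤ) = n • ((1, 0) : ℤ × ℤ × ℤ) := by ext <;> simp
  rw [this, map_zsmul, hL.map_q]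

lemma IsGood.isInv_iq {L} (hL : IsGood L) (t) (a : PowerSeries ℂ) : IsInv L t 0 (iq a) := fun x => by
  rw [zero_smul, add_zero, cf_iq, cf_iq]
  by_cases h : x.2 = 0
  · have : x = (x.1, 0) := Prod.ext rfl h
    rw [this, hL.map_natCast]
  · rw [if_neg (fun h' => h ((hL.snd x).1 h'.1)), if_neg (fun h' => h h'.1)]

lemma cf_X_mul (φ : PowerSeries LP) (x : ℤ × ℤ × ℤ) : cf (X * φ) (x + (1, 0)) = cf φ x := by
  obtain ⟨n, r⟩ := x
  rcases lt_trichotomy n (-1) with h | rfl | h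
  · rw [cf_of_neg _ (by simp; omega), cf_of_neg _ (by simp; omega)]
  · rw [cf_of_neg φ (by simp)]
    simp [cf]
  · obtain ⟨n, rfl⟩ : ∃ k : ℕ, n = k := ⟨n.toNat, by omega⟩
    rw [cf_natCast, Prod.mk_add_mk, add_zero, ← Nat.cast_succ, cf_natCast, coeff_succ_X_mul]

lemma IsGood.isInv_of_X_mul {L t m φ} (hL : IsGood L) (h : IsInv L t m (X * φ)) : IsInv L t m φ :=
  fun x => by
    rw [← cf_X_mul, ← cf_X_mul φ x, ← h (x + (1, 0)), map_add, hL.map_q]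
    congr 1
    abel

end FormalJacobi

section Generators

open PowerSeries

lemma cf_ser {ι : Type*} {deg : ι → ℕ} (h : ∀ n, {i | deg i = n}.Finite) (ρ : ι → ℤ × ℤ)
    (c : ι → ℂ) (x : ℤ × ℤ × ℤ) :
    cf (ser h fun i => (AddMonoidAlgebra.single (ρ i) (c i) : LP)) x
      = ∑ᶠ i, if ((deg i : ℤ), ρ i) = x then c i else 0 := by
  classical
  obtain ⟨n, r⟩ := x
  rcases lt_or_ge n 0 with hn | hn
  · rw [cf_of_neg _ hn, finsum_eq_zero_of_forall_eq_zero]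
    intro i
    rw [if_neg]
    intro h'
    have := congrArg Prod.fst h'
    simp only at this
    omega
  lift n to ℕ using hn
  rw [cf_natCast, coeff_ser, AddMonoidAlgebra.coeff_sum, Finsupp.finsetSum_apply,
    finsum_eq_sum_of_support_subset (s := (h n).toFinset)]
  · refine Finset.sum_congr rfl fun i hi => ?_
    have : deg i = n := by simpa using hi
    simp [Finsupp.single_apply, this]
  · intro i hi
    simp only [Function.mem_support, ne_eq, ite_eq_right_iff, Classical.not_imp, Prod.mk.injEq,
      Nat.cast_inj] at hi
    simpa using hi.1.1

lemma isInv_ser {ι : Type*} {deg : ι → ℕ} (h : ∀ n, {i | deg i = n}.Finite) (ρ : ι → ℤ × ℤ)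
    (c : ι → ℂ) {L : (ℤ × ℤ × ℤ) ≃+ (ℤ × ℤ × ℤ)} {t : ℤ × ℤ × ℤ} {m : ℤ} (σ : ι ≃ ι)
    (hσ : ∀ i, ((deg (σ i) : ℤ), ρ (σ i)) = L ((deg i : ℤ), ρ i) + m • t)
    (hc : ∀ i, c (σ i) = c i) :
    IsInv L t m (ser h fun i => (AddMonoidAlgebra.single (ρ i) (c i) : LP)) := fun x => by
  rw [cf_ser, cf_ser, ← finsum_comp_equiv σ]
  refine finsum_congr fun i => ?_
  rw [hσ, hc]
  simp only [add_left_inj, L.injective.eq_iff]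

/-- Linear part of the elliptic transformation of coefficients. -/
def ellL : (ℤ × ℤ × ℤ) ≃+ (ℤ × ℤ × ℤ) where
  toFun x := (x.1 + x.2.1 - x.2.2, x.2)
  invFun x := (x.1 - x.2.1 + x.2.2, x.2)
  left_inv x := by ext <;> simp; ring
  right_inv x := by ext <;> simp; ring
  map_add' x y := by ext <;> simp <;> ring

/-- Rotation of order three of the exponents. -/
def rot : (ℤ × ℤ) ≃+ (ℤ × ℤ) where
  toFun r := (-r.2, r.1 - r.2)
  invFun r := (r.2 - r.1, -r.1)
  left_inv x := by ext <;> simp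
  right_inv x := by ext <;> simp
  map_add' x y := by ext <;> simp <;> ring

/-- A mirror symmetry of the exponents. -/
def mir : (ℤ × ℤ) ≃+ (ℤ × ℤ) where
  toFun r := (r.1 - r.2, -r.2)
  invFun r := (r.1 - r.2, -r.2)
  left_inv x := by ext <;> simp
  right_inv x := by ext <;> simp
  map_add' x y := by ext <;> simp <;> ring

/-- Extension of an automorphism of the exponents by the identity on powers of `q`. -/
def extq (g : (ℤ × ℤ) ≃+ (ℤ × ℤ)) : (ℤ × ℤ × ℤ) ≃+ (ℤ × ℤ × ℤ) :=
  (AddEquiv.refl ℤ).prodCongr g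

lemma extq_apply (g : (ℤ × ℤ) ≃+ (ℤ × ℤ)) (x : ℤ × ℤ × ℤ) : extq g x = (x.1, g x.2) := rfl

lemma isGood_ellL : IsGood ellL := ⟨rfl, fun _ => Iff.rfl⟩

lemma isGood_extq (g : (ℤ × ℤ) ≃+ (ℤ × ℤ)) : IsGood (extq g) :=
  ⟨by rw [extq_apply, map_zero], fun x => by rw [extq_apply]; simp⟩

/-- Formal Jacobi series of index `m` for the hexagonal lattice, with the symmetries used here. -/
structure IsV (m : ℤ) (φ : PowerSeries LP) : Prop where
  ell : IsInv ellL (1, 1, -1) m φ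
  rot : IsInv (extq rot) 0 m φ
  mir : IsInv (extq mir) 0 m φ

lemma IsV.add {m φ ψ} (h : IsV m φ) (h' : IsV m ψ) : IsV m (φ + ψ) :=
  ⟨h.1.add h'.1, h.2.add h'.2, h.3.add h'.3⟩

lemma IsV.smul {m φ} (c : ℂ) (h : IsV m φ) : IsV m (c • φ) :=
  ⟨h.1.smul c, h.2.smul c, h.3.smul c⟩

lemma IsV.mul {m m' φ ψ} (h : IsV m φ) (h' : IsV m' ψ) : IsV (m + m') (φ * ψ) :=
  ⟨h.1.mul h'.1, h.2.mul h'.2, h.3.mul h'.3⟩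

lemma isV_iq (a : PowerSeries ℂ) : IsV 0 (iq a) :=
  ⟨isGood_ellL.isInv_iq _ a, (isGood_extq _).isInv_iq _ a, (isGood_extq _).isInv_iq _ a⟩

lemma IsV.iq_mul {m φ} (a : PowerSeries ℂ) (h : IsV m φ) : IsV m (iq a * φ) := by
  simpa using (isV_iq a).mul h

lemma IsV.of_X_mul {m φ} (h : IsV m (X * φ)) : IsV m φ :=
  ⟨isGood_ellL.isInv_of_X_mul h.1, (isGood_extq _).isInv_of_X_mul h.2,
    (isGood_extq _).isInv_of_X_mul h.3⟩

lemma IsV.pow {m φ} (h : IsV m φ) (n : ℕ) : IsV (n * m) (φ ^ n) := by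
  induction n with
  | zero => simpa using isV_iq 1
  | succ n ih => rw [pow_succ]; convert ih.mul h using 1; push_cast; ring

lemma isV_zero (m : ℤ) : IsV m 0 := by
  have : ∀ x, cf 0 x = 0 := fun x => by simp [cf]
  exact ⟨fun x => by rw [this, this], fun x => by rw [this, this], fun x => by rw [this, this]⟩

lemma IsV.sum {m : ℤ} {ι : Type*} (s : Finset ι) (φ : ι → PowerSeries LP)
    (h : ∀ i ∈ s, IsV m (φ i)) : IsV m (∑ i ∈ s, φ i) := by
  classical
  induction s using Finset.induction_on with
  | empty => simpa using isV_zero m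
  | insert i s hi ih =>
    rw [Finset.sum_insert hi]
    exact (h i (by simp)).add (ih fun j hj => h j (by simp [hj]))

lemma IsV.sub {m φ ψ} (h : IsV m φ) (h' : IsV m ψ) : IsV m (φ - ψ) := by
  rw [sub_eq_add_neg, ← neg_one_smul ℂ]
  exact h.add (h'.smul _)

/-- The degree function with finite fibres indexing products of three theta series. -/
lemma finite_tri3 (n : ℕ) :
    {k : ℤ × ℤ × ℤ | tri k.1 + (tri k.2.1 + tri k.2.2) = n}.Finite :=
  finite_fiber_prod finite_tri (finite_fiber_prod finite_tri finite_tri) n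

/-- The product of three theta series with the `j`-th power of the total exponent inserted. -/
def thetaT (j : ℕ) : PowerSeries LP :=
  ser finite_tri3 fun k => AddMonoidAlgebra.single (k.1 - k.2.2, k.2.1 - k.2.2)
    (sg k.1 * sg k.2.1 * sg k.2.2 * ((k.1 : ℂ) + k.2.1 + k.2.2 + 3 / 2) ^ j)

lemma sg_add_one (k : ℤ) : sg (k + 1) = - sg k := by
  rw [sg, sg, zpow_add₀ (by norm_num)]; simp

lemma sg_sub_one (k : ℤ) : sg (k - 1) = - sg k := by
  rw [sg, sg, zpow_sub₀ (by norm_num)]; simp [div_neg]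

lemma tri_add_one (k : ℤ) : (tri (k + 1) : ℤ) = tri k + k + 1 := by
  have h := two_mul_tri k
  have h' := two_mul_tri (k + 1)
  nlinarith

lemma tri_sub_one (k : ℤ) : (tri (k - 1) : ℤ) = tri k - k := by
  have h := two_mul_tri k
  have h' := two_mul_tri (k - 1)
  nlinarith

lemma isV_thetaT (j : ℕ) : IsV 1 (thetaT j) := by
  refine ⟨isInv_ser finite_tri3 _ _
      ((Equiv.addRight 1).prodCongr ((Equiv.subRight 1).prodCongr (Equiv.refl ℤ))) (fun k => ?_)
      (fun k => ?_),
    isInv_ser finite_tri3 _ _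
      (⟨fun k => (k.2.2, k.1, k.2.1), fun k => (k.2.1, k.2.2, k.1), fun _ => rfl, fun _ => rfl⟩)
      (fun k => ?_) (fun k => ?_),
    isInv_ser finite_tri3 _ _
      (⟨fun k => (k.1, k.2.2, k.2.1), fun k => (k.1, k.2.2, k.2.1), fun _ => rfl, fun _ => rfl⟩)
      (fun k => ?_) (fun k => ?_)⟩
  · obtain ⟨a, b, c⟩ := k
    ext
    · simp [ellL, tri_add_one, tri_sub_one]; ring
    · simp [ellL]; ring
    · simp [ellL]; ring
  · obtain ⟨a, b, c⟩ := k
    simp [sg_add_one, sg_sub_one]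
  · obtain ⟨a, b, c⟩ := k
    ext <;> simp [extq_apply, rot]; ring
  · obtain ⟨a, b, c⟩ := k
    simp only [Equiv.coe_fn_mk]
    ring
  · obtain ⟨a, b, c⟩ := k
    ext <;> simp [extq_apply, mir]; ring
  · obtain ⟨a, b, c⟩ := k
    simp only [Equiv.coe_fn_mk]
    ring

/-- The generator of the ring of formal Jacobi series built from theta values. -/
def gen0 : PowerSeries LP := iq (Jq⁻¹ ^ 3) * thetaT 0

/-- The generator built from the first theta derivative. -/
def gen1 : PowerSeries LP := iq (Jq⁻¹ ^ 3) * thetaT 1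

/-- The generator built from the third theta derivative. -/
def gen3 : PowerSeries LP :=
  iq (Jq⁻¹ ^ 3) * ((1 / 6 : ℂ) • thetaT 3 - (1 / 8 : ℂ) • (iq E2q * thetaT 1))

lemma isV_gen0 : IsV 1 gen0 := (isV_thetaT 0).iq_mul _

lemma isV_gen1 : IsV 1 gen1 := (isV_thetaT 1).iq_mul _

lemma isV_gen3 : IsV 1 gen3 :=
  (((isV_thetaT 3).smul _).sub (((isV_thetaT 1).iq_mul _).smul _)).iq_mul _

lemma tri_eq_zero {k : ℤ} : tri k = 0 ↔ k = 0 ∨ k = -1 := by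
  have h := two_mul_tri k
  constructor
  · intro h0
    rw [h0] at h
    rcases mul_eq_zero.mp h.symm with h | h
    · exact Or.inl h
    · right; omega
  · rintro (rfl | rfl) <;> simpa using h

lemma coeff_zero_thetaT (j : ℕ) : coeff 0 (thetaT j) =
    ∑ k ∈ ({0, -1} : Finset ℤ) ×ˢ (({0, -1} : Finset ℤ) ×ˢ ({0, -1} : Finset ℤ)),
      (AddMonoidAlgebra.single (k.1 - k.2.2, k.2.1 - k.2.2)
        (sg k.1 * sg k.2.1 * sg k.2.2 * ((k.1 : ℂ) + k.2.1 + k.2.2 + 3 / 2) ^ j) : LP) := by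
  rw [thetaT, coeff_ser]
  refine Finset.sum_congr ?_ fun _ _ => rfl
  ext k
  simp [tri_eq_zero]

lemma coeff_zero_Jq : coeff 0 Jq = 1 := by
  have : (finite_tri 0).toFinset = {0, -1} := by ext; simp [tri_eq_zero]
  rw [Jq, thetaC, coeff_ser, this, Finset.sum_pair (by norm_num)]
  norm_num [sg]

lemma Jq_mul_inv : Jq * Jq⁻¹ = 1 := by
  refine PowerSeries.mul_inv_cancel _ ?_
  rw [← coeff_zero_eq_constantCoeff_apply, coeff_zero_Jq]
  exact one_ne_zero

lemma coeff_zero_inv_Jq : coeff 0 (Jq⁻¹ ^ 3) = 1 := by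
  have := congrArg (constantCoeff (R := ℂ)) Jq_mul_inv
  rw [map_mul, ← coeff_zero_eq_constantCoeff_apply, coeff_zero_Jq, one_mul, map_one] at this
  rw [coeff_zero_eq_constantCoeff_apply, map_pow, this, one_pow]

/-- Orbit sum of the minimal exponents. -/
def orbA : LP := .single (1, 0) 1 + .single (0, 1) 1 + .single (-1, -1) 1

/-- Orbit sum of the negatives of the minimal exponents. -/
def orbB : LP := .single (-1, 0) 1 + .single (0, -1) 1 + .single (1, 1) 1

lemma coeff_zero_iq_mul (a : PowerSeries ℂ) (φ : PowerSeries LP) :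
    coeff 0 (iq a * φ) = coeff 0 a • coeff 0 φ := by
  rw [coeff_zero_eq_constantCoeff_apply, map_mul, ← coeff_zero_eq_constantCoeff_apply,
    ← coeff_zero_eq_constantCoeff_apply, coeff_iq, Algebra.smul_def]

lemma single_eq_smul (r : ℤ × ℤ) (c : ℂ) : (AddMonoidAlgebra.single r c : LP) = c • .single r 1 := by
  rw [AddMonoidAlgebra.smul_single, smul_eq_mul, mul_one]

lemma coeff_zero_thetaT_eq (j : ℕ) : coeff 0 (thetaT j) =
    ((3 / 2 : ℂ) ^ j - (-3 / 2) ^ j) • 1 + (-1 / 2 : ℂ) ^ j • orbA - (1 / 2 : ℂ) ^ j • orbB := by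
  rw [coeff_zero_thetaT]
  have h : ∀ k : ℤ × ℤ × ℤ, (AddMonoidAlgebra.single (k.1 - k.2.2, k.2.1 - k.2.2)
        (sg k.1 * sg k.2.1 * sg k.2.2 * ((k.1 : ℂ) + k.2.1 + k.2.2 + 3 / 2) ^ j) : LP)
      = (sg k.1 * sg k.2.1 * sg k.2.2 * ((k.1 : ℂ) + k.2.1 + k.2.2 + 3 / 2) ^ j) •
        .single (k.1 - k.2.2, k.2.1 - k.2.2) 1 := fun k => single_eq_smul _ _
  have h1 : sg 0 = 1 := by simp [sg]
  have h2 : sg (-1) = -1 := by norm_num [sg]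
  simp only [h, Finset.sum_product, Finset.sum_pair (show (0 : ℤ) ≠ -1 by norm_num), h1, h2, orbA,
    orbB, AddMonoidAlgebra.one_def]
  norm_num
  simp only [← Prod.zero_eq_mk]
  module

lemma coeff_zero_gen0 : coeff 0 gen0 = orbA - orbB := by
  rw [gen0, coeff_zero_iq_mul, coeff_zero_inv_Jq, one_smul, coeff_zero_thetaT_eq]
  simp

lemma coeff_zero_gen1 : coeff 0 gen1 = (3 : ℂ) • 1 - (1 / 2 : ℂ) • (orbA + orbB) := by
  rw [gen1, coeff_zero_iq_mul, coeff_zero_inv_Jq, one_smul, coeff_zero_thetaT_eq]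
  module

lemma coeff_zero_gen3 : coeff 0 gen3 = (3 / 4 : ℂ) • 1 + (1 / 24 : ℂ) • (orbA + orbB) := by
  have h : coeff 0 E2q = 1 := by simp [E2q]
  rw [gen3, coeff_zero_iq_mul, coeff_zero_inv_Jq, one_smul, map_sub, coeff_smul, coeff_smul,
    coeff_zero_iq_mul, coeff_zero_thetaT_eq, coeff_zero_thetaT_eq, h]
  module

end Generators

section LeadingTerms

open PowerSeries

/-- Laurent polynomials with coefficients in `R`. -/
def lpIn (R : Subring ℂ) : Subring LP where
  carrier := {P | ∀ r, P.coeff r ∈ R}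
  mul_mem' {P Q} ha hb r := by
    rw [LP.coeff_mul_eq_sum P Q _ subset_rfl]
    exact R.sum_mem fun i _ => R.mul_mem (ha _) (hb _)
  one_mem' r := by
    rw [AddMonoidAlgebra.one_def, AddMonoidAlgebra.coeff_single, Finsupp.single_apply]; split_ifs
    exacts [R.one_mem, R.zero_mem]
  add_mem' ha hb r := by
    rw [AddMonoidAlgebra.coeff_add, Finsupp.add_apply]; exact R.add_mem (ha r) (hb r)
  zero_mem' r := by rw [AddMonoidAlgebra.coeff_zero]; exact R.zero_mem
  neg_mem' ha r := by
    rw [AddMonoidAlgebra.coeff_neg, Finsupp.neg_apply]; exact R.neg_mem (ha r)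

lemma single_mem_lpIn {R : Subring ℂ} (r : ℤ × ℤ) {c : ℂ} (hc : c ∈ R) :
    (AddMonoidAlgebra.single r c : LP) ∈ lpIn R := fun s => by
  rw [AddMonoidAlgebra.coeff_single, Finsupp.single_apply]; split_ifs
  exacts [hc, R.zero_mem]

lemma smul_mem_lpIn {R : Subring ℂ} {c : ℂ} (hc : c ∈ R) {P : LP} (hP : P ∈ lpIn R) :
    c • P ∈ lpIn R := fun s => by
  rw [AddMonoidAlgebra.coeff_smul, Finsupp.smul_apply]
  exact R.mul_mem hc (hP s)

/-- Formal Jacobi series with coefficients in `R`. -/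
def jIn (R : Subring ℂ) : Subring (PowerSeries LP) where
  carrier := {a | ∀ n, a.coeff n ∈ lpIn R}
  mul_mem' ha hb n := by
    rw [PowerSeries.coeff_mul]
    exact Subring.sum_mem _ fun i _ => Subring.mul_mem _ (ha _) (hb _)
  one_mem' n := by
    rw [PowerSeries.coeff_one]; split_ifs
    exacts [Subring.one_mem _, Subring.zero_mem _]
  add_mem' ha hb n := by rw [map_add]; exact Subring.add_mem _ (ha n) (hb n)
  zero_mem' n := by rw [map_zero]; exact Subring.zero_mem _
  neg_mem' ha n := by rw [map_neg]; exact Subring.neg_mem _ (ha n)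

lemma smul_mem_jIn {R : Subring ℂ} {c : ℂ} (hc : c ∈ R) {φ : PowerSeries LP} (h : φ ∈ jIn R) :
    c • φ ∈ jIn R := fun n => by
  rw [coeff_smul]
  exact smul_mem_lpIn hc (h n)

lemma algebraMap_mem_lpIn {R : Subring ℂ} {c : ℂ} (hc : c ∈ R) : algebraMap ℂ LP c ∈ lpIn R :=
  single_mem_lpIn 0 hc

lemma iq_mem_jIn {R : Subring ℂ} {a : PowerSeries ℂ} (ha : a ∈ coeffIn R) : iq a ∈ jIn R :=
  fun n => by
    rw [coeff_iq]
    exact algebraMap_mem_lpIn (ha n)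

lemma sg_mem (R : Subring ℂ) (k : ℤ) : sg k ∈ R := by
  rcases Int.even_or_odd k with h | h
  · rw [sg, h.neg_one_zpow]; exact R.one_mem
  · rw [sg, h.neg_one_zpow]; exact R.neg_mem R.one_mem

lemma half_mem {R : Subring ℂ} (h6 : (1 / 6 : ℂ) ∈ R) : (1 / 2 : ℂ) ∈ R := by
  have := R.mul_mem (natCast_mem R 3) h6
  norm_num at this ⊢
  exact this

lemma thetaT_mem {R : Subring ℂ} (h6 : (1 / 6 : ℂ) ∈ R) (j : ℕ) : thetaT j ∈ jIn R := fun n => by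
  rw [thetaT, coeff_ser]
  refine Subring.sum_mem _ fun k _ => single_mem_lpIn _ ?_
  refine R.mul_mem (R.mul_mem (R.mul_mem (sg_mem R _) (sg_mem R _)) (sg_mem R _)) (R.pow_mem ?_ _)
  have h3 : (3 / 2 : ℂ) ∈ R := by
    have := R.mul_mem (natCast_mem R 3) (half_mem h6)
    norm_num at this ⊢
    exact this
  exact R.add_mem (R.add_mem (R.add_mem (intCast_mem R _) (intCast_mem R _)) (intCast_mem R _)) h3

lemma Jq_mem {R : Subring ℂ} (h6 : (1 / 6 : ℂ) ∈ R) : Jq ∈ coeffIn R := fun n => by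
  rw [Jq, thetaC, coeff_ser]
  refine R.sum_mem fun k _ => ?_
  rw [pow_one, Nat.factorial_one, Nat.cast_one, div_one]
  exact R.mul_mem (sg_mem R k) (R.add_mem (intCast_mem R k) (half_mem h6))

lemma inv_Jq_mem {R : Subring ℂ} (h6 : (1 / 6 : ℂ) ∈ R) : Jq⁻¹ ∈ coeffIn R := fun n => by
  refine coeff_mem_of_unit_mul R (Jq_mem h6) coeff_zero_Jq (n + 1) (fun i _ => ?_) n (by omega)
  rw [Jq_mul_inv]
  exact (coeffIn R).one_mem i

lemma gen0_mem {R : Subring ℂ} (h6 : (1 / 6 : ℂ) ∈ R) : gen0 ∈ jIn R :=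
  Subring.mul_mem _ (iq_mem_jIn (Subring.pow_mem _ (inv_Jq_mem h6) 3)) (thetaT_mem h6 0)

lemma gen1_mem {R : Subring ℂ} (h6 : (1 / 6 : ℂ) ∈ R) : gen1 ∈ jIn R :=
  Subring.mul_mem _ (iq_mem_jIn (Subring.pow_mem _ (inv_Jq_mem h6) 3)) (thetaT_mem h6 1)

lemma gen3_mem {R : Subring ℂ} (h6 : (1 / 6 : ℂ) ∈ R) : gen3 ∈ jIn R := by
  refine Subring.mul_mem _ (iq_mem_jIn (Subring.pow_mem _ (inv_Jq_mem h6) 3)) ?_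
  refine Subring.sub_mem _ (smul_mem_jIn h6 (thetaT_mem h6 3)) (smul_mem_jIn ?_
    (Subring.mul_mem _ (iq_mem_jIn (coeff_E2q_mem R)) (thetaT_mem h6 1)))
  have := R.pow_mem (half_mem h6) 3
  norm_num at this ⊢
  exact this

/-- Laurent polynomials invariant under the hexagonal symmetries, with exponents in the hexagon of
radius `m`. -/
structure IsW (m : ℤ) (P : LP) : Prop where
  rot : ∀ r, P.coeff (rot r) = P.coeff r
  mir : ∀ r, P.coeff (mir r) = P.coeff r
  le : ∀ r, P.coeff r ≠ 0 → r.1 ≤ m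

lemma IsW.bounds {m : ℤ} {P : LP} (h : IsW m P) {r : ℤ × ℤ} (hr : P.coeff r ≠ 0) :
    0 ≤ m ∧ |r.1| ≤ m ∧ |r.2| ≤ m ∧ |r.1 - r.2| ≤ m := by
  have h1 := h.le r hr
  have hr1 : P.coeff (_root_.rot r) ≠ 0 := by rwa [h.rot]
  have hr2 : P.coeff (_root_.rot (_root_.rot r)) ≠ 0 := by rwa [h.rot]
  have hm : P.coeff (_root_.mir r) ≠ 0 := by rwa [h.mir]
  have hm1 : P.coeff (_root_.rot (_root_.mir r)) ≠ 0 := by rwa [h.rot]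
  have hm2 : P.coeff (_root_.rot (_root_.rot (_root_.mir r))) ≠ 0 := by rwa [h.rot]
  have h2 := h.le _ hr1
  have h3 := h.le _ hr2
  have h4 := h.le _ hm
  have h5 := h.le _ hm1
  have h6 := h.le _ hm2
  simp only [_root_.rot, _root_.mir, AddEquiv.coe_mk, Equiv.coe_fn_mk] at h2 h3 h4 h5 h6
  simp only [abs_le]
  omega

lemma IsW.add {m : ℤ} {P Q : LP} (h : IsW m P) (h' : IsW m Q) : IsW m (P + Q) := by
  refine ⟨fun r => ?_, fun r => ?_, fun r hr => ?_⟩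
  · simp [h.1, h'.1]
  · simp [h.2, h'.2]
  · by_contra hlt
    refine hr ?_
    rw [AddMonoidAlgebra.coeff_add, Finsupp.add_apply, not_not.mp (mt (h.3 r) hlt),
      not_not.mp (mt (h'.3 r) hlt), add_zero]

lemma IsW.smul {m : ℤ} {P : LP} (c : ℂ) (h : IsW m P) : IsW m (c • P) := by
  refine ⟨fun r => ?_, fun r => ?_, fun r hr => h.3 r fun h0 => hr ?_⟩
  · simp [h.1]
  · simp [h.2]
  · simp [h0]

lemma coeff_mul_comp {P Q : LP} (g : (ℤ × ℤ) ≃+ (ℤ × ℤ)) (hP : ∀ r, P.coeff (g r) = P.coeff r)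
    (hQ : ∀ r, Q.coeff (g r) = Q.coeff r) (r) : (P * Q).coeff (g r) = (P * Q).coeff r := by
  have key : ∀ T : LP, (∀ r, T.coeff (g r) = T.coeff r) ↔
      AddMonoidAlgebra.domCongr ℂ ℂ g T = T := fun T => by
    constructor
    · intro h
      refine AddMonoidAlgebra.ext ?_
      ext r
      rw [AddMonoidAlgebra.coeff_domCongr, ← h, AddEquiv.apply_symm_apply]
    · intro h r
      conv_lhs => rw [← h]
      rw [AddMonoidAlgebra.coeff_domCongr, AddEquiv.symm_apply_apply]
  refine (key (P * Q)).mpr ?_ r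
  rw [map_mul, (key P).mp hP, (key Q).mp hQ]

lemma IsW.mul {m m' : ℤ} {P Q : LP} (h : IsW m P) (h' : IsW m' Q) : IsW (m + m') (P * Q) := by
  refine ⟨coeff_mul_comp _ h.1 h'.1, coeff_mul_comp _ h.2 h'.2, fun r hr => ?_⟩
  rw [LP.coeff_mul_eq_sum P Q _ subset_rfl] at hr
  obtain ⟨s, -, hs⟩ := Finset.exists_ne_zero_of_sum_ne_zero hr
  have h1 := h.3 s (left_ne_zero_of_mul hs)
  have h2 := h'.3 _ (right_ne_zero_of_mul hs)
  simp only [Prod.fst_sub] at h2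
  omega

lemma isW_one : IsW 0 1 := by
  refine ⟨fun r => ?_, fun r => ?_, fun r hr => ?_⟩
  · simp [AddMonoidAlgebra.one_def, Finsupp.single_apply, eq_comm (a := (0 : ℤ × ℤ))]
  · simp [AddMonoidAlgebra.one_def, Finsupp.single_apply, eq_comm (a := (0 : ℤ × ℤ))]
  · rw [AddMonoidAlgebra.one_def, AddMonoidAlgebra.coeff_single, Finsupp.single_apply] at hr
    have : (0 : ℤ × ℤ) = r := by by_contra h; exact hr (if_neg h)
    rw [← this]; simp

lemma IsW.pow {m : ℤ} {P : LP} (h : IsW m P) (n : ℕ) : IsW (n * m) (P ^ n) := by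
  induction n with
  | zero => simpa using isW_one
  | succ n ih => rw [pow_succ]; convert ih.mul h using 1; push_cast; ring

lemma IsW.sum {m : ℤ} {ι : Type*} (s : Finset ι) (P : ι → LP) (hs : s.Nonempty)
    (h : ∀ i ∈ s, IsW m (P i)) : IsW m (∑ i ∈ s, P i) :=
  Finset.sum_induction_nonempty _ _ (fun _ _ => IsW.add) hs h

lemma isW_orbA : IsW 1 orbA := by
  refine ⟨fun r => ?_, fun r => ?_, fun r hr => ?_⟩
  · simp [orbA, Finsupp.single_apply, rot, Prod.ext_iff]
    grind
  · simp [orbA, Finsupp.single_apply, mir, Prod.ext_iff]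
    grind
  · simp [orbA, Finsupp.single_apply, Prod.ext_iff] at hr
    grind

lemma isW_orbB : IsW 1 orbB := by
  refine ⟨fun r => ?_, fun r => ?_, fun r hr => ?_⟩
  · simp [orbB, Finsupp.single_apply, rot, Prod.ext_iff]
    grind
  · simp [orbB, Finsupp.single_apply, mir, Prod.ext_iff]
    grind
  · simp [orbB, Finsupp.single_apply, Prod.ext_iff] at hr
    grind

lemma coeff_orbA_mul {m : ℤ} {P : LP} (h : IsW m P) (s : ℤ) :
    (orbA * P).coeff (m + 1, s) = P.coeff (m, s) := by
  have h0 : ∀ a b : ℤ, m < a → P.coeff (a, b) = 0 := fun a b hab => by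
    by_contra h'
    have := h.3 _ h'
    simp only at this
    omega
  simp only [orbA, add_mul, AddMonoidAlgebra.coeff_add, Finsupp.add_apply,
    AddMonoidAlgebra.coeff_single_mul_apply, Prod.neg_mk, Prod.mk_add_mk, one_mul]
  rw [h0 (-0 + (m + 1)) _ (by omega), h0 (- -1 + (m + 1)) _ (by omega)]
  simp

lemma coeff_orbB_mul {m : ℤ} {P : LP} (h : IsW m P) (s : ℤ) :
    (orbB * P).coeff (m + 1, s) = P.coeff (m, s - 1) := by
  have h0 : ∀ a b : ℤ, m < a → P.coeff (a, b) = 0 := fun a b hab => by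
    by_contra h'
    have := h.3 _ h'
    simp only at this
    omega
  simp only [orbB, add_mul, AddMonoidAlgebra.coeff_add, Finsupp.add_apply,
    AddMonoidAlgebra.coeff_single_mul_apply, Prod.neg_mk, Prod.mk_add_mk, one_mul]
  rw [h0 (-0 + (m + 1)) _ (by omega), h0 (- -1 + (m + 1)) _ (by omega)]
  simp [sub_eq_neg_add]

lemma isW_monomial (i j : ℕ) : IsW (i + j : ℕ) (orbA ^ i * orbB ^ j) := by
  simpa using (isW_orbA.pow i).mul (isW_orbB.pow j)

lemma coeff_monomial_top (i j : ℕ) (s : ℤ) :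
    (orbA ^ i * orbB ^ j).coeff ((i + j : ℕ), s) = if s = j then 1 else 0 := by
  induction i with
  | zero =>
    induction j generalizing s with
    | zero => simp [AddMonoidAlgebra.one_def, Finsupp.single_apply, Prod.ext_iff, eq_comm]
    | succ j ih =>
      have := isW_monomial 0 j
      rw [pow_zero, one_mul] at this ih ⊢
      rw [pow_succ', ← add_assoc, Nat.cast_succ, coeff_orbB_mul this, ih, Nat.cast_succ]
      simp only [sub_eq_iff_eq_add]
  | succ i ih =>
    rw [pow_succ', mul_assoc, add_right_comm, Nat.cast_succ, coeff_orbA_mul (isW_monomial i j), ih]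

lemma IsW.exists_sub {m : ℕ} {P : LP} (h : IsW (m + 1 : ℕ) P) :
    IsW m (P - ∑ j ∈ Finset.range (m + 2),
      P.coeff ((m + 1 : ℕ), (j : ℤ)) • (orbA ^ (m + 1 - j) * orbB ^ j)) := by
  have hW : IsW (m + 1 : ℕ) (P - ∑ j ∈ Finset.range (m + 2),
      P.coeff ((m + 1 : ℕ), (j : ℤ)) • (orbA ^ (m + 1 - j) * orbB ^ j)) := by
    rw [sub_eq_add_neg, ← neg_one_smul ℂ]
    refine h.add (IsW.smul _ (IsW.sum _ _ ⟨0, by simp⟩ fun j hj => IsW.smul _ ?_))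
    have e : m + 1 - j + j = m + 1 := by simp at hj; omega
    have := isW_monomial (m + 1 - j) j
    rwa [e] at this
  refine ⟨hW.1, hW.2, fun r hr => ?_⟩
  have h1 := hW.3 r hr
  by_contra hlt
  obtain ⟨r1, s⟩ := r
  obtain rfl : r1 = (m + 1 : ℕ) := by simp only at h1 hlt; push_cast at *; omega
  refine hr ?_
  have e : ∀ j ∈ Finset.range (m + 2),
      (P.coeff ((m + 1 : ℕ), (j : ℤ)) • (orbA ^ (m + 1 - j) * orbB ^ j)).coeff ((m + 1 : ℕ), s)
      = if s = j then P.coeff ((m + 1 : ℕ), s) else 0 := fun j hj => by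
    have e : m + 1 - j + j = m + 1 := by simp at hj; omega
    have := coeff_monomial_top (m + 1 - j) j s
    rw [e] at this
    rw [AddMonoidAlgebra.coeff_smul, Finsupp.smul_apply, this]
    split_ifs with hs
    · rw [hs]; simp
    · simp
  rw [AddMonoidAlgebra.coeff_sub, Finsupp.sub_apply, AddMonoidAlgebra.coeff_sum,
    Finsupp.finsetSum_apply, Finset.sum_congr rfl e]
  by_cases hs : P.coeff ((m + 1 : ℕ), s) = 0
  · simp only [hs, ite_self, Finset.sum_const_zero, sub_zero]
  · obtain ⟨-, h2, h3, h4⟩ := h.bounds hs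
    simp only [abs_le] at h2 h3 h4
    push_cast at h2 h3 h4
    lift s to ℕ using by omega
    rw [Finset.sum_eq_single s]
    · simp
    · intro b _ hb
      rw [if_neg (by simpa using hb.symm)]
    · intro hb
      simp at hb
      omega

lemma Submodule.one_mem_pow_zero {S A : Type*} [CommRing S] [CommRing A] [Algebra S A]
    (N : Submodule S A) : (1 : A) ∈ N ^ 0 := by
  rw [pow_zero]
  exact Submodule.one_le.mp le_rfl

lemma Submodule.mul_mem_pow_add {S A : Type*} [CommRing S] [CommRing A] [Algebra S A]
    (N : Submodule S A) {x y : A} {i j : ℕ} (hx : x ∈ N ^ i) (hy : y ∈ N ^ j) :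
    x * y ∈ N ^ (i + j) := by
  rw [pow_add]
  exact Submodule.mul_mem_mul hx hy

lemma Submodule.pow_le_pow_of_le {S A : Type*} [CommRing S] [CommRing A] [Algebra S A]
    {N N' : Submodule S A} (h : N ≤ N') (m : ℕ) : N ^ m ≤ N' ^ m := by
  gcongr

lemma Submodule.pow_mem_pow_of_mem {S A : Type*} [CommRing S] [CommRing A] [Algebra S A]
    {N : Submodule S A} {x : A} (h : x ∈ N) (m : ℕ) : x ^ m ∈ N ^ m :=
  Submodule.pow_mem_pow _ h m

lemma IsW.mem_span_pow (R : Subring ℂ) {m : ℕ} {P : LP} (h : IsW m P) (hP : P ∈ lpIn R) :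
    P ∈ Submodule.span R ({1, orbA, orbB} : Set LP) ^ m := by
  induction m generalizing P with
  | zero =>
    have e : P = (⟨P.coeff 0, hP 0⟩ : R) • 1 := by
      refine AddMonoidAlgebra.ext ?_
      ext r
      by_cases hr : P.coeff r = 0
      · rw [hr]
        by_cases h0 : r = 0
        · subst h0
          have : (⟨P.coeff 0, hP 0⟩ : R) = 0 := Subtype.ext hr
          rw [this]; simp
        · rw [AddMonoidAlgebra.coeff_smul, Finsupp.smul_apply, AddMonoidAlgebra.one_def,
            AddMonoidAlgebra.coeff_single, Finsupp.single_apply, if_neg (Ne.symm h0), smul_zero]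
      · obtain ⟨-, h2, h3, h4⟩ := h.bounds hr
        have : r = 0 := by
          ext
          · simpa using h2
          · simpa using h3
        subst this
        rw [AddMonoidAlgebra.coeff_smul, Finsupp.smul_apply, AddMonoidAlgebra.coeff_one_zero]
        simp [Subring.smul_def]
    rw [e]
    exact Submodule.smul_mem _ _ (Submodule.one_mem_pow_zero _)
  | succ m ih =>
    have hA : orbA ∈ Submodule.span R ({1, orbA, orbB} : Set LP) := Submodule.subset_span (by simp)
    have hB : orbB ∈ Submodule.span R ({1, orbA, orbB} : Set LP) := Submodule.subset_span (by simp)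
    have h1 : (1 : LP) ∈ Submodule.span R ({1, orbA, orbB} : Set LP) :=
      Submodule.subset_span (by simp)
    have hAR : orbA ∈ lpIn R := Subring.add_mem _ (Subring.add_mem _ (single_mem_lpIn _ R.one_mem)
      (single_mem_lpIn _ R.one_mem)) (single_mem_lpIn _ R.one_mem)
    have hBR : orbB ∈ lpIn R := Subring.add_mem _ (Subring.add_mem _ (single_mem_lpIn _ R.one_mem)
      (single_mem_lpIn _ R.one_mem)) (single_mem_lpIn _ R.one_mem)
    have hQ := ih h.exists_sub (Subring.sub_mem _ hP (Subring.sum_mem _ fun j _ =>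
      smul_mem_lpIn (hP _) (Subring.mul_mem _ (Subring.pow_mem _ hAR _) (Subring.pow_mem _ hBR _))))
    have hle : Submodule.span R ({1, orbA, orbB} : Set LP) ^ m ≤
        Submodule.span R ({1, orbA, orbB} : Set LP) ^ (m + 1) := by
      intro x hx
      have := Submodule.mul_mem_pow_add _ hx (Submodule.pow_mem_pow_of_mem h1 1)
      rwa [one_pow, mul_one] at this
    rw [← sub_add_cancel P (∑ j ∈ Finset.range (m + 2),
      P.coeff ((m + 1 : ℕ), (j : ℤ)) • (orbA ^ (m + 1 - j) * orbB ^ j))]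
    refine Submodule.add_mem _ (hle hQ) (Submodule.sum_mem _ fun j hj => ?_)
    have hm := Submodule.mul_mem_pow_add _ (Submodule.pow_mem_pow_of_mem hA (m + 1 - j))
      (Submodule.pow_mem_pow_of_mem hB j)
    rw [show m + 1 - j + j = m + 1 by simp at hj; omega] at hm
    exact Submodule.smul_mem _ (⟨_, hP _⟩ : R) hm

/-- Exponents of monomials of degree `m` in the three generators. -/
def idx (m : ℕ) : Finset (ℕ × ℕ) :=
  (Finset.range (m + 1) ×ˢ Finset.range (m + 1)).filter fun p => p.1 + p.2 ≤ m

lemma mem_idx {m : ℕ} {p : ℕ × ℕ} : p ∈ idx m ↔ p.1 + p.2 ≤ m := by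
  simp only [idx, Finset.mem_filter, Finset.mem_product, Finset.mem_range]
  omega

/-- Monomials of degree `m` in three ring elements. -/
def mono3 {A : Type*} [CommRing A] (x y z : A) (m : ℕ) (p : ℕ × ℕ) : A :=
  x ^ p.1 * y ^ p.2 * z ^ (m - p.1 - p.2)

lemma span_pow_le {S A : Type*} [CommRing S] [CommRing A] [Algebra S A] (x y z : A) (m : ℕ) :
    Submodule.span S ({x, y, z} : Set A) ^ m ≤ Submodule.span S (mono3 x y z m '' idx m) := by
  induction m with
  | zero =>
    rw [pow_zero, Submodule.one_le]
    exact Submodule.subset_span ⟨(0, 0), by simp [mem_idx], by simp [mono3]⟩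
  | succ m ih =>
    rw [pow_succ]
    refine (mul_le_mul_left ih _).trans ?_
    rw [Submodule.span_mul_span, Submodule.span_le]
    rintro _ ⟨_, ⟨⟨a, b⟩, hp, rfl⟩, w, hw, rfl⟩
    have hp : a + b ≤ m := by simpa [mem_idx] using hp
    refine Submodule.subset_span ?_
    rcases hw with rfl | rfl | rfl
    · refine ⟨(a + 1, b), by simp [mem_idx]; omega, ?_⟩
      simp only [mono3]
      rw [show m + 1 - (a + 1) - b = m - a - b by omega]
      ring
    · refine ⟨(a, b + 1), by simp [mem_idx]; omega, ?_⟩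
      simp only [mono3]
      rw [show m + 1 - a - (b + 1) = m - a - b by omega]
      ring
    · refine ⟨(a, b), by simp [mem_idx]; omega, ?_⟩
      simp only [mono3]
      rw [show m + 1 - a - b = m - a - b + 1 by omega]
      ring

lemma IsW.exists_coeffs {R : Subring ℂ} (h6 : (1 / 6 : ℂ) ∈ R) {m : ℕ} {P : LP} (h : IsW m P)
    (hP : P ∈ lpIn R) : ∃ c : ℕ × ℕ → ℂ, (∀ p, c p ∈ R) ∧
      ∑ p ∈ idx m, c p • mono3 (coeff 0 gen0) (coeff 0 gen1) (coeff 0 gen3) m p = P := by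
  have hle : Submodule.span R ({1, orbA, orbB} : Set LP) ≤
      Submodule.span R ({coeff 0 gen0, coeff 0 gen1, coeff 0 gen3} : Set LP) := by
    set S := Submodule.span R ({coeff 0 gen0, coeff 0 gen1, coeff 0 gen3} : Set LP)
    have h0 : coeff 0 gen0 ∈ S := Submodule.subset_span (by simp)
    have h1 : coeff 0 gen1 ∈ S := Submodule.subset_span (by simp)
    have h3 : coeff 0 gen3 ∈ S := Submodule.subset_span (by simp)
    have hs : ∀ c ∈ R, ∀ x ∈ S, c • x ∈ S := fun c hc x hx => S.smul_mem ⟨c, hc⟩ hx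
    have hh := half_mem h6
    have hs1 : (1 / 12 : ℂ) ∈ R := by
      have := R.mul_mem h6 hh
      norm_num at this ⊢
      exact this
    have e1 : (1 : LP) = coeff 0 gen3 + (1 / 12 : ℂ) • coeff 0 gen1 := by
      rw [coeff_zero_gen3, coeff_zero_gen1]; module
    have hone : (1 : LP) ∈ S := by
      rw [e1]; exact S.add_mem h3 (hs _ hs1 _ h1)
    have hsum : orbA + orbB ∈ S := by
      have e : orbA + orbB = (6 : ℂ) • coeff 0 gen3 - (3 / 2 : ℂ) • coeff 0 gen1 := by
        rw [coeff_zero_gen3, coeff_zero_gen1]; module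
      rw [e]
      refine S.sub_mem (hs _ (by exact_mod_cast natCast_mem R 6) _ h3) (hs _ ?_ _ h1)
      have := R.mul_mem (natCast_mem R 3) hh
      norm_num at this ⊢
      exact this
    have eA : orbA = (1 / 2 : ℂ) • ((orbA + orbB) + coeff 0 gen0) := by
      rw [coeff_zero_gen0]; module
    have eB : orbB = (1 / 2 : ℂ) • ((orbA + orbB) - coeff 0 gen0) := by
      rw [coeff_zero_gen0]; module
    rw [Submodule.span_le]
    rintro x (rfl | rfl | rfl)
    · exact hone
    · rw [eA]; exact hs _ hh _ (S.add_mem hsum h0)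
    · rw [eB]; exact hs _ hh _ (S.sub_mem hsum h0)
  have := span_pow_le _ _ _ m (Submodule.pow_le_pow_of_le hle m (h.mem_span_pow R hP))
  rw [Submodule.mem_span_image_finset_iff_exists_fun'] at this
  obtain ⟨c, hc⟩ := this
  exact ⟨fun p => c p, fun p => (c p).2, hc⟩

end LeadingTerms

section Decomposition

open PowerSeries

lemma IsV.isW_coeff_zero {m : ℤ} {φ : PowerSeries LP} (h : IsV m φ) : IsW m (coeff 0 φ) := by
  have h1 : ∀ r, (coeff 0 φ).coeff (_root_.rot r) = (coeff 0 φ).coeff r := fun r => by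
    have := h.rot (((0 : ℕ) : ℤ), r)
    rwa [smul_zero, add_zero, extq_apply, cf_natCast, cf_natCast] at this
  refine ⟨h1, fun r => ?_, fun r hr => ?_⟩
  · have := h.mir (((0 : ℕ) : ℤ), r)
    rwa [smul_zero, add_zero, extq_apply, cf_natCast, cf_natCast] at this
  · rw [← h1, ← cf_natCast, ← h.ell] at hr
    by_contra hlt
    refine hr (cf_of_neg _ ?_)
    simp [ellL, _root_.rot]
    omega

/-- Monomials in the generators. -/
abbrev genM (m : ℕ) (p : ℕ × ℕ) : PowerSeries LP := mono3 gen0 gen1 gen3 m p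

lemma isV_genM {m : ℕ} {p : ℕ × ℕ} (hp : p ∈ idx m) : IsV m (genM m p) := by
  have := ((isV_gen0.pow p.1).mul (isV_gen1.pow p.2)).mul (isV_gen3.pow (m - p.1 - p.2))
  rw [mem_idx] at hp
  have e : (p.1 : ℤ) * 1 + p.2 * 1 + (m - p.1 - p.2 : ℕ) * 1 = m := by
    rw [Nat.cast_sub (by omega), Nat.cast_sub (by omega)]
    ring
  rwa [e] at this

lemma coeff_zero_genM (m : ℕ) (p : ℕ × ℕ) :
    coeff 0 (genM m p) = mono3 (coeff 0 gen0) (coeff 0 gen1) (coeff 0 gen3) m p := by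
  simp only [genM, mono3, coeff_zero_eq_constantCoeff_apply, map_mul, map_pow]

lemma genM_mem {R : Subring ℂ} (h6 : (1 / 6 : ℂ) ∈ R) (m : ℕ) (p : ℕ × ℕ) : genM m p ∈ jIn R :=
  Subring.mul_mem _ (Subring.mul_mem _ (Subring.pow_mem _ (gen0_mem h6) _)
    (Subring.pow_mem _ (gen1_mem h6) _)) (Subring.pow_mem _ (gen3_mem h6) _)

lemma exists_leading {R : Subring ℂ} (h6 : (1 / 6 : ℂ) ∈ R) (m : ℕ) (P : LP) :
    ∃ c : ℕ × ℕ → ℂ, IsW m P → ∑ p ∈ idx m, c p • coeff 0 (genM m p) = P ∧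
      (P ∈ lpIn R → ∀ p, c p ∈ R) := by
  simp only [coeff_zero_genM]
  by_cases hW : IsW m P
  · by_cases hP : P ∈ lpIn R
    · obtain ⟨c, hc, h⟩ := hW.exists_coeffs h6 hP
      exact ⟨c, fun _ => ⟨h, fun _ => hc⟩⟩
    · obtain ⟨c, -, h⟩ := hW.exists_coeffs (R := ⊤) trivial (fun _ => trivial)
      exact ⟨c, fun _ => ⟨h, fun h' => (hP h').elim⟩⟩
  · exact ⟨0, fun h => (hW h).elim⟩

/-- Every formal Jacobi series is a combination of monomials in the generators, and integrality of
its coefficients up to some order is inherited by the coefficients of the combination. -/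
theorem IsV.exists_decomposition {R : Subring ℂ} (h6 : (1 / 6 : ℂ) ∈ R) {m : ℕ}
    {φ : PowerSeries LP} (h : IsV m φ) :
    ∃ g : ℕ × ℕ → PowerSeries ℂ, φ = ∑ p ∈ idx m, iq (g p) * genM m p ∧
      ∀ N, (∀ n ≤ N, coeff n φ ∈ lpIn R) → ∀ p, ∀ n ≤ N, coeff n (g p) ∈ R := by
  choose ξ hξ using exists_leading h6 m
  let rem : PowerSeries LP → PowerSeries LP := fun ψ => ψ - ∑ p ∈ idx m, ξ (coeff 0 ψ) p • genM m p
  let sh : PowerSeries LP → PowerSeries LP := fun ψ => .mk fun n => coeff (n + 1) (rem ψ)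
  have hrem : ∀ ψ, IsV m ψ → rem ψ = X * sh ψ := fun ψ hψ => by
    have h0 : constantCoeff (rem ψ) = 0 := by
      rw [← coeff_zero_eq_constantCoeff_apply, map_sub, map_sum]
      simp only [coeff_smul]
      rw [(hξ _ hψ.isW_coeff_zero).1, sub_self]
    have := sub_const_eq_X_mul_shift (rem ψ)
    rwa [h0, map_zero, sub_zero] at this
  have hsh : ∀ ψ, IsV m ψ → IsV m (sh ψ) := fun ψ hψ => by
    refine IsV.of_X_mul ?_
    rw [← hrem ψ hψ]
    exact hψ.sub (IsV.sum _ _ fun p hp => (isV_genM hp).smul _)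
  let st : ℕ → PowerSeries LP := fun n => sh^[n] φ
  have hst : ∀ n, st (n + 1) = sh (st n) := fun n => Function.iterate_succ_apply' _ _ _
  have hV : ∀ n, IsV m (st n) := fun n => by
    induction n with
    | zero => exact h
    | succ n ih => rw [hst]; exact hsh _ ih
  let g : ℕ → ℕ × ℕ → PowerSeries ℂ := fun j p => .mk fun n => ξ (coeff 0 (st (n + j))) p
  have hg : ∀ j p, g j p = C (ξ (coeff 0 (st j)) p) + X * g (j + 1) p := fun j p => by
    have := sub_const_eq_X_mul_shift (g j p)
    rw [sub_eq_iff_eq_add'] at this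
    rw [this]
    congr 2
    · rw [← coeff_zero_eq_constantCoeff_apply, coeff_mk, zero_add]
    · ext n
      rw [coeff_mk, coeff_mk, coeff_mk, add_right_comm, add_assoc]
  have hC : ∀ (c : ℂ) (ψ : PowerSeries LP), iq (C c) * ψ = c • ψ := fun c ψ => by
    rw [iq, map_C, ← smul_eq_C_mul, algebraMap_smul]
  have hX : iq X = X := map_X _
  have hΨ : ∀ j, ∑ p ∈ idx m, iq (g j p) * genM m p = ∑ p ∈ idx m, ξ (coeff 0 (st j)) p • genM m p
      + X * ∑ p ∈ idx m, iq (g (j + 1) p) * genM m p := fun j => by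
    rw [Finset.mul_sum, ← Finset.sum_add_distrib]
    refine Finset.sum_congr rfl fun p _ => ?_
    rw [hg, map_add, add_mul, hC, map_mul, hX, mul_assoc]
  have hS : ∀ j, st j = ∑ p ∈ idx m, ξ (coeff 0 (st j)) p • genM m p + X * st (j + 1) := fun j => by
    rw [hst, ← hrem _ (hV j), add_sub_cancel]
  have key : ∀ N j, coeff N (st j) = coeff N (∑ p ∈ idx m, iq (g j p) * genM m p) := fun N => by
    induction N with
    | zero =>
      intro j
      rw [hΨ]
      conv_lhs => rw [hS]
      simp only [map_add, coeff_zero_X_mul]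
    | succ N ih =>
      intro j
      rw [hΨ]
      conv_lhs => rw [hS]
      simp only [map_add, coeff_succ_X_mul, ih]
  refine ⟨g 0, ?_, fun N hN p n hn => ?_⟩
  · ext1 N
    exact key N 0
  · have hint : ∀ j n, n + j ≤ N → coeff n (st j) ∈ lpIn R := fun j => by
      induction j with
      | zero => exact fun n hn => hN n hn
      | succ j ih =>
        intro n hn
        rw [hst, coeff_mk, map_sub, map_sum]
        refine Subring.sub_mem _ (ih _ (by omega)) (Subring.sum_mem _ fun p _ => ?_)
        rw [coeff_smul]
        exact smul_mem_lpIn ((hξ _ (hV j).isW_coeff_zero).2 (ih 0 (by omega)) p) (genM_mem h6 m p _)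
    rw [coeff_mk, add_zero]
    exact (hξ _ (hV n).isW_coeff_zero).2 (hint n 0 (by omega)) p

end Decomposition

section Specialization

open PowerSeries

/-- The substitution `e^r ↦ e^{(r₁ + t r₂) u}`. -/
def evalExp (t : ℂ) : LP →ₐ[ℂ] PowerSeries ℂ :=
  AddMonoidAlgebra.lift ℂ (PowerSeries ℂ) (ℤ × ℤ)
    { toFun := fun r => ex ((r.toAdd.1 : ℂ) + t * r.toAdd.2)
      map_one' := by simp [ex_zero]
      map_mul' := fun r s => by
        rw [← ex_add]
        congr 1
        simp
        ring }

lemma evalExp_single (t : ℂ) (r : ℤ × ℤ) (b : ℂ) :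
    evalExp t (AddMonoidAlgebra.single r b) = b • ex ((r.1 : ℂ) + t * r.2) :=
  AddMonoidAlgebra.lift_single _ _ _

/-- The Taylor expansion in `u` of the restriction of a Laurent-coefficient series to a line. -/
def Et (t : ℂ) : PowerSeries LP →+* PowerSeries (PowerSeries ℂ) :=
  swapVars.comp (PowerSeries.map (evalExp t : LP →+* PowerSeries ℂ))

lemma coeff_Et (t : ℂ) (φ : PowerSeries LP) (d n : ℕ) :
    coeff n (coeff d (Et t φ)) = coeff d (evalExp t (coeff n φ)) := by
  rw [Et, RingHom.comp_apply, coeff_swapVars, coeff_map]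
  rfl

lemma Et_iq (t : ℂ) (a : PowerSeries ℂ) : Et t (iq a) = C a := by
  ext d n
  rw [coeff_Et, coeff_iq, AlgHom.commutes, coeff_C]
  change coeff d (C (coeff n a)) = _
  rw [coeff_C]
  split_ifs <;> simp

lemma Et_smul (t c : ℂ) (φ : PowerSeries LP) : Et t (c • φ) = c • Et t φ := by
  ext d n
  rw [coeff_Et, coeff_smul, map_smul, coeff_smul, coeff_smul, coeff_smul, coeff_Et]

lemma Et_ser {ι : Type*} {deg : ι → ℕ} (h : ∀ n, {i | deg i = n}.Finite) (t : ℂ)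
    (r : ι → ℤ × ℤ) (b : ι → ℂ) :
    Et t (ser h fun i => AddMonoidAlgebra.single (r i) (b i))
      = swapVars (ser h fun i => b i • ex (((r i).1 : ℂ) + t * (r i).2)) := by
  rw [Et, RingHom.comp_apply, map_ser]
  congr 2
  funext i
  exact evalExp_single _ _ _

lemma thetaS_mul_thetaS_mul (l l' l'' : ℕ) (t : ℂ) :
    thetaS l 1 * thetaS l' t * thetaS l'' (-1 - t) = swapVars (ser finite_tri3 fun k =>
      (sg k.1 * sg k.2.1 * sg k.2.2 * (((k.1 : ℂ) + 1 / 2) ^ l / l.factorial *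
        (((k.2.1 : ℂ) + 1 / 2) ^ l' / l'.factorial) *
        (((k.2.2 : ℂ) + 1 / 2) ^ l'' / l''.factorial))) •
        ex (((k.1 - k.2.2 : ℤ) : ℂ) + t * (k.2.1 - k.2.2 : ℤ))) := by
  rw [thetaS, thetaS, thetaS, ← map_mul, ← map_mul, mul_assoc, ser_mul, ser_mul]
  congr 2
  funext k
  rw [smul_mul_smul_comm, smul_mul_smul_comm, ← ex_add, ← ex_add]
  refine congrArg₂ (· • ·) ?_ (congrArg ex ?_)
  · ring
  · push_cast
    ring

lemma Et_thetaT_zero (t : ℂ) :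
    Et t (thetaT 0) = thetaS 0 1 * thetaS 0 t * thetaS 0 (-1 - t) := by
  rw [thetaS_mul_thetaS_mul, thetaT, Et_ser]
  congr 3
  funext k
  simp

lemma Et_thetaT_one (t : ℂ) : Et t (thetaT 1) = thetaOne 1 t (-1 - t) := by
  rw [thetaOne]
  simp only [thetaS_mul_thetaS_mul, ← map_add, ← ser_add, ← add_smul]
  rw [thetaT, Et_ser]
  congr 3
  funext k
  congr 1
  norm_num
  ring

lemma Et_thetaT_three (t : ℂ) :
    (1 / 6 : ℂ) • Et t (thetaT 3) = thetaThree 1 t (-1 - t) := by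
  rw [thetaThree]
  simp only [thetaS_mul_thetaS_mul, ← map_add, ← ser_add, ← add_smul]
  rw [← Et_smul, thetaT, Et, RingHom.comp_apply]
  congr 1
  ext1 n
  rw [coeff_map, coeff_smul, coeff_ser, coeff_ser, Finset.smul_sum, map_sum]
  refine Finset.sum_congr (M := PowerSeries ℂ) rfl fun k _ => ?_
  rw [AddMonoidAlgebra.smul_single]
  refine (evalExp_single _ _ _).trans ?_
  congr 1
  simp only [smul_eq_mul, Nat.factorial]
  norm_num
  ring

/-- `F = c u^d + O(u^{d+1})`. -/
def Leads (d : ℕ) (c : PowerSeries ℂ) (F : PowerSeries (PowerSeries ℂ)) : Prop :=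
  ∃ Y, F = X ^ d * Y ∧ constantCoeff Y = c

lemma Leads.mul {d d' : ℕ} {c c' : PowerSeries ℂ} {F F' : PowerSeries (PowerSeries ℂ)}
    (h : Leads d c F) (h' : Leads d' c' F') : Leads (d + d') (c * c') (F * F') := by
  obtain ⟨Y, rfl, rfl⟩ := h
  obtain ⟨Y', rfl, rfl⟩ := h'
  exact ⟨Y * Y', by ring, map_mul _ _ _⟩

lemma Leads.congr {d d' : ℕ} {c : PowerSeries ℂ} {F : PowerSeries (PowerSeries ℂ)}
    (h : Leads d c F) (e : d = d') : Leads d' c F := e ▸ h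

lemma Leads.add {d : ℕ} {c c' : PowerSeries ℂ} {F F' : PowerSeries (PowerSeries ℂ)}
    (h : Leads d c F) (h' : Leads d c' F') : Leads d (c + c') (F + F') := by
  obtain ⟨Y, rfl, rfl⟩ := h
  obtain ⟨Y', rfl, rfl⟩ := h'
  exact ⟨Y + Y', by ring, map_add _ _ _⟩

lemma leads_zero (F : PowerSeries (PowerSeries ℂ)) : Leads 0 (constantCoeff F) F :=
  ⟨F, by simp, rfl⟩

lemma leads_C (a : PowerSeries ℂ) : Leads 0 a (C a) := ⟨C a, by simp, by simp⟩

lemma Leads.pow {d : ℕ} {c : PowerSeries ℂ} {F : PowerSeries (PowerSeries ℂ)}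
    (h : Leads d c F) (n : ℕ) : Leads (n * d) (c ^ n) (F ^ n) := by
  obtain ⟨Y, rfl, rfl⟩ := h
  exact ⟨Y ^ n, by rw [mul_pow, ← pow_mul, mul_comm n], map_pow _ _ _⟩

lemma Leads.coeff_eq {d : ℕ} {c : PowerSeries ℂ} {F : PowerSeries (PowerSeries ℂ)}
    (h : Leads d c F) : coeff d F = c := by
  obtain ⟨Y, rfl, rfl⟩ := h
  simpa using coeff_X_pow_mul Y d 0

lemma Leads.coeff_lt {d : ℕ} {c : PowerSeries ℂ} {F : PowerSeries (PowerSeries ℂ)}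
    (h : Leads d c F) {e : ℕ} (he : e < d) : coeff e F = 0 := by
  obtain ⟨Y, rfl, rfl⟩ := h
  rw [coeff_X_pow_mul', if_neg (by omega)]

lemma thetaC_zero : thetaC 0 = 0 := by
  ext n
  rw [thetaC, coeff_ser, map_zero]
  have hs : ∀ k, tri (-1 - k) = tri k := fun k => by
    have h := two_mul_tri k
    have h' := two_mul_tri (-1 - k)
    nlinarith
  have hg : ∀ k, sg (-1 - k) = - sg k := fun k => by
    have : sg (-1 - k) = sg (-k - 1) := by congr 1; ring
    rw [this, sg_sub_one, sg, sg, _root_.zpow_neg, ← _root_.inv_zpow]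
    norm_num
  refine Finset.sum_involution (fun k _ => -1 - k) ?_ ?_ ?_ ?_
  · intro k _
    simp [hg]
  · intro k _ _
    omega
  · intro k hk
    simpa [hs] using hk
  · intro k _
    ring

lemma leads_thetaS_zero (a : ℂ) : Leads 1 (C a * Jq) (thetaS 0 a) := by
  refine ⟨.mk fun d => coeff (d + 1) (thetaS 0 a), ?_, ?_⟩
  · ext1 d
    rcases d with _ | d
    · rw [coeff_thetaS, thetaC_zero]
      simp
    · rw [pow_one, coeff_succ_X_mul, coeff_mk]
  · rw [← coeff_zero_eq_constantCoeff_apply, coeff_mk, coeff_thetaS, ← Jq, smul_eq_C_mul]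
    simp

lemma leads_thetaS_one (a : ℂ) : Leads 0 Jq (thetaS 1 a) := by
  convert leads_zero _ using 1
  rw [← coeff_zero_eq_constantCoeff_apply, coeff_thetaS, ← Jq]
  simp

lemma constantCoeff_thetaS_zero (a : ℂ) : constantCoeff (thetaS 0 a) = 0 := by
  rw [← coeff_zero_eq_constantCoeff_apply, (leads_thetaS_zero a).coeff_lt one_pos]

lemma leads_thetaOne (t : ℂ) :
    Leads 2 (C (-(t ^ 2 + t + 1)) * Jq ^ 3) (thetaOne 1 t (-1 - t)) := by
  rw [thetaOne]
  have h1 := (((leads_thetaS_one 1).mul (leads_thetaS_zero t)).mul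
    (leads_thetaS_zero (-1 - t))).congr (d' := 2) (by norm_num)
  have h2 := (((leads_thetaS_zero 1).mul (leads_thetaS_one t)).mul
    (leads_thetaS_zero (-1 - t))).congr (d' := 2) (by norm_num)
  have h3 := (((leads_thetaS_zero 1).mul (leads_thetaS_zero t)).mul
    (leads_thetaS_one (-1 - t))).congr (d' := 2) (by norm_num)
  convert (h1.add h2).add h3 using 1
  simp only [map_sub, map_neg, map_one, map_add, map_pow]
  ring

lemma leads_thetaThree (t : ℂ) : Leads 0 (Jq ^ 3) (thetaThree 1 t (-1 - t)) := by
  convert leads_zero _ using 1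
  have h1 : ∀ a, constantCoeff (thetaS 1 a) = Jq := fun a => by
    rw [← coeff_zero_eq_constantCoeff_apply, (leads_thetaS_one a).coeff_eq]
  rw [thetaThree]
  simp only [map_add, map_mul, constantCoeff_thetaS_zero, h1]
  ring

lemma Et_gen3 (t : ℂ) : Et t gen3 =
    C (Jq⁻¹ ^ 3) * (thetaThree 1 t (-1 - t) + 3 * eC * thetaOne 1 t (-1 - t)) := by
  rw [gen3, map_mul, Et_iq, map_sub, Et_smul, Et_smul, map_mul, Et_iq, Et_thetaT_three,
    Et_thetaT_one, eC]
  congr 1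
  rw [sub_eq_add_neg]
  congr 1
  have h : (3 : PowerSeries (PowerSeries ℂ)) = C (3 : PowerSeries ℂ) := (map_ofNat C 3).symm
  rw [h, ← map_mul, ← smul_mul_assoc, ← neg_mul]
  congr 1
  ext d n
  simp only [map_neg, coeff_smul, coeff_C]
  split_ifs
  · have h : (3 : PowerSeries ℂ) = C (3 : ℂ) := (map_ofNat C 3).symm
    rw [h, coeff_C_mul, map_rat_smul]
    simp [Rat.smul_def]
    ring
  · simp

lemma inv_Jq_pow_mul : Jq⁻¹ ^ 3 * Jq ^ 3 = 1 := by
  rw [← mul_pow, mul_comm, Jq_mul_inv, one_pow]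

lemma leads_gen0 (t : ℂ) : Leads 3 (C (-(t ^ 2 + t))) (Et t gen0) := by
  rw [gen0, map_mul, Et_iq, Et_thetaT_zero]
  have h := (leads_C (Jq⁻¹ ^ 3)).mul (((leads_thetaS_zero 1).mul (leads_thetaS_zero t)).mul
    (leads_thetaS_zero (-1 - t)))
  convert h using 1
  simp only [map_sub, map_neg, map_one, map_add, map_pow]
  linear_combination -(C t ^ 2 + C t) * (inv_Jq_pow_mul).symm

lemma leads_gen1 (t : ℂ) : Leads 2 (C (-(t ^ 2 + t + 1))) (Et t gen1) := by
  rw [gen1, map_mul, Et_iq, Et_thetaT_one]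
  convert (leads_C (Jq⁻¹ ^ 3)).mul (leads_thetaOne t) using 1
  linear_combination C (-(t ^ 2 + t + 1)) * (inv_Jq_pow_mul).symm

lemma leads_gen3 (t : ℂ) : Leads 0 1 (Et t gen3) := by
  rw [Et_gen3]
  have h := (leads_C (Jq⁻¹ ^ 3)).mul ((leads_thetaThree t).add (leads_zero
    (3 * eC * thetaOne 1 t (-1 - t))))
  convert h using 1
  rw [map_mul (constantCoeff (R := PowerSeries ℂ)) (3 * eC), ← coeff_zero_eq_constantCoeff_apply (thetaOne _ _ _), (leads_thetaOne t).coeff_lt two_pos]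
  rw [mul_zero, add_zero, inv_Jq_pow_mul]

lemma C_Dlt_pow : (C Dlt ^ 3 * C (Jq⁻¹ ^ 3) : PowerSeries (PowerSeries ℂ))
    = C (X * Jq ^ 7) ^ 3 := by
  rw [← map_pow, ← map_pow, ← map_mul]
  congr 1
  rw [Dlt]
  linear_combination X ^ 3 * Jq ^ 21 * inv_Jq_pow_mul

lemma isJ_gen0 (t : ℕ) : IsJ 33 (C Dlt ^ 3 * Et t gen0 * corr (t ^ 2 + t + 1)) := by
  have h := isJ_thetaZero 1 t
  push_cast at h
  rw [gen0, map_mul, Et_iq, Et_thetaT_zero, ← mul_assoc, C_Dlt_pow]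
  convert h using 1
  rw [show (1 : ℚ) ^ 2 + 1 * t + t ^ 2 = t ^ 2 + t + 1 by ring]
  ring

lemma isJ_gen1 (t : ℕ) : IsJ 34 (C Dlt ^ 3 * Et t gen1 * corr (t ^ 2 + t + 1)) := by
  have h := isJ_thetaOne 1 t
  push_cast at h
  rw [gen1, map_mul, Et_iq, Et_thetaT_one, ← mul_assoc, C_Dlt_pow]
  convert h using 1
  rw [show (1 : ℚ) ^ 2 + 1 * t + t ^ 2 = t ^ 2 + t + 1 by ring]
  ring

lemma isJ_gen3 (t : ℕ) : IsJ 36 (C Dlt ^ 3 * Et t gen3 * corr (t ^ 2 + t + 1)) := by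
  have h := (isJ_thetaThree 1 t).smul (1 / 3)
  push_cast at h
  rw [Et_gen3, ← mul_assoc, C_Dlt_pow]
  convert h using 1
  rw [show (1 : ℚ) ^ 2 + 1 * t + t ^ 2 = t ^ 2 + t + 1 by ring]
  have h3 : ∀ F : PowerSeries (PowerSeries ℂ), (1 / 3 : ℂ) • (3 * F) = F := fun F => by
    rw [show (3 : PowerSeries (PowerSeries ℂ)) * F = (3 : ℂ) • F by
      rw [ofNat_smul_eq_nsmul, nsmul_eq_mul]; norm_num, smul_smul]
    norm_num
  refine (h3 _).symm.trans ?_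
  congr 1
  ring

lemma constantCoeff_corr (M : ℚ) : constantCoeff (corr M) = 1 := constantCoeff_gauss _

lemma corr_nsmul (M : ℚ) (n : ℕ) : corr (n * M) = corr M ^ n := by
  induction n with
  | zero => simp [corr_zero]
  | succ n ih => rw [pow_succ, ← ih, ← corr_add]; congr 1; push_cast; ring

end Specialization

section JacobiIntegrality

open PowerSeries

/-- The order in `u` of the monomial `p` in the generators. -/
def ordM (p : ℕ × ℕ) : ℕ := 3 * p.1 + 2 * p.2

/-- The leading Taylor coefficient of the monomial `p`, as a function of `s = t ^ 2 + t`. -/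
def leadM (s : ℂ) (p : ℕ × ℕ) : ℂ := (-s) ^ p.1 * (-(s + 1)) ^ p.2

lemma leads_genM (t : ℂ) (m : ℕ) (p : ℕ × ℕ) :
    Leads (ordM p) (C (leadM (t ^ 2 + t) p)) (Et t (genM m p)) := by
  have h := (((leads_gen0 t).pow p.1).mul ((leads_gen1 t).pow p.2)).mul
    ((leads_gen3 t).pow (m - p.1 - p.2))
  rw [genM, mono3, map_mul, map_mul, map_pow, map_pow, map_pow, leadM, map_mul, map_pow, map_pow]
  convert h.congr (d' := ordM p) (by rw [ordM]; ring) using 1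
  rw [one_pow, mul_one]

/-- The normalized Taylor expansion of the monomial `p`. -/
def normM (t : ℕ) (m : ℕ) (p : ℕ × ℕ) : PowerSeries (PowerSeries ℂ) :=
  C (Dlt ^ (3 * m)) * Et t (genM m p) * corr (m * (t ^ 2 + t + 1))

lemma isJ_normM (t m : ℕ) {p : ℕ × ℕ} (hp : p ∈ idx m) :
    IsJ (36 * m - ordM p) (normM t m p) := by
  obtain ⟨c, hc⟩ := Nat.exists_eq_add_of_le (mem_idx.mp hp)
  have h := (((isJ_gen0 t).pow p.1).mul ((isJ_gen1 t).pow p.2)).mul ((isJ_gen3 t).pow c)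
  convert h.congr (w' := 36 * m - ordM p) (by rw [ordM, hc]; push_cast; ring) using 1
  rw [normM, corr_nsmul, genM, mono3, map_mul, map_mul, map_pow, map_pow, map_pow, hc,
    show p.1 + p.2 + c - p.1 - p.2 = c by omega, pow_mul, map_pow]
  ring

lemma leads_normM (t m : ℕ) (p : ℕ × ℕ) :
    Leads (ordM p) (Dlt ^ (3 * m) * C (leadM (t ^ 2 + t) p)) (normM t m p) := by
  have h := ((leads_C (Dlt ^ (3 * m))).mul (leads_genM t m p)).mul
    (leads_zero (corr (m * (t ^ 2 + t + 1))))
  rw [constantCoeff_corr, mul_one] at h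
  exact h.congr (by omega)

lemma mem_of_forall_sum_leadM_mem {V : Type*} [AddCommGroup V] [Module ℂ V] (W : Submodule ℂ V)
    (E : Finset (ℕ × ℕ)) (hE : Set.InjOn Prod.fst (E : Set (ℕ × ℕ))) (v : ℕ × ℕ → V)
    (h : ∀ t : ℕ, ∑ p ∈ E, leadM ((t : ℂ) ^ 2 + t) p • v p ∈ W) : ∀ p ∈ E, v p ∈ W := by
  by_contra! hne
  obtain ⟨p, hp, hv⟩ := hne
  obtain ⟨f, hf, hW⟩ := Submodule.exists_dual_map_eq_bot_of_notMem hv inferInstance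
  have hfW : ∀ x ∈ W, f x = 0 := fun x hx => by
    have : f x ∈ W.map f := Submodule.mem_map_of_mem hx
    rwa [hW, Submodule.mem_bot] at this
  obtain ⟨p₀, hp₀, hmin⟩ := (E.filter fun p => f (v p) ≠ 0).exists_min_image Prod.fst
    ⟨p, Finset.mem_filter.mpr ⟨hp, hf⟩⟩
  rw [Finset.mem_filter] at hp₀
  let P : Polynomial ℂ := ∑ p ∈ E, Polynomial.C (f (v p)) *
    (Polynomial.X ^ p.1 * ((-1) ^ p.1 * (-(Polynomial.X + 1)) ^ p.2))
  have hP : P = 0 := by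
    refine Polynomial.eq_zero_of_infinite_isRoot P (Set.infinite_of_injective_forall_mem
      (f := fun t : ℕ => (t : ℂ) ^ 2 + t) (fun a b hab => ?_) fun t => ?_)
    · have h1 : a ^ 2 + a = b ^ 2 + b := by
        have h2 : (a : ℂ) ^ 2 + a = (b : ℂ) ^ 2 + b := hab
        exact_mod_cast h2
      nlinarith
    · have h1 := hfW _ (h t)
      rw [map_sum] at h1
      change Polynomial.eval _ P = 0
      rw [← h1, Polynomial.eval_finsetSum]
      refine Finset.sum_congr rfl fun q _ => ?_
      rw [map_smul, smul_eq_mul, leadM, neg_pow ((t : ℂ) ^ 2 + t)]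
      simp
      ring
  have hc : P.coeff p₀.1 = f (v p₀) * ((-1) ^ p₀.1 * (-1) ^ p₀.2) := by
    rw [Polynomial.finsetSum_coeff, Finset.sum_eq_single p₀]
    · rw [Polynomial.coeff_C_mul]
      congr 1
      have := Polynomial.coeff_X_pow_mul
        ((-1) ^ p₀.1 * (-(Polynomial.X + 1)) ^ p₀.2 : Polynomial ℂ) p₀.1 0
      rw [zero_add] at this
      rw [this, Polynomial.coeff_zero_eq_eval_zero]
      simp
    · intro q hq hne
      rw [Polynomial.coeff_C_mul]
      by_cases h0 : f (v q) = 0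
      · rw [h0, zero_mul]
      · have h1 := hmin q (Finset.mem_filter.mpr ⟨hq, h0⟩)
        have h2 : p₀.1 ≠ q.1 := fun e => hne (hE hq hp₀.1 e.symm)
        rw [Polynomial.coeff_X_pow_mul', if_neg (by omega), mul_zero]
    · exact fun h => (h hp₀.1).elim
  rw [hP, Polynomial.coeff_zero] at hc
  exact hp₀.2 ((mul_eq_zero.mp hc.symm).resolve_right (by simp))

lemma exists_isMF_Dlt_pow_mul {k : ℤ} {m : ℕ} {φ : PowerSeries LP} {g : ℕ × ℕ → PowerSeries ℂ}
    (hφ : φ = ∑ p ∈ idx m, iq (g p) * genM m p)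
    (hJ : ∀ t : ℕ, IsJ k (Et t φ * corr (m * (t ^ 2 + t + 1)))) (D : ℕ) :
    ∃ N : ℕ, ∀ p ∈ idx m, ordM p < D → IsMF (k + ordM p + 12 * N) (Dlt ^ N * g p) := by
  induction D with
  | zero => exact ⟨0, fun p _ h => absurd h (by omega)⟩
  | succ D ih =>
    obtain ⟨N, hN⟩ := ih
    have hD : ∀ n : ℕ, IsMF (n * 12 : ℤ) (Dlt ^ n) := fun n => isMF_Dlt.pow n
    have key : ∀ t : ℕ, ∑ p ∈ (idx m).filter (fun p => ordM p = D),
        leadM ((t : ℂ) ^ 2 + t) p • (Dlt ^ (N + 3 * m) * g p) ∈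
          mfSubmodule (k + D + 12 * (N + 3 * m : ℕ)) := by
      intro t
      have h1 : IsJ (k + 12 * (N + 3 * m : ℕ)) (∑ p ∈ idx m, C (Dlt ^ N * g p) * normM t m p) := by
        convert ((hD (N + 3 * m)).isJ.mul (hJ t)).congr
          (w' := k + 12 * (N + 3 * m : ℕ)) (by push_cast; ring) using 1
        rw [hφ, map_sum, Finset.sum_mul, Finset.mul_sum]
        refine Finset.sum_congr rfl fun p _ => ?_
        rw [normM, map_mul (Et (t : ℂ)), Et_iq, pow_add, map_mul, map_mul]
        ring
      have h2 : IsJ (k + 12 * (N + 3 * m : ℕ))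
          (∑ p ∈ (idx m).filter (fun p => ordM p < D), C (Dlt ^ N * g p) * normM t m p) := by
        refine IsJ.sum _ _ fun p hp => ?_
        rw [Finset.mem_filter] at hp
        exact ((hN p hp.1 hp.2).isJ.mul (isJ_normM t m hp.1)).congr (by push_cast; ring)
      have h3 := (h1.sub h2) D
      rw [← Finset.sum_filter_add_sum_filter_not (idx m) (fun p => ordM p < D),
        add_sub_cancel_left, map_sum] at h3
      rw [← Finset.sum_filter_add_sum_filter_not (Finset.filter _ _) (fun p => ordM p = D),
        Finset.filter_filter, Finset.filter_filter,
        Finset.sum_eq_zero (s := Finset.filter (fun p => ¬ ordM p < D ∧ ¬ ordM p = D) _),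
        add_zero] at h3
      · change IsMF _ _
        convert h3.congr (w' := k + D + 12 * (N + 3 * m : ℕ)) (by ring) using 1
        refine Finset.sum_congr ?_ fun p hp => ?_
        · ext p
          simp only [Finset.mem_filter]
          constructor
          · rintro ⟨h, h'⟩
            exact ⟨h, by omega, h'⟩
          · rintro ⟨h, -, h'⟩
            exact ⟨h, h'⟩
        · rw [Finset.mem_filter] at hp
          have h4 := (leads_normM t m p).coeff_eq
          rw [hp.2.2] at h4
          rw [coeff_C_mul, h4, smul_eq_C_mul, pow_add]
          ring
      · intro p hp
        rw [Finset.mem_filter] at hp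
        rw [coeff_C_mul, (leads_normM t m p).coeff_lt (by omega), mul_zero]
    have hmem := mem_of_forall_sum_leadM_mem _ _ (fun p hp q hq hpq => ?_) _ key
    · refine ⟨N + 3 * m, fun p hp hlt => ?_⟩
      rcases Nat.lt_succ_iff_lt_or_eq.mp hlt with hlt | heq
      · have := (hD (3 * m)).mul (hN p hp hlt)
        rw [← mul_assoc, ← pow_add, add_comm (3 * m)] at this
        exact this.congr (by push_cast; ring)
      · have := hmem p (Finset.mem_filter.mpr ⟨hp, heq⟩)
        rw [heq]
        exact this
    · rw [Finset.mem_coe, Finset.mem_filter, ordM] at hp hq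
      exact Prod.ext hpq (by omega)

/-- Integrality of a series with the symmetries and Taylor expansions of a Hermitian Jacobi form
of weight `k` and index `m` follows from integrality of its first coefficients. -/
theorem IsV.mem_jIn {R : Subring ℂ} (h6 : (1 / 6 : ℂ) ∈ R) {k : ℤ} {m : ℕ} {φ : PowerSeries LP}
    (h : IsV m φ) (hJ : ∀ t : ℕ, IsJ k (Et t φ * corr (m * (t ^ 2 + t + 1))))
    (hR : ∀ n : ℕ, 12 * (n : ℤ) ≤ k + 3 * m → coeff n φ ∈ lpIn R) : φ ∈ jIn R := by
  obtain ⟨g, hφ, hg⟩ := h.exists_decomposition h6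
  obtain ⟨N, hN⟩ := exists_isMF_Dlt_pow_mul hφ hJ (3 * m + 1)
  have hJR : Jq ^ (8 * N) ∈ coeffIn R := Subring.pow_mem _ (Jq_mem h6) _
  have hJ0 : coeff 0 (Jq ^ (8 * N)) = 1 := by
    have := coeff_zero_Jq
    rw [coeff_zero_eq_constantCoeff_apply] at this ⊢
    rw [map_pow, this, one_pow]
  rw [hφ]
  refine Subring.sum_mem _ fun p hp => Subring.mul_mem _ (iq_mem_jIn ?_) (genM_mem h6 m p)
  have hord : ordM p ≤ 3 * m := by
    rw [mem_idx] at hp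
    rw [ordM]
    omega
  have hXJ : Dlt ^ N * g p = X ^ N * (Jq ^ (8 * N) * g p) := by
    rw [Dlt, mul_pow, ← pow_mul, mul_assoc]
  have hmem : Dlt ^ N * g p ∈ coeffIn R := by
    refine IsMF.coeff_mem R h6 (k + ordM p + 12 * N).toNat.succ _ (by push_cast; omega) _
      (hN p hp (by omega)) fun j hj => ?_
    rw [hXJ, coeff_X_pow_mul']
    split_ifs with hle
    · rw [coeff_mul]
      refine Subring.sum_mem _ fun ij hij => R.mul_mem (hJR _) ?_
      have := Finset.HasAntidiagonal.mem_antidiagonal.mp hij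
      refine hg (j - N) (fun n hn => hR n ?_) p _ (by omega)
      omega
    · exact R.zero_mem
  intro n
  refine coeff_mem_of_unit_mul R hJR hJ0 (n + 1) (fun i _ => ?_) n (by omega)
  have := hmem (i + N)
  rw [hXJ, coeff_X_pow_mul] at this
  exact this

end JacobiIntegrality

section FourierUniqueness

/-- Uniqueness of absolutely convergent Fourier series. -/
lemma eq_zero_of_hasSum_fourier {a : ℤ → ℂ} (ha : Summable a)
    (h : ∀ θ : ℝ, HasSum (fun n => a n * Complex.exp (2 * Real.pi * I * (n * θ))) 0) (m : ℤ) :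
    a m = 0 := by
  have h1 : Summable fun n => a n • (fourier n : C(AddCircle (1 : ℝ), ℂ)) :=
    .of_norm (by simpa [norm_smul, fourier_norm] using ha.norm)
  have h2 : HasSum (fun n => a n • (fourier n : C(AddCircle (1 : ℝ), ℂ))) 0 := by
    convert h1.hasSum
    symm
    ext x
    induction x using QuotientAddGroup.induction_on with
    | _ θ =>
      have h3 := (ContinuousMap.hasSum_apply h1.hasSum (θ : AddCircle (1 : ℝ)))
      refine h3.unique ?_
      convert h θ using 2 with n
      swap
      · rfl
      · simp only [ContinuousMap.smul_apply, smul_eq_mul]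
        congr 1
        rw [fourier_coe_apply]
        congr 1
        push_cast
        ring
  have h3 := h2.mapL (ContinuousMap.toLp (E := ℂ) 2 AddCircle.haarAddCircle ℂ)
  have h4 := h3.mapL (innerSL ℂ (fourierLp (T := 1) 2 m))
  rw [map_zero, map_zero] at h4
  refine (HasSum.unique ?_ h4)
  have he : (fun n => if n = m then a m else 0) = fun n => innerSL ℂ (fourierLp (T := 1) 2 m)
      (ContinuousMap.toLp (E := ℂ) 2 AddCircle.haarAddCircle ℂ (a n • fourier n)) := ?_
  · rw [← he]
    exact hasSum_ite_eq m (a m)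
  funext n
  symm
  rw [map_smul, map_smul]
  change a n • inner ℂ (fourierLp (T := 1) 2 m) (fourierLp 2 n) = _
  have := orthonormal_iff_ite.mp (orthonormal_fourier (T := 1)) m n
  rw [this]
  split_ifs with e1 e2 e2
  · simp [e1]
  · exact (e2 e1.symm).elim
  · exact (e1 e2.symm).elim
  · simp

/-- Extraction of a Fourier coefficient in one variable from an absolutely convergent series. -/
lemma tsum_fiber_eq_zero {ι : Type*} {c : ι × ℤ → ℂ} (hc : Summable c)
    (h : ∀ θ : ℝ, HasSum (fun y : ι × ℤ => c y * Complex.exp (2 * Real.pi * I * (y.2 * θ))) 0)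
    (m : ℤ) : HasSum (fun i => c (i, m)) 0 := by
  have hs : Summable fun y : ℤ × ι => c y.swap := (Equiv.prodComm ℤ ι).summable_iff.mpr hc
  have hf : ∀ m, Summable fun i => c (i, m) := fun m => hs.prod_factor m
  have h0 := eq_zero_of_hasSum_fourier (a := fun m => ∑' i, c (i, m)) hs.prod (fun θ => ?_) m
  · rw [← h0]
    exact (hf m).hasSum
  · have h1 := (Equiv.prodComm ℤ ι).hasSum_iff.mpr (h θ)
    refine h1.prod_fiberwise fun n => ?_
    exact (hf n).hasSum.mul_right _

/-- The additive character of the torus attached to an index. -/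
def char4 (θ : Fin 4 → ℝ) (y : (ℤ × ℤ × ℤ) × ℤ) : ℂ :=
  y.1.1 * θ 0 + y.1.2.1 * θ 1 + y.1.2.2 * θ 2 + y.2 * θ 3

lemma eq_zero_of_hasSum_char4 {c : (ℤ × ℤ × ℤ) × ℤ → ℂ}
    (h : ∀ θ : Fin 4 → ℝ, HasSum (fun y => c y * Complex.exp (2 * Real.pi * I * char4 θ y)) 0)
    (y : (ℤ × ℤ × ℤ) × ℤ) : c y = 0 := by
  have hsum : ∀ θ, Summable fun y => c y * Complex.exp (2 * Real.pi * I * char4 θ y) :=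
    fun θ => (h θ).summable
  have h1 : ∀ (m : ℤ) (θ : Fin 4 → ℝ), HasSum (fun x : ℤ × ℤ × ℤ =>
      c (x, m) * Complex.exp (2 * Real.pi * I * char4 ![θ 0, θ 1, θ 2, 0] (x, m))) 0 := by
    intro m θ
    refine tsum_fiber_eq_zero (hsum _) (fun s => ?_) m
    convert h ![θ 0, θ 1, θ 2, s] using 2 with y
    rw [mul_assoc, ← Complex.exp_add]
    congr 2
    simp [char4]
    ring
  have h2 : ∀ (m b : ℤ) (θ : Fin 4 → ℝ), HasSum (fun x : ℤ × ℤ =>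
      c ((x.1, x.2, b), m) *
        Complex.exp (2 * Real.pi * I * char4 ![θ 0, θ 1, 0, 0] ((x.1, x.2, b), m))) 0 := by
    intro m b θ
    refine tsum_fiber_eq_zero (c := fun x : (ℤ × ℤ) × ℤ => c ((x.1.1, x.1.2, x.2), m) *
      Complex.exp (2 * Real.pi * I * char4 ![θ 0, θ 1, 0, 0] ((x.1.1, x.1.2, x.2), m)))
      (((Equiv.prodAssoc ℤ ℤ ℤ).hasSum_iff.mpr (h1 m ![θ 0, θ 1, 0, 0])).summable)
      (fun s => ?_) b
    convert (Equiv.prodAssoc ℤ ℤ ℤ).hasSum_iff.mpr (h1 m ![θ 0, θ 1, s, 0]) using 2 with y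
    simp only [Function.comp_apply, Equiv.prodAssoc_apply]
    rw [mul_assoc, ← Complex.exp_add]
    congr 2
    simp [char4]
    ring
  have h3 : ∀ (m b a : ℤ) (θ : Fin 4 → ℝ), HasSum (fun n : ℤ =>
      c ((n, a, b), m) *
        Complex.exp (2 * Real.pi * I * char4 ![θ 0, 0, 0, 0] ((n, a, b), m))) 0 := by
    intro m b a θ
    refine tsum_fiber_eq_zero (c := fun x : ℤ × ℤ => c ((x.1, x.2, b), m) *
      Complex.exp (2 * Real.pi * I * char4 ![θ 0, 0, 0, 0] ((x.1, x.2, b), m)))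
      ((h2 m b ![θ 0, 0, 0, 0]).summable) (fun s => ?_) a
    convert h2 m b ![θ 0, s, 0, 0] using 2 with y
    rw [mul_assoc, ← Complex.exp_add]
    congr 2
    simp [char4]
    ring
  obtain ⟨⟨n, a, b⟩, m⟩ := y
  refine eq_zero_of_hasSum_fourier (a := fun n => c ((n, a, b), m)) ?_ (fun s => ?_) n
  · convert (h3 m b a 0).summable using 2 with n
    simp [char4]
  · convert h3 m b a ![s, 0, 0, 0] using 2 with n
    congr 2
    simp [char4]

end FourierUniqueness

section Lattice

/-- `√-3`. -/
abbrev sq3 : ℂ := sqrtD (-3)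

lemma sq3_eq : sq3 = (Real.sqrt 3 : ℂ) * I := by
  simp [sq3, sqrtD]

lemma sq3_sq : sq3 * sq3 = -3 := by
  have h : (Real.sqrt 3 : ℂ) * (Real.sqrt 3 : ℂ) = 3 := by
    rw [← Complex.ofReal_mul, Real.mul_self_sqrt (by norm_num)]
    norm_num
  rw [sq3_eq]
  linear_combination (I * I) * h + 3 * I_mul_I

lemma sq3_ne_zero : sq3 ≠ 0 := fun h => by
  have := sq3_sq
  rw [h] at this
  norm_num at this

lemma conj_sq3 : (starRingEnd ℂ) sq3 = -sq3 := by
  rw [sq3_eq]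
  simp

/-- The primitive cube root of unity `(-1 + √-3) / 2`. -/
def om : ℂ := (-1 + sq3) / 2

lemma om_sq : om * om = -1 - om := by
  rw [om]
  linear_combination (1 / 4) * sq3_sq

lemma conj_om : (starRingEnd ℂ) om = -1 - om := by
  rw [om, map_div₀, map_add, conj_sq3, map_ofNat, map_neg, map_one]
  ring

lemma sq3_eq_om : sq3 = 1 + 2 * om := by rw [om]; ring

lemma ringInt_iff {z : ℂ} : z ∈ ringInt (-3) ↔ ∃ a b : ℤ, z = a + b * om := by
  constructor
  · rintro ⟨a, b, rfl⟩
    refine ⟨a - b, b, ?_⟩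
    rw [om]
    push_cast
    ring
  · rintro ⟨a, b, rfl⟩
    refine ⟨a + b, b, ?_⟩
    rw [om]
    push_cast
    ring

lemma om_im : om.im = Real.sqrt 3 / 2 := by
  rw [om, sq3_eq]
  simp

lemma add_mul_om_inj {a b c d : ℝ} (h : (a : ℂ) + b * om = c + d * om) : a = c ∧ b = d := by
  have h1 := congrArg Complex.im h
  have h2 : Real.sqrt 3 / 2 ≠ 0 := by positivity
  simp only [add_im, ofReal_im, mul_im, ofReal_re, om_im, zero_add, zero_mul, add_zero] at h1
  have hb : b = d := mul_right_cancel₀ h2 h1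
  subst hb
  exact ⟨by exact_mod_cast add_right_cancel h, rfl⟩

/-- The element `(r₁ + r₂ ω) / √-3` of the inverse different. -/
def alp (r : ℤ × ℤ) : ℂ := ((r.1 : ℂ) + r.2 * om) / sq3

lemma sq3_mul_alp (r : ℤ × ℤ) : sq3 * alp r = r.1 + r.2 * om := by
  rw [alp, mul_div_cancel₀ _ sq3_ne_zero]

lemma alp_mem (r : ℤ × ℤ) : alp r ∈ invDiff (-3) :=
  ringInt_iff.mpr ⟨r.1, r.2, sq3_mul_alp r⟩

lemma alp_injective : Function.Injective alp := fun r s h => by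
  have h1 : ((r.1 : ℝ) : ℂ) + (r.2 : ℝ) * om = (s.1 : ℝ) + (s.2 : ℝ) * om := by
    have := congrArg (sq3 * ·) h
    simp only [sq3_mul_alp] at this
    exact_mod_cast this
  have h2 := add_mul_om_inj h1
  exact Prod.ext (by exact_mod_cast h2.1) (by exact_mod_cast h2.2)

lemma conj_alp (r : ℤ × ℤ) :
    (starRingEnd ℂ) (alp r) = -((r.1 : ℂ) + r.2 * (-1 - om)) / sq3 := by
  rw [alp, map_div₀, conj_sq3, map_add, map_mul, conj_om]
  rw [map_intCast, map_intCast, div_neg, neg_div]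

lemma normSq_alp (r : ℤ × ℤ) :
    normSq (alp r) = ((r.1 ^ 2 - r.1 * r.2 + r.2 ^ 2 : ℤ) : ℝ) / 3 := by
  have h : ((normSq (alp r) : ℝ) : ℂ) = (((r.1 ^ 2 - r.1 * r.2 + r.2 ^ 2 : ℤ) : ℝ) / 3 : ℝ) := by
    rw [← Complex.mul_conj, conj_alp, alp, div_mul_div_comm, sq3_sq]
    push_cast
    linear_combination ((r.2 : ℂ) ^ 2 / 3) * (-1) * om_sq
  exact_mod_cast h

/-- The Hermitian matrix with diagonal `n, m` and off-diagonal entry `alp r`. -/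
def Hmat (y : (ℤ × ℤ × ℤ) × ℤ) : Matrix (Fin 2) (Fin 2) ℂ :=
  !![(y.1.1 : ℂ), alp y.1.2; (starRingEnd ℂ) (alp y.1.2), (y.2 : ℂ)]

lemma Hmat_injective : Function.Injective Hmat := by
  rintro ⟨⟨n, r⟩, m⟩ ⟨⟨n', r'⟩, m'⟩ h
  have h00 := congrFun (congrFun h 0) 0
  have h01 := congrFun (congrFun h 0) 1
  have h11 := congrFun (congrFun h 1) 1
  simp [Hmat] at h00 h01 h11
  simp [h00, h11, alp_injective h01]

lemma exists_Hmat {H : Matrix (Fin 2) (Fin 2) ℂ} (h : H ∈ HermLattice (-3)) :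
    ∃ y, Hmat y = H := by
  obtain ⟨⟨h1, h2, h3⟩, -⟩ := h
  obtain ⟨n, hn⟩ := h2 0
  obtain ⟨m, hm⟩ := h2 1
  obtain ⟨a, b, hab⟩ := ringInt_iff.mp (h3 0 1)
  have h01 : H 0 1 = alp (a, b) := by
    rw [alp, eq_div_iff sq3_ne_zero, mul_comm]
    exact hab
  refine ⟨((n, a, b), m), ?_⟩
  ext i j
  fin_cases i <;> fin_cases j
  · exact hn.symm
  · exact h01.symm
  · change (starRingEnd ℂ) (alp (a, b)) = H 1 0
    rw [← h01]
    exact h1.apply 1 0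
  · exact hm.symm

lemma nonneg_of_Hmat {y : (ℤ × ℤ × ℤ) × ℤ} (h : (Hmat y).PosSemidef) :
    0 ≤ y.1.1 ∧ 0 ≤ y.2 ∧
      y.1.2.1 ^ 2 - y.1.2.1 * y.1.2.2 + y.1.2.2 ^ 2 ≤ 3 * y.1.1 * y.2 := by
  have h0 := h.diag_nonneg (i := 0)
  have h1 := h.diag_nonneg (i := 1)
  have h2 := h.det_nonneg
  simp only [Hmat, of_apply, cons_val', cons_val_zero, cons_val_one, cons_val_fin_one] at h0 h1
  rw [Hmat, det_fin_two_of, Complex.mul_conj, normSq_alp] at h2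
  refine ⟨by exact_mod_cast h0, by exact_mod_cast h1, ?_⟩
  have h3 : (0 : ℝ) ≤ (y.1.1 : ℝ) * y.2 -
      ((y.1.2.1 ^ 2 - y.1.2.1 * y.1.2.2 + y.1.2.2 ^ 2 : ℤ) : ℝ) / 3 := by
    exact_mod_cast h2
  have h4 : ((y.1.2.1 ^ 2 - y.1.2.1 * y.1.2.2 + y.1.2.2 ^ 2 : ℤ) : ℝ) ≤
    ((3 * y.1.1 * y.2 : ℤ) : ℝ) := by
    push_cast at h3 ⊢
    linarith
  exact_mod_cast h4

lemma trace_Hmat_mul (y : (ℤ × ℤ × ℤ) × ℤ) (a b c d : ℂ) :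
    (Hmat y * !![a, b; c, d]).trace =
      y.1.1 * a + alp y.1.2 * c + (starRingEnd ℂ) (alp y.1.2) * b + y.2 * d := by
  rw [Hmat, trace_fin_two]
  simp [Matrix.mul_apply, Fin.sum_univ_two]
  ring

end Lattice

section HalfSpace

lemma mem_upperHalfSpace {a b c d : ℂ} (ha : 0 < a.im)
    (h : normSq (b - (starRingEnd ℂ) c) < 4 * (a.im * d.im)) :
    !![a, b; c, d] ∈ HermitianUpperHalfSpace := by
  have hm : ((!![a, b; c, d] - (!![a, b; c, d])ᴴ).map fun w => w / (2 * I)) =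
      !![(a.im : ℂ), (b - (starRingEnd ℂ) c) / (2 * I);
        (starRingEnd ℂ) ((b - (starRingEnd ℂ) c) / (2 * I)), (d.im : ℂ)] := by
    have him : ∀ z : ℂ, (z - (starRingEnd ℂ) z) / (2 * I) = z.im := fun z => by
      rw [Complex.sub_conj]
      field_simp
      push_cast
      ring
    ext i j
    fin_cases i <;> fin_cases j <;> simp [him]
    rw [map_ofNat, div_neg, ← neg_div, neg_sub]
  rw [HermitianUpperHalfSpace, Set.mem_ofPred_eq, hm]
  set w := (b - (starRingEnd ℂ) c) / (2 * I) with hw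
  have hn : normSq w < a.im * d.im := by
    rw [hw, normSq_div, div_lt_iff₀ (by simp)]
    simp
    linarith
  refine Matrix.PosDef.of_dotProduct_mulVec_pos ?_ fun x hx => ?_
  · ext i j
    fin_cases i <;> fin_cases j <;> simp
  · have hre : star x ⬝ᵥ (!![(a.im : ℂ), w; (starRingEnd ℂ) w, (d.im : ℂ)] *ᵥ x) =
        (((normSq (a.im * x 0 + w * x 1) + (a.im * d.im - normSq w) * normSq (x 1)) / a.im : ℝ)
          : ℂ) := by
      have : (a.im : ℂ) ≠ 0 := by exact_mod_cast ha.ne'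
      simp only [dotProduct, mulVec, Fin.sum_univ_two]
      push_cast
      rw [eq_div_iff this]
      simp only [← Complex.mul_conj]
      simp
      ring
    rw [hre]
    have hpos : 0 < (normSq (a.im * x 0 + w * x 1) + (a.im * d.im - normSq w) * normSq (x 1))
        / a.im := by
      refine div_pos ?_ ha
      by_cases h1 : x 1 = 0
      · have h0 : x 0 ≠ 0 := fun h0 => hx (by ext i; fin_cases i <;> simp [h0, h1])
        rw [h1]
        simp only [mul_zero, add_zero, map_zero]
        rw [normSq_pos]
        exact mul_ne_zero (by exact_mod_cast ha.ne') h0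
      · have := normSq_pos.mpr h1
        have := mul_pos (sub_pos.mpr hn) this
        have := normSq_nonneg (a.im * x 0 + w * x 1)
        linarith
    exact_mod_cast hpos

lemma conj_mul_mem {Z U : Matrix (Fin 2) (Fin 2) ℂ} (hZ : Z ∈ HermitianUpperHalfSpace)
    (hU : IsUnit U) : U * Z * Uᴴ ∈ HermitianUpperHalfSpace := by
  have h : ((U * Z * Uᴴ - (U * Z * Uᴴ)ᴴ).map fun w => w / (2 * I))
      = U * ((Z - Zᴴ).map fun w => w / (2 * I)) * Uᴴ := by
    have e : ∀ A : Matrix (Fin 2) (Fin 2) ℂ, (A.map fun w => w / (2 * I)) = (1 / (2 * I)) • A :=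
      fun A => by ext; simp [div_eq_inv_mul]
    rw [e, e, conjTranspose_mul, conjTranspose_mul, conjTranspose_conjTranspose, Matrix.mul_smul,
      Matrix.smul_mul, Matrix.mul_sub, Matrix.sub_mul, Matrix.mul_assoc, Matrix.mul_assoc]
  rw [HermitianUpperHalfSpace, Set.mem_ofPred_eq, h]
  exact Matrix.PosDef.mul_mul_conjTranspose_same hZ (Matrix.vecMul_injective_of_isUnit hU)

lemma transpose_mem {Z : Matrix (Fin 2) (Fin 2) ℂ} (hZ : Z ∈ HermitianUpperHalfSpace) :
    Zᵀ ∈ HermitianUpperHalfSpace := by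
  have h : ((Zᵀ - Zᵀᴴ).map fun w => w / (2 * I)) = ((Z - Zᴴ).map fun w => w / (2 * I))ᵀ := by
    ext
    simp
  rw [HermitianUpperHalfSpace, Set.mem_ofPred_eq, h]
  exact Matrix.PosDef.transpose hZ

end HalfSpace

section Symmetries

variable {k : ℤ} (f : HermitianModularForm (-3) k)

/-- Fourier coefficients of a Hermitian modular form, indexed by integer coordinates. -/
def fc (y : (ℤ × ℤ × ℤ) × ℤ) : ℂ := f.coeff (Hmat y)

lemma hasSum_expansion {Z : Matrix (Fin 2) (Fin 2) ℂ} (hZ : Z ∈ HermitianUpperHalfSpace) :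
    HasSum (fun y => fc f y * Complex.exp (2 * Real.pi * I * (Hmat y * Z).trace)) (f.toFun Z) := by
  have h := f.expansion Z hZ
  have h1 : HasSum (fun H : Matrix (Fin 2) (Fin 2) ℂ =>
      f.coeff H * Complex.exp (2 * Real.pi * I * (H * Z).trace)) (f.toFun Z) := by
    refine (hasSum_subtype_iff_of_support_subset (s := HermLattice (-3)) fun H hH => ?_).mp h
    exact f.coeff_supported H (left_ne_zero_of_mul hH)
  refine (Hmat_injective.hasSum_iff fun H hH => ?_).mpr h1
  by_contra hne
  exact hH (exists_Hmat (f.coeff_supported H (left_ne_zero_of_mul hne)))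

/-- Matrices with imaginary part the identity, in Fourier coordinates. -/
def torusPoint (θ : Fin 4 → ℝ) : Matrix (Fin 2) (Fin 2) ℂ :=
  !![θ 0 + I, (starRingEnd ℂ) (θ 2 + θ 1 * (1 + om)); θ 2 + θ 1 * (1 + om), θ 3 + I]

lemma torusPoint_mem (θ : Fin 4 → ℝ) : torusPoint θ ∈ HermitianUpperHalfSpace :=
  mem_upperHalfSpace (by simp) (by simp)

lemma alp_mul_add_conj (r : ℤ × ℤ) (a b z : ℂ) :
    alp r * ((a + b * (1 + om)) * z) +
      (starRingEnd ℂ) (alp r) * ((a + b * (1 + (-1 - om))) * z) = (r.1 * b + r.2 * a) * z := by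
  have h := sq3_ne_zero
  rw [conj_alp, alp, div_mul_eq_mul_div, div_mul_eq_mul_div, ← add_div, div_eq_iff h, sq3_eq_om]
  ring

lemma trace_Hmat_mul_torusPoint (y : (ℤ × ℤ × ℤ) × ℤ) (θ : Fin 4 → ℝ) :
    (Hmat y * torusPoint θ).trace = char4 θ y + (y.1.1 + y.2) * I := by
  have h := alp_mul_add_conj y.1.2 (θ 2) (θ 1) 1
  simp only [mul_one] at h
  rw [torusPoint, trace_Hmat_mul, char4, map_add, map_mul, map_add, map_one, conj_om, conj_ofReal,
    conj_ofReal]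
  linear_combination h

lemma fc_eq_of_trace_eq {T : Matrix (Fin 2) (Fin 2) ℂ → Matrix (Fin 2) (Fin 2) ℂ}
    (hT : ∀ Z ∈ HermitianUpperHalfSpace, T Z ∈ HermitianUpperHalfSpace)
    (hf : ∀ Z ∈ HermitianUpperHalfSpace, f.toFun (T Z) = f.toFun Z)
    (σ : Equiv.Perm ((ℤ × ℤ × ℤ) × ℤ))
    (hσ : ∀ y Z, (Hmat y * T Z).trace = (Hmat (σ y) * Z).trace) (y : (ℤ × ℤ × ℤ) × ℤ) :
    fc f (σ y) = fc f y := by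
  have h := eq_zero_of_hasSum_char4 (c := fun y => (fc f y - fc f (σ.symm y)) *
    Complex.exp (2 * Real.pi * I * ((y.1.1 + y.2) * I))) (fun θ => ?_) (σ y)
  · have h1 := (mul_eq_zero.mp h).resolve_right (Complex.exp_ne_zero _)
    rw [σ.symm_apply_apply] at h1
    exact sub_eq_zero.mp h1
  · have hZ := torusPoint_mem θ
    have h1 := hasSum_expansion f hZ
    have h2 := hasSum_expansion f (hT _ hZ)
    rw [hf _ hZ] at h2
    rw [← σ.symm.hasSum_iff] at h2
    have h3 := h1.sub h2
    rw [sub_self] at h3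
    refine h3.congr_fun ?_
    intro y
    simp only [Function.comp_apply, hσ, σ.apply_symm_apply]
    rw [trace_Hmat_mul_torusPoint, mul_add, Complex.exp_add]
    ring

lemma mem_modularGroup {U V : Matrix (Fin 2) (Fin 2) ℂ} (hU : ∀ i j, U i j ∈ ringInt (-3))
    (hV : ∀ i j, V i j ∈ ringInt (-3)) (hUV : V * Uᴴ = 1) :
    fromBlocks U 0 0 V ∈ HermitianModularGroup (-3) := by
  have h0 : (0 : ℂ) ∈ ringInt (-3) := ringInt_iff.mpr ⟨0, 0, by simp⟩
  have h1 : Uᴴ * V = 1 := mul_eq_one_comm.mp hUV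
  have h2 : Vᴴ * U = 1 := by
    have := congrArg conjTranspose h1
    rwa [conjTranspose_mul, conjTranspose_conjTranspose, conjTranspose_one] at this
  refine ⟨?_, ?_⟩
  · rintro (i | i) (j | j)
    · exact hU i j
    · exact h0
    · exact h0
    · exact hV i j
  · rw [J2, fromBlocks_conjTranspose, fromBlocks_multiply, fromBlocks_multiply]
    simp [h1, h2]

lemma toFun_conj (hk : Even k) {U V : Matrix (Fin 2) (Fin 2) ℂ}
    (hU : ∀ i j, U i j ∈ ringInt (-3)) (hV : ∀ i j, V i j ∈ ringInt (-3)) (hUV : V * Uᴴ = 1)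
    (hdet : (U.det * V.det * V.det) ^ 2 = 1) {Z : Matrix (Fin 2) (Fin 2) ℂ}
    (hZ : Z ∈ HermitianUpperHalfSpace) : f.toFun (U * Z * Uᴴ) = f.toFun Z := by
  have h := f.transform _ (mem_modularGroup hU hV hUV) Z hZ
  have hd : nuChar (-3) k (fromBlocks U 0 0 V) * V.det ^ k = 1 := by
    obtain ⟨j, rfl⟩ := hk
    rw [nuChar, if_neg (by norm_num), det_fromBlocks_zero₂₁, ← mul_zpow, ← two_mul, _root_.zpow_mul,
      zpow_ofNat, hdet, _root_.one_zpow]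
  simp only [matAct, toBlocks_fromBlocks₁₁, toBlocks_fromBlocks₁₂, toBlocks_fromBlocks₂₁,
    toBlocks_fromBlocks₂₂, Matrix.zero_mul, zero_add, add_zero] at h
  rwa [hd, one_mul, Matrix.inv_eq_left_inv (mul_eq_one_comm.mp hUV)] at h

lemma fc_eq_of_conj (hk : Even k) {U V : Matrix (Fin 2) (Fin 2) ℂ}
    (hU : ∀ i j, U i j ∈ ringInt (-3)) (hV : ∀ i j, V i j ∈ ringInt (-3)) (hUV : V * Uᴴ = 1)
    (hdet : (U.det * V.det * V.det) ^ 2 = 1) (σ : Equiv.Perm ((ℤ × ℤ × ℤ) × ℤ))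
    (hσ : ∀ y, Uᴴ * Hmat y * U = Hmat (σ y)) (y : (ℤ × ℤ × ℤ) × ℤ) :
    fc f (σ y) = fc f y := by
  have hu : IsUnit U := by
    have := congrArg conjTranspose hUV
    rw [conjTranspose_mul, conjTranspose_conjTranspose, conjTranspose_one] at this
    exact IsUnit.of_mul_eq_one _ this
  refine fc_eq_of_trace_eq f (T := fun Z => U * Z * Uᴴ) (fun Z hZ => conj_mul_mem hZ hu)
    (fun Z hZ => toFun_conj f hk hU hV hUV hdet hZ) σ (fun y Z => ?_) y
  rw [← hσ, ← Matrix.mul_assoc, Matrix.trace_mul_comm, Matrix.mul_assoc Uᴴ, Matrix.mul_assoc Uᴴ]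
  simp only [Matrix.mul_assoc]

lemma om_mem : om ∈ ringInt (-3) := ringInt_iff.mpr ⟨0, 1, by simp⟩

lemma zero_mem_ringInt : (0 : ℂ) ∈ ringInt (-3) := ringInt_iff.mpr ⟨0, 0, by simp⟩

lemma one_mem_ringInt : (1 : ℂ) ∈ ringInt (-3) := ringInt_iff.mpr ⟨1, 0, by simp⟩

lemma mem_of_entries {S : Set ℂ} {a b c d : ℂ} (ha : a ∈ S) (hb : b ∈ S) (hc : c ∈ S)
    (hd : d ∈ S) (i j : Fin 2) : !![a, b; c, d] i j ∈ S := by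
  fin_cases i <;> fin_cases j <;> assumption

lemma conjTranspose_two (a b c d : ℂ) : (!![a, b; c, d])ᴴ =
    !![(starRingEnd ℂ) a, (starRingEnd ℂ) c; (starRingEnd ℂ) b, (starRingEnd ℂ) d] := by
  ext i j
  fin_cases i <;> fin_cases j <;> rfl

lemma matrix_two_congr {a b c d a' b' c' d' : ℂ} (ha : a = a') (hb : b = b') (hc : c = c')
    (hd : d = d') : !![a, b; c, d] = !![a', b'; c', d'] := by
  rw [ha, hb, hc, hd]

lemma alp_mul_om (r : ℤ × ℤ) : alp r * om = alp (rot r) := by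
  rw [alp, alp, div_mul_eq_mul_div]
  congr 1
  simp only [rot, AddEquiv.coe_mk, Equiv.coe_fn_mk]
  push_cast
  linear_combination r.2 * om_sq

lemma alp_neg (r : ℤ × ℤ) : alp (-r) = -alp r := by
  rw [alp, alp, ← neg_div]
  congr 1
  simp only [Prod.fst_neg, Prod.snd_neg]
  push_cast
  ring

lemma conj_alp_eq (r : ℤ × ℤ) : (starRingEnd ℂ) (alp r) = alp (-mir r) := by
  rw [conj_alp, alp]
  congr 1
  simp only [mir, AddEquiv.coe_mk, Equiv.coe_fn_mk, Prod.fst_neg, Prod.snd_neg]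
  push_cast
  ring

lemma om_mul_conj_om : om * (starRingEnd ℂ) om = 1 := by
  rw [conj_om]
  linear_combination -om_sq

lemma fc_rot (hk : Even k) (x : ℤ × ℤ × ℤ) (m : ℤ) : fc f (extq rot x, m) = fc f (x, m) := by
  refine fc_eq_of_conj f hk (U := !![1, 0; 0, om]) (V := !![1, 0; 0, om])
    (mem_of_entries one_mem_ringInt zero_mem_ringInt zero_mem_ringInt om_mem)
    (mem_of_entries one_mem_ringInt zero_mem_ringInt zero_mem_ringInt om_mem) ?_ ?_
    ((extq rot).toEquiv.prodCongr (Equiv.refl ℤ)) (fun y => ?_) (x, m)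
  · rw [conjTranspose_two, mul_fin_two, one_fin_two]
    simp [om_mul_conj_om]
  · rw [det_fin_two_of]
    have h : om * om * om = 1 := by linear_combination (om - 1) * om_sq
    linear_combination (om * om * om + 1) * h
  · rw [conjTranspose_two, Hmat, Hmat, mul_fin_two, mul_fin_two]
    refine matrix_two_congr ?_ ?_ ?_ ?_
    · simp [extq_apply]
    · simp [extq_apply, alp_mul_om]
    · simp [extq_apply, ← alp_mul_om, mul_comm]
    · simp
      linear_combination (y.2 : ℂ) * om_mul_conj_om

lemma fc_neg (hk : Even k) (n : ℤ) (r : ℤ × ℤ) (m : ℤ) :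
    fc f ((n, -r), m) = fc f ((n, r), m) := by
  have hm : (-1 : ℂ) ∈ ringInt (-3) := ringInt_iff.mpr ⟨-1, 0, by simp⟩
  refine fc_eq_of_conj f hk (U := !![1, 0; 0, -1]) (V := !![1, 0; 0, -1])
    (mem_of_entries one_mem_ringInt zero_mem_ringInt zero_mem_ringInt hm)
    (mem_of_entries one_mem_ringInt zero_mem_ringInt zero_mem_ringInt hm) ?_ ?_
    ((extq (AddEquiv.neg _)).toEquiv.prodCongr (Equiv.refl ℤ)) (fun y => ?_) ((n, r), m)
  · rw [conjTranspose_two, mul_fin_two, one_fin_two]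
    simp
  · rw [det_fin_two_of]
    norm_num
  · rw [conjTranspose_two, Hmat, Hmat, mul_fin_two, mul_fin_two]
    refine matrix_two_congr ?_ ?_ ?_ ?_ <;> simp [extq_apply, alp_neg]

lemma fc_transpose (hs : IsSymmetricHMF f) (n : ℤ) (r : ℤ × ℤ) (m : ℤ) :
    fc f ((n, -mir r), m) = fc f ((n, r), m) := by
  refine fc_eq_of_trace_eq f (T := transpose) (fun Z hZ => transpose_mem hZ) (fun Z hZ => hs Z hZ)
    ((extq (mir.trans (AddEquiv.neg _))).toEquiv.prodCongr (Equiv.refl ℤ)) (fun y Z => ?_)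
    ((n, r), m)
  rw [← trace_transpose, transpose_mul, transpose_transpose, trace_mul_comm]
  congr 2
  ext i j
  fin_cases i <;> fin_cases j <;> simp [Hmat, extq_apply, ← conj_alp_eq]

lemma fc_mir (hk : Even k) (hs : IsSymmetricHMF f) (x : ℤ × ℤ × ℤ) (m : ℤ) :
    fc f (extq mir x, m) = fc f (x, m) := by
  rw [extq_apply, ← fc_neg f hk, fc_transpose f hs]

/-- The action of `!![1, 0; ω, 1]` on indices. -/
def ellPerm : Equiv.Perm ((ℤ × ℤ × ℤ) × ℤ) where
  toFun y := (ellL y.1 + y.2 • (1, 1, -1), y.2)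
  invFun y := (ellL.symm (y.1 - y.2 • (1, 1, -1)), y.2)
  left_inv y := by simp
  right_inv y := by simp

lemma fc_ell (hk : Even k) (x : ℤ × ℤ × ℤ) (m : ℤ) :
    fc f (ellL x + m • (1, 1, -1), m) = fc f (x, m) := by
  refine fc_eq_of_conj f hk (U := !![1, 0; om, 1]) (V := !![1, 1 + om; 0, 1])
    (mem_of_entries one_mem_ringInt zero_mem_ringInt om_mem one_mem_ringInt)
    (mem_of_entries one_mem_ringInt (ringInt_iff.mpr ⟨1, 1, by simp⟩) zero_mem_ringInt
      one_mem_ringInt) ?_ ?_ ellPerm (fun y => ?_) (x, m)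
  · rw [conjTranspose_two, mul_fin_two, one_fin_two, conj_om]
    simp
  · rw [det_fin_two_of, det_fin_two_of]
    simp
  · have h := sq3_ne_zero
    have h1 : alp y.1.2 + (-1 - om) * y.2 = alp (ellPerm y).1.2 := by
      rw [alp, alp, eq_div_iff h, add_mul, div_mul_cancel₀ _ h, sq3_eq_om]
      simp [ellPerm, ellL]
      linear_combination (-2 * y.2 : ℂ) * om_sq
    have h2 := alp_mul_add_conj y.1.2 (-1) 1 1
    rw [conjTranspose_two, Hmat, Hmat, mul_fin_two, mul_fin_two]
    refine matrix_two_congr ?_ ?_ ?_ ?_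
    · simp only [map_one, conj_om]
      simp [ellPerm, ellL]
      linear_combination h2 - y.2 * om_sq
    · rw [← h1]
      simp [conj_om]
    · rw [← h1]
      simp [conj_om]
      ring
    · simp [ellPerm]

/-- Exchange of the diagonal entries on indices. -/
def swapPerm : Equiv.Perm ((ℤ × ℤ × ℤ) × ℤ) where
  toFun y := ((y.2, -mir y.1.2), y.1.1)
  invFun y := ((y.2, -mir y.1.2), y.1.1)
  left_inv y := by
    ext <;> simp [mir]
  right_inv y := by
    ext <;> simp [mir]

lemma fc_swap (hk : Even k) (n : ℤ) (r : ℤ × ℤ) (m : ℤ) :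
    fc f ((m, -mir r), n) = fc f ((n, r), m) := by
  refine fc_eq_of_conj f hk (U := !![0, 1; 1, 0]) (V := !![0, 1; 1, 0])
    (mem_of_entries zero_mem_ringInt one_mem_ringInt one_mem_ringInt zero_mem_ringInt)
    (mem_of_entries zero_mem_ringInt one_mem_ringInt one_mem_ringInt zero_mem_ringInt) ?_ ?_
    swapPerm (fun y => ?_) ((n, r), m)
  · rw [conjTranspose_two, mul_fin_two, one_fin_two]
    simp
  · rw [det_fin_two_of]
    norm_num
  · rw [conjTranspose_two, Hmat, Hmat, mul_fin_two, mul_fin_two]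
    refine matrix_two_congr ?_ ?_ ?_ ?_ <;> simp [swapPerm, ← conj_alp_eq]

end Symmetries

section Inversion

open UpperHalfPlane hiding I

variable {k : ℤ} (f : HermitianModularForm (-3) k)

/-- The matrix unit projecting onto the first coordinate. -/
def projOne : Matrix (Fin 2) (Fin 2) ℂ := !![1, 0; 0, 0]

lemma projOne_mul_self : projOne * projOne = projOne := by
  rw [projOne, mul_fin_two]
  simp

/-- Inversion in the first variable. -/
def invMat : Matrix (Fin 2 ⊕ Fin 2) (Fin 2 ⊕ Fin 2) ℂ :=
  fromBlocks (1 - projOne) (-projOne) projOne (1 - projOne)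

lemma invMat_mem : invMat ∈ HermitianModularGroup (-3) := by
  have h0 := zero_mem_ringInt
  have h1 := one_mem_ringInt
  have hm : (-1 : ℂ) ∈ ringInt (-3) := ringInt_iff.mpr ⟨-1, 0, by simp⟩
  have e : (projOne)ᴴ = projOne := by
    rw [projOne, conjTranspose_two]
    simp
  refine ⟨?_, ?_⟩
  · rintro (i | i) (j | j) <;> fin_cases i <;> fin_cases j <;> simpa [invMat, projOne]
  · rw [invMat, J2, fromBlocks_conjTranspose, fromBlocks_multiply, fromBlocks_multiply]
    simp only [conjTranspose_sub, conjTranspose_neg, conjTranspose_one, e]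
    simp [mul_sub, sub_mul, projOne_mul_self, neg_add_eq_sub]

lemma det_invMat : invMat.det = 1 := by
  have h : invMat = fromBlocks 1 (-projOne) 0 1 * fromBlocks 1 0 projOne 1 *
      fromBlocks 1 (-projOne) 0 1 := by
    rw [invMat, fromBlocks_multiply, fromBlocks_multiply]
    simp [sub_mul, projOne_mul_self, ← sub_eq_add_neg, neg_add_eq_sub]
  rw [h, det_mul, det_mul, det_fromBlocks_zero₂₁, det_fromBlocks_zero₁₂]
  simp

lemma toFun_inversion {a b c d : ℂ} (ha : a ≠ 0) (h : !![a, b; c, d] ∈ HermitianUpperHalfSpace) :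
    f.toFun !![-1 / a, b / a; c / a, d - b * c / a] = a ^ k * f.toFun !![a, b; c, d] := by
  have h1 := f.transform _ invMat_mem _ h
  have hc : projOne * !![a, b; c, d] + (1 - projOne) = !![a, b; 0, 1] := by
    rw [projOne, one_fin_two, mul_fin_two]
    ext i j
    fin_cases i <;> fin_cases j <;> simp
  have hn : (1 - projOne) * !![a, b; c, d] + -projOne = !![-1, 0; c, d] := by
    rw [projOne, one_fin_two]
    ext i j
    fin_cases i <;> fin_cases j <;> simp
  have hi : (!![a, b; 0, 1])⁻¹ = !![1 / a, -b / a; 0, 1] := by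
    refine Matrix.inv_eq_right_inv ?_
    rw [mul_fin_two, one_fin_two]
    refine matrix_two_congr ?_ ?_ ?_ ?_ <;> field_simp <;> ring
  simp only [matAct, invMat, toBlocks_fromBlocks₁₁, toBlocks_fromBlocks₁₂, toBlocks_fromBlocks₂₁,
    toBlocks_fromBlocks₂₂] at h1
  rw [hc, hn, hi, nuChar, if_neg (by norm_num), ← invMat, det_invMat, _root_.one_zpow, one_mul,
    det_fin_two_of, mul_one, mul_zero, sub_zero, mul_fin_two] at h1
  rw [← h1]
  congr 1
  refine matrix_two_congr ?_ ?_ ?_ ?_ <;> ring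

/-- The exponential attached to an index in the Fourier-Jacobi expansion. -/
def jexp (t τ u : ℂ) (x : ℤ × ℤ × ℤ) : ℂ :=
  Complex.exp (2 * Real.pi * I * (x.1 * τ) + (x.2.1 + t * x.2.2) * u)

/-- A point of the half-space restricted to the direction `t`. -/
def jpoint (t : ℕ) (τ u d : ℂ) : Matrix (Fin 2) (Fin 2) ℂ :=
  !![τ, (t + 1 * (1 + (-1 - om))) * (u / (2 * Real.pi * I));
    (t + 1 * (1 + om)) * (u / (2 * Real.pi * I)), d]

lemma exp_trace_jpoint (t : ℕ) (τ u d : ℂ) (y : (ℤ × ℤ × ℤ) × ℤ) :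
    Complex.exp (2 * Real.pi * I * (Hmat y * jpoint t τ u d).trace) =
      jexp t τ u y.1 * Complex.exp (2 * Real.pi * I * (y.2 * d)) := by
  rw [jpoint, trace_Hmat_mul, jexp, ← Complex.exp_add]
  congr 1
  have h := alp_mul_add_conj y.1.2 t 1 (u / (2 * Real.pi * I))
  have h2 : (2 * Real.pi * I : ℂ) * (u / (2 * Real.pi * I)) = u :=
    mul_div_cancel₀ _ Complex.two_pi_I_ne_zero
  linear_combination (2 * Real.pi * I : ℂ) * h + (y.1.2.1 * 1 + y.1.2.2 * (t : ℂ)) * h2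

lemma exists_jpoint_mem (t : ℕ) (τ τ' : ℍ) (u u' w : ℂ) : ∃ Y : ℝ, ∀ θ : ℝ,
    jpoint t τ u (θ + Y * I) ∈ HermitianUpperHalfSpace ∧
      jpoint t τ' u' (θ + Y * I - w) ∈ HermitianUpperHalfSpace := by
  have key : ∀ (τ : ℍ) (u w : ℂ), ∃ Y₀ : ℝ, ∀ Y ≥ Y₀, ∀ θ : ℝ,
      jpoint t τ u (θ + Y * I - w) ∈ HermitianUpperHalfSpace := by
    intro τ u w
    set A := normSq ((t + 1 * (1 + (-1 - om))) * (u / (2 * Real.pi * I)) -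
      (starRingEnd ℂ) ((t + 1 * (1 + om)) * (u / (2 * Real.pi * I)))) with hA
    refine ⟨A / (4 * τ.im) + w.im + 1, fun Y hY θ => mem_upperHalfSpace τ.im_pos ?_⟩
    rw [← hA]
    have h1 : A / (4 * τ.im) < Y - w.im := by linarith
    rw [div_lt_iff₀ (mul_pos four_pos τ.im_pos)] at h1
    have h2 : ((θ : ℂ) + Y * I - w).im = Y - w.im := by simp
    rw [h2, UpperHalfPlane.coe_im]
    linarith
  obtain ⟨Y₁, h1⟩ := key τ u 0
  obtain ⟨Y₂, h2⟩ := key τ' u' w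
  refine ⟨max Y₁ Y₂, fun θ => ⟨?_, h2 _ (le_max_right _ _) θ⟩⟩
  simpa using h1 _ (le_max_left Y₁ Y₂) θ

lemma hasSum_jpoint {t : ℕ} {τ u d : ℂ} (h : jpoint t τ u d ∈ HermitianUpperHalfSpace) :
    HasSum (fun y : (ℤ × ℤ × ℤ) × ℤ =>
      fc f y * (jexp t τ u y.1 * Complex.exp (2 * Real.pi * I * (y.2 * d))))
      (f.toFun (jpoint t τ u d)) := by
  simpa only [exp_trace_jpoint] using hasSum_expansion f h

lemma summable_jexp (t : ℕ) (τ : ℍ) (u : ℂ) (m : ℤ) :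
    Summable fun x => fc f (x, m) * jexp t τ u x := by
  obtain ⟨Y, hY⟩ := exists_jpoint_mem t τ τ u u 0
  have h := (hasSum_jpoint f (hY 0).1).summable
  have h1 : Summable fun x : ℤ × ℤ × ℤ => fc f (x, m) *
      (jexp t τ u x * Complex.exp (2 * Real.pi * I * (m * ((0 : ℝ) + Y * I)))) :=
    (((Equiv.prodComm _ _).summable_iff.mpr h).prod_factor m)
  simp only [← mul_assoc] at h1
  exact (summable_mul_right_iff (Complex.exp_ne_zero _)).mp h1

lemma tsum_jexp_inversion (t : ℕ) (τ τ' : ℍ) (u : ℂ) (hτ : (τ' : ℂ) * τ = -1) (m : ℤ) :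
    ∑' x, fc f (x, m) * jexp t τ' (u / τ) x =
      (τ : ℂ) ^ k * Complex.exp (m * (t ^ 2 + t + 1) * u ^ 2 / (2 * Real.pi * I * τ)) *
        ∑' x, fc f (x, m) * jexp t τ u x := by
  have h0 : (τ : ℂ) ≠ 0 := UpperHalfPlane.ne_zero τ
  have hpi := Complex.two_pi_I_ne_zero
  set w : ℂ := (t ^ 2 + t + 1) * (u / (2 * Real.pi * I)) ^ 2 / τ with hw
  obtain ⟨Y, hY⟩ := exists_jpoint_mem t τ τ' u (u / τ) w
  have hf : ∀ θ : ℝ, f.toFun (jpoint t τ' (u / τ) (θ + Y * I - w)) =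
      (τ : ℂ) ^ k * f.toFun (jpoint t τ u (θ + Y * I)) := fun θ => by
    rw [jpoint, jpoint, ← toFun_inversion f h0 (hY θ).1]
    congr 1
    refine matrix_two_congr ?_ ?_ ?_ ?_
    · rw [eq_div_iff h0, hτ]
    · ring
    · ring
    · rw [hw]
      linear_combination (-((u / (2 * Real.pi * I)) ^ 2 / τ)) * om_sq
  set E : ℤ → ℂ := fun m => Complex.exp (2 * Real.pi * I * (m * (Y * I))) with hE
  have hx : ∀ (m : ℤ) (θ : ℝ), Complex.exp (2 * Real.pi * I * (m * (θ + Y * I))) =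
      E m * Complex.exp (2 * Real.pi * I * (m * θ)) := fun m θ => by
    rw [hE, ← Complex.exp_add]
    ring_nf
  have hx' : ∀ (m : ℤ) (θ : ℝ), Complex.exp (2 * Real.pi * I * (m * (θ + Y * I - w))) =
      E m * Complex.exp (-(2 * Real.pi * I * (m * w))) *
        Complex.exp (2 * Real.pi * I * (m * θ)) := fun m θ => by
    rw [hE, ← Complex.exp_add, ← Complex.exp_add]
    ring_nf
  have hd : ∀ θ : ℝ, HasSum (fun y : (ℤ × ℤ × ℤ) × ℤ =>
      (fc f y * jexp t τ' (u / τ) y.1 * (E y.2 * Complex.exp (-(2 * Real.pi * I * (y.2 * w)))) -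
        (τ : ℂ) ^ k * (fc f y * jexp t τ u y.1 * E y.2)) *
          Complex.exp (2 * Real.pi * I * (y.2 * θ))) 0 := fun θ => by
    have h1 := hasSum_jpoint f (hY θ).1
    have h2 := hasSum_jpoint f (hY θ).2
    rw [hf] at h2
    have h3 := h2.sub (h1.mul_left ((τ : ℂ) ^ k))
    rw [sub_self] at h3
    refine h3.congr_fun fun y => ?_
    rw [hx, hx']
    ring
  have hc : Summable fun y : (ℤ × ℤ × ℤ) × ℤ =>
      (fc f y * jexp t τ' (u / τ) y.1 * (E y.2 * Complex.exp (-(2 * Real.pi * I * (y.2 * w)))) -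
        (τ : ℂ) ^ k * (fc f y * jexp t τ u y.1 * E y.2)) := by
    simpa using (hd 0).summable
  have h4 := tsum_fiber_eq_zero hc hd m
  have h5 := ((summable_jexp f t τ' (u / τ) m).hasSum.mul_right
    (E m * Complex.exp (-(2 * Real.pi * I * (m * w))))).sub
    (((summable_jexp f t τ u m).hasSum.mul_right (E m)).mul_left ((τ : ℂ) ^ k))
  have h6 := h5.unique h4
  have hEm : E m ≠ 0 := Complex.exp_ne_zero _
  have hexp : Complex.exp (m * (t ^ 2 + t + 1) * u ^ 2 / (2 * Real.pi * I * τ)) =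
      Complex.exp (2 * Real.pi * I * (m * w)) := by
    congr 1
    rw [hw]
    field_simp
  rw [hexp]
  have h7 : Complex.exp (2 * Real.pi * I * (m * w)) *
      Complex.exp (-(2 * Real.pi * I * (m * w))) = 1 := by
    rw [← Complex.exp_add, add_neg_cancel, Complex.exp_zero]
  refine mul_right_cancel₀ hEm ?_
  linear_combination Complex.exp (2 * Real.pi * I * (m * w)) * h6 -
    (E m * ∑' x, fc f (x, m) * jexp t τ' (u / τ) x) * h7

end Inversion

section FourierJacobi

open PowerSeries
open UpperHalfPlane hiding I

variable {k : ℤ} (f : HermitianModularForm (-3) k)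

lemma nonneg_of_fc_ne_zero {y : (ℤ × ℤ × ℤ) × ℤ} (h : fc f y ≠ 0) :
    0 ≤ y.1.1 ∧ 0 ≤ y.2 ∧
      y.1.2.1 ^ 2 - y.1.2.1 * y.1.2.2 + y.1.2.2 ^ 2 ≤ 3 * y.1.1 * y.2 :=
  nonneg_of_Hmat (f.coeff_supported _ h).2

/-- Indices in the support of the Fourier-Jacobi coefficient of index `m`. -/
abbrev Cone (m : ℕ) : Type :=
  {x : ℕ × ℤ × ℤ // x.2.1 ^ 2 - x.2.1 * x.2.2 + x.2.2 ^ 2 ≤ 3 * (x.1 : ℤ) * m}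

lemma finite_cone (m n : ℕ) : {i : Cone m | i.1.1 = n}.Finite := by
  set B : ℤ := 6 * n * m with hB
  have hfin : ({n} ×ˢ (Set.Icc (-B) B ×ˢ Set.Icc (-B) B) : Set (ℕ × ℤ × ℤ)).Finite :=
    (Set.finite_singleton n).prod ((Set.finite_Icc _ _).prod (Set.finite_Icc _ _))
  refine Set.Finite.of_finite_image (f := fun i : Cone m => i.1) (hfin.subset ?_)
    Subtype.val_injective.injOn
  rintro _ ⟨⟨⟨n', a, b⟩, h⟩, rfl : n' = n, rfl⟩
  simp only at h
  have hab : a ^ 2 + b ^ 2 ≤ B := by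
    rw [hB]
    nlinarith [sq_nonneg (a - b)]
  have key : ∀ c : ℤ, c ^ 2 ≤ B → c ∈ Set.Icc (-B) B := fun c hc => by
    have := Int.le_self_sq c
    have := Int.le_self_sq (-c)
    rw [neg_sq] at this
    exact ⟨by linarith, by linarith⟩
  exact ⟨rfl, key a (by nlinarith [sq_nonneg b]), key b (by nlinarith [sq_nonneg a])⟩

/-- The integer coordinates of an element of the cone. -/
def Cone.idx {m : ℕ} (i : Cone m) : ℤ × ℤ × ℤ := (i.1.1, i.1.2)

lemma Cone.idx_injective {m : ℕ} : Function.Injective (Cone.idx (m := m)) := fun i j h => by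
  have h1 : (i.1.1 : ℤ) = j.1.1 := congrArg Prod.fst h
  have h2 := congrArg Prod.snd h
  exact Subtype.ext (Prod.ext (by exact_mod_cast h1) h2)

lemma Cone.exists_idx {m : ℕ} {x : ℤ × ℤ × ℤ} (h : fc f (x, (m : ℤ)) ≠ 0) :
    ∃ i : Cone m, i.idx = x := by
  obtain ⟨h1, -, h3⟩ := nonneg_of_fc_ne_zero f h
  obtain ⟨n, r⟩ := x
  lift n to ℕ using h1
  exact ⟨⟨(n, r), h3⟩, rfl⟩

/-- The Fourier-Jacobi coefficient of index `m`. -/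
def fourierJacobi (m : ℕ) : PowerSeries LP :=
  ser (finite_cone m) fun i => AddMonoidAlgebra.single i.1.2 (fc f (i.idx, m))

lemma cf_fourierJacobi (m : ℕ) (x : ℤ × ℤ × ℤ) : cf (fourierJacobi f m) x = fc f (x, m) := by
  rw [fourierJacobi, cf_ser]
  change (∑ᶠ i : Cone m, if i.idx = x then fc f (i.idx, m) else 0) = _
  by_cases h : ∃ i : Cone m, i.idx = x
  · obtain ⟨i, rfl⟩ := h
    rw [finsum_eq_single _ i fun j hj => if_neg fun h => hj (Cone.idx_injective h)]
    exact if_pos rfl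
  · rw [finsum_eq_zero_of_forall_eq_zero fun i => if_neg fun hi => h ⟨i, hi⟩]
    by_contra hne
    exact h (Cone.exists_idx f (Ne.symm hne))

lemma isV_fourierJacobi (hk : Even k) (hs : IsSymmetricHMF f) (m : ℕ) :
    IsV m (fourierJacobi f m) where
  ell x := by rw [cf_fourierJacobi, cf_fourierJacobi, fc_ell f hk]
  rot x := by rw [cf_fourierJacobi, cf_fourierJacobi, smul_zero, add_zero, fc_rot f hk]
  mir x := by rw [cf_fourierJacobi, cf_fourierJacobi, smul_zero, add_zero, fc_mir f hk hs]

lemma jexp_idx {m : ℕ} (t : ℕ) (τ : ℍ) (u : ℂ) (i : Cone m) :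
    jexp t τ u i.idx = qp τ ^ i.1.1 *
      Complex.exp (((i.1.2.1 + t * i.1.2.2 : ℝ) : ℂ) * u) := by
  rw [jexp, qp, ← Complex.exp_nat_mul, ← Complex.exp_add]
  congr 1
  simp only [Cone.idx]
  push_cast
  ring

lemma isJ_fourierJacobi (m t : ℕ) :
    IsJ k (Et t (fourierJacobi f m) * corr (m * (t ^ 2 + t + 1))) := by
  have hterm : ∀ (τ : ℍ) (u : ℂ) (i : Cone m), fc f (i.idx, m) * qp τ ^ i.1.1 *
      Complex.exp (((i.1.2.1 + t * i.1.2.2 : ℝ) : ℂ) * u) =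
        fc f (i.idx, m) * jexp t τ u i.idx := fun τ u i => by
    rw [jexp_idx, mul_assoc]
  have hsum : ∀ (τ : ℍ) (u : ℂ), ∑' i : Cone m, fc f (i.idx, m) * qp τ ^ i.1.1 *
      Complex.exp (((i.1.2.1 + t * i.1.2.2 : ℝ) : ℂ) * u) =
        ∑' x, fc f (x, m) * jexp t τ u x := fun τ u => by
    simp only [hterm]
    exact Cone.idx_injective.tsum_eq fun x hx => Cone.exists_idx f (left_ne_zero_of_mul hx)
  have hT := isTaylor_ser (finite_cone m) (fun i => fc f (i.idx, m))
    (fun i => i.1.2.1 + t * i.1.2.2) fun τ u => by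
      simp only [hterm]
      exact (summable_jexp f t τ u m).comp_injective Cone.idx_injective
  have hEt : Et t (fourierJacobi f m) = swapVars (ser (finite_cone m) fun i =>
      fc f (i.idx, m) • ex ((i.1.2.1 + t * i.1.2.2 : ℝ) : ℂ)) := by
    rw [fourierJacobi, Et_ser]
    congr 3
    funext i
    push_cast
    rfl
  rw [← hEt] at hT
  intro d
  refine isMF_coeff_mul_gauss _ hT.1 k _ _ hT.2 (fun τ τ' u hτ => ?_) d
  simp only [hsum]
  rw [tsum_jexp_inversion f t τ τ' u hτ]
  push_cast
  rfl

lemma coeff_coeff_fourierJacobi (m n : ℕ) (r : ℤ × ℤ) :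
    (coeff n (fourierJacobi f m)).coeff r = fc f (((n : ℤ), r), (m : ℤ)) := by
  rw [← cf_natCast, cf_fourierJacobi]

theorem fc_mem {R : Subring ℂ} (h6 : (1 / 6 : ℂ) ∈ R) (hk : Even k) (hs : IsSymmetricHMF f)
    (hR : ∀ (n m : ℕ) (r : ℤ × ℤ), 9 * (n : ℤ) ≤ k → m ≤ n → fc f (((n : ℤ), r), (m : ℤ)) ∈ R)
    (m : ℕ) : ∀ (n : ℕ) (r : ℤ × ℤ), fc f (((n : ℤ), r), (m : ℤ)) ∈ R := by
  induction m using Nat.strong_induction_on with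
  | _ m ih =>
    have h := (isV_fourierJacobi f hk hs m).mem_jIn h6 (isJ_fourierJacobi f m) fun n hn r => by
      rw [coeff_coeff_fourierJacobi]
      rcases lt_or_ge n m with hnm | hnm
      · rw [← fc_swap f hk]
        exact ih n hnm m _
      · exact hR n m r (by omega) hnm
    intro n r
    rw [← coeff_coeff_fourierJacobi]
    exact h n r

end FourierJacobi

section Integrality

/-- The subring of `p`-integral rational numbers. -/
def pInt (p : ℕ) (hp : p.Prime) : Subring ℂ where
  carrier := {z | IsPIntegral p z}
  mul_mem' := by
    rintro x y ⟨a, b, hb, h⟩ ⟨c, d, hd, h'⟩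
    refine ⟨a * c, b * d, fun hdvd => ?_, ?_⟩
    · exact ((Nat.prime_iff_prime_int.mp hp).dvd_or_dvd hdvd).elim hb hd
    · push_cast
      linear_combination d * y * h + a * h'
  one_mem' := ⟨1, 1, fun h => (Nat.prime_iff_prime_int.mp hp).not_dvd_one h, by simp⟩
  add_mem' := by
    rintro x y ⟨a, b, hb, h⟩ ⟨c, d, hd, h'⟩
    refine ⟨a * d + c * b, b * d, fun hdvd => ?_, ?_⟩
    · exact ((Nat.prime_iff_prime_int.mp hp).dvd_or_dvd hdvd).elim hb hd
    · push_cast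
      linear_combination d * h + b * h'
  zero_mem' := ⟨0, 1, fun h => (Nat.prime_iff_prime_int.mp hp).not_dvd_one h, by simp⟩
  neg_mem' := by
    rintro x ⟨a, b, hb, h⟩
    exact ⟨-a, b, hb, by push_cast; linear_combination -h⟩

lemma one_sixth_mem_pInt {p : ℕ} (hp : p.Prime) (hp5 : 5 ≤ p) : (1 / 6 : ℂ) ∈ pInt p hp := by
  refine ⟨1, 6, fun h => ?_, by norm_num⟩
  have h1 : p ∣ 2 * 3 := by exact_mod_cast h
  rcases hp.dvd_mul.mp h1 with h2 | h2
  · have := Nat.le_of_dvd (by norm_num) h2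
    omega
  · have := Nat.le_of_dvd (by norm_num) h2
    omega

end Integrality

/-- **p-integrality criterion over ℚ(√-3)** (Corollary 1.2 (1), `K = ℚ(√-3)`).
If a symmetric Hermitian modular form of even weight `k` with rational Fourier
coefficients has `a_f([[m, α], [ᾱ, n]]) ∈ ℤ_(p)` for all `0 ≤ m ≤ (5k+9)/45`,
`0 ≤ n ≤ (10k+3)/90`, `α ∈ D_K⁻¹` with `mn - N(α) ≥ 0`, then all its Fourier
coefficients are `p`-integral. -/
theorem integrality_criterion_sqrt_neg_three
    (p : ℕ) (hp : Nat.Prime p) (hp5 : 5 ≤ p) (k : ℤ) (hk : Even k)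
    (f : HermitianModularForm (-3) k) (hsym : IsSymmetricHMF f)
    (hrat : ∀ H, ∃ q : ℚ, f.coeff H = (q : ℂ))
    (hint : ∀ (m n : ℤ) (α : ℂ), α ∈ invDiff (-3) →
      0 ≤ m → 45 * m ≤ 5 * k + 9 → 0 ≤ n → 90 * n ≤ 10 * k + 3 →
      Complex.normSq α ≤ (m : ℝ) * (n : ℝ) →
      IsPIntegral p (f.coeff !![(m : ℂ), α; (starRingEnd ℂ) α, (n : ℂ)])) :
    ∀ H, IsPIntegral p (f.coeff H) := by
  have h := fc_mem f (one_sixth_mem_pInt hp hp5) hk hsym fun n m r hn hmn => by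
    by_cases h0 : fc f (((n : ℤ), r), (m : ℤ)) = 0
    · rw [h0]
      exact Subring.zero_mem _
    · obtain ⟨h1, h2, h3⟩ := nonneg_of_fc_ne_zero f h0
      refine hint n m (alp r) (alp_mem r) h1 (by omega) h2 (by omega) ?_
      rw [normSq_alp, div_le_iff₀ three_pos]
      have h4 : ((r.1 ^ 2 - r.1 * r.2 + r.2 ^ 2 : ℤ) : ℝ) ≤ ((3 * (n : ℤ) * (m : ℤ) : ℤ) : ℝ) :=
        Int.cast_le.mpr h3
      refine h4.trans_eq ?_
      push_cast
      ring
  intro H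
  by_cases h0 : f.coeff H = 0
  · rw [h0]
    exact (pInt p hp).zero_mem
  · obtain ⟨⟨⟨n, r⟩, m⟩, rfl⟩ := exists_Hmat (f.coeff_supported H h0)
    obtain ⟨h1, h2, -⟩ := nonneg_of_fc_ne_zero f (y := ((n, r), m)) h0
    simp only at h1 h2
    lift n to ℕ using h1
    lift m to ℕ using h2
    exact h m n r

end
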